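/- arXiv:2203.02983 — 3 statements merged into one kernel-verified Lean document; each statement's English description precedes it below -/
import Mathlib

section
/- (C¹-robustness for the sharpened dynamics alternative) Let (X,C) be a strongly ordered separable Banach space, F₀ : X → X a compact C¹ map with DF₀(x) strongly positive for all x, pointwise dissipative with attractor A, and F : [−ε₀,ε₀] × X → X a compact C¹ map. Let B₁ ⊃ A be an open ball. Then there exists η > 0 such that whenever sup{‖F_ε x − F₀ x‖ + ‖DF_ε(x) − DF₀(x)‖ : ε ∈ [−ε₀,ε₀], x ∈ B₁} < η, there exist a cone C₁ with nonempty interior satisfying C₁ ⊆ (Int C) ∪ {0}, an open bounded set D₁ with B₁ ⊃ D₁ ⊃ A, integers q, m₁ > 0 and ε₁ > 0 such that for each ε ∈ (−ε₁,ε₁): (i) for each n ≥ q, F_εⁿ(D₁) ⊆ D₁ and F_εⁿx ≪₁ F_εⁿy whenever x, y ∈ D₁ with x <₁ y; and (ii) for each x ∈ D₁, either ω(x,F_ε^q) is a linearly stable cycle of F_ε^q of minimal period at most m₁, or there is δ > 0 such that limsup_{n→∞} ‖F_ε^{nq}x − F_ε^{nq}y‖ ≥ δ for every y ∈ D₁ with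 y <₁ x or y >₁ x. -/
open Filter Topology MeasureTheory Set Bornology Metric
open scoped ENNReal NNReal

noncomputable section

section Defs

variable {X : Type*} [NormedAddCommGroup X] [NormedSpace ℝ X]

/-- A cone in a Banach space: a closed convex set with `r • C ⊆ C` for all `r > 0`
and `C ∩ (-C) = {0}`. -/
def IsCone (C : Set X) : Prop :=
  IsClosed C ∧ Convex ℝ C ∧ (∀ r : ℝ, 0 < r → ∀ x ∈ C, r • x ∈ C) ∧ C ∩ (-C) = {0}

/-- `(X, C)` is strongly ordered: `C` is a cone with nonempty interior. -/
def StronglyOrderedCone (C : Set X) : Prop :=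
  IsCone C ∧ (interior C).Nonempty

/-- `x < y` in the order induced by the cone `C`. -/
def coneLT (C : Set X) (x y : X) : Prop := y - x ∈ C \ {0}

/-- `x ≤ y` in the order induced by the cone `C`. -/
def coneLE (C : Set X) (x y : X) : Prop := y - x ∈ C

/-- `x ≪ y` in the order induced by the cone `C`. -/
def coneLLT (C : Set X) (x y : X) : Prop := y - x ∈ interior C

/-- A bounded linear operator is strongly positive (w.r.t. the cone `C`) if
`T v ≫ 0` whenever `v > 0`. -/
def StronglyPositive (C : Set X) (T : X →L[ℝ] X) : Prop :=
  ∀ v : X, v ∈ C \ {0} → T v ∈ interior C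

/-- A map between normed spaces is compact if it sends bounded sets to relatively
compact sets. -/
def IsCompactMap {Y Z : Type*} [NormedAddCommGroup Y] [NormedAddCommGroup Z]
    (f : Y → Z) : Prop :=
  ∀ B : Set Y, IsBounded B → IsCompact (closure (f '' B))

/-- `h` is pointwise dissipative: some nonempty bounded set `B` attracts every point. -/
def PointwiseDissipative (h : X → X) : Prop :=
  ∃ B : Set X, B.Nonempty ∧ IsBounded B ∧
    ∀ x : X, Tendsto (fun n : ℕ => infDist (h^[n] x) B) atTop (nhds 0)

/-- The set `A` attracts the set `B` under iteration of `h`. -/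
def AttractsSet (h : X → X) (A B : Set X) : Prop :=
  ∀ ε : ℝ, 0 < ε → ∃ N : ℕ, ∀ n : ℕ, N ≤ n → ∀ x ∈ B, infDist (h^[n] x) A < ε

/-- `A` is an attractor of `h`: the maximal compact invariant set attracting every
bounded set. -/
def IsAttractor (h : X → X) (A : Set X) : Prop :=
  A.Nonempty ∧ IsCompact A ∧ h '' A = A ∧
    (∀ B : Set X, IsBounded B → AttractsSet h A B) ∧
    (∀ A' : Set X, IsCompact A' → h '' A' = A' → A' ⊆ A)

/-- The ω-limit set `ω(x,h) = ⋂ₖ closure {hⁿ x : n ≥ k}`. -/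
def omegaMap (h : X → X) (x : X) : Set X :=
  ⋂ k : ℕ, closure {y : X | ∃ n : ℕ, k ≤ n ∧ y = h^[n] x}

/-- The largest Lyapunov exponent `λ_max(x,h) = liminf (log ‖Dhⁿ(x)‖)/n` (in `EReal`). -/
def lambdaMax (h : X → X) (x : X) : EReal :=
  atTop.liminf fun n : ℕ => ((Real.log ‖fderiv ℝ (h^[n]) x‖ / n : ℝ) : EReal)

/-- The principal Lyapunov exponent `λ₁(x,h) = limsup (log ‖Dhⁿ(x)‖)/n` (in `EReal`). -/
def lambdaOne (h : X → X) (x : X) : EReal :=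
  atTop.limsup fun n : ℕ => ((Real.log ‖fderiv ℝ (h^[n]) x‖ / n : ℝ) : EReal)

/-- `S` is a linearly stable cycle of `h` of minimal period `p`: `S` is the orbit of a
`p`-periodic point `z` with spectral radius of `Dhᵖ(z)` at most `1`. -/
def IsLinStableCycle (h : X → X) (p : ℕ) (S : Set X) : Prop :=
  ∃ z : X, h^[p] z = z ∧ (∀ l : ℕ, 0 < l → l < p → h^[l] z ≠ z) ∧
    spectralRadius ℝ (fderiv ℝ (h^[p]) z) ≤ 1 ∧ S = {y : X | ∃ n : ℕ, y = h^[n] z}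

/-- `S` is a linearly stable cycle of `h` of minimal period at most `m`. -/
def IsLinStableCycleLe (h : X → X) (m : ℕ) (S : Set X) : Prop :=
  ∃ p : ℕ, 0 < p ∧ p ≤ m ∧ IsLinStableCycle h p S

/-- Semiflow axioms for `Φ : ℝ → X → X` (restricted to nonnegative times). -/
def IsSemiflow (Φ : ℝ → X → X) : Prop :=
  (∀ x : X, Φ 0 x = x) ∧
    (∀ s t : ℝ, 0 ≤ s → 0 ≤ t → ∀ x : X, Φ (t + s) x = Φ t (Φ s x)) ∧
    ContinuousOn (fun p : ℝ × X => Φ p.1 p.2) (Ici (0 : ℝ) ×ˢ (univ : Set X))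

/-- The ω-limit set of `x` under a semiflow. -/
def omegaFlow (Φ : ℝ → X → X) (x : X) : Set X :=
  ⋂ s : ℝ, closure {y : X | ∃ t : ℝ, s ≤ t ∧ y = Φ t x}

/-- The largest Lyapunov exponent of `x` w.r.t. a semiflow. -/
def lambdaMaxFlow (Φ : ℝ → X → X) (x : X) : EReal :=
  atTop.liminf fun t : ℝ => ((Real.log ‖fderiv ℝ (Φ t) x‖ / t : ℝ) : EReal)

/-- The principal Lyapunov exponent of `x` w.r.t. a semiflow. -/
def lambdaOneFlow (Φ : ℝ → X → X) (x : X) : EReal :=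
  atTop.limsup fun t : ℝ => ((Real.log ‖fderiv ℝ (Φ t) x‖ / t : ℝ) : EReal)

end Defs

section Shy

variable {X : Type*} [NormedAddCommGroup X] [NormedSpace ℝ X] [MeasurableSpace X]

/-- A Borel set `W` is shy if there is a nonzero compactly supported Borel measure `μ`
with `μ(x + W) = 0` for every `x`. -/
def IsShy (W : Set X) : Prop :=
  MeasurableSet W ∧
    ∃ μ : Measure X, μ ≠ 0 ∧ (∃ K : Set X, IsCompact K ∧ μ Kᶜ = 0) ∧
      ∀ x : X, μ ((fun w => x + w) '' W) = 0

/-- `W` is prevalent in `V` if `V \ W` is shy. -/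
def IsPrevalentIn (V W : Set X) : Prop := IsShy (V \ W)

end Shy

section Cones

variable {X : Type*} [NormedAddCommGroup X] [NormedSpace ℝ X]

/-- `C` is a closed pointed convex cone for which the unit vector `u` is an order unit,
with `v ≤ (M * ‖v‖) • u` for every `v`. -/
structure IsOrderUnitCone (C : Set X) (u : X) (M : ℝ) : Prop where
  isClosed : IsClosed C
  add_mem : ∀ {v w : X}, v ∈ C → w ∈ C → v + w ∈ C
  smul_mem : ∀ {a : ℝ} {v : X}, 0 ≤ a → v ∈ C → a • v ∈ C
  eq_zero : ∀ {v : X}, v ∈ C → -v ∈ C → v = 0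
  norm_unit : ‖u‖ = 1
  unit_mem : u ∈ C
  unit_sub_mem : ∀ v : X, (M * ‖v‖) • u - v ∈ C

namespace IsOrderUnitCone

variable {C : Set X} {u : X} {M : ℝ}

lemma unit_ne_zero (hC : IsOrderUnitCone C u M) : u ≠ 0 := by
  intro h
  have := hC.norm_unit
  simp [h] at this

lemma zero_mem (hC : IsOrderUnitCone C u M) : (0 : X) ∈ C := by
  simpa using hC.smul_mem le_rfl hC.unit_mem

lemma nonneg_of_smul_mem (hC : IsOrderUnitCone C u M) {a : ℝ} {v : X} (hv : v ∈ C)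
    (hv0 : v ≠ 0) (h : a • v ∈ C) : 0 ≤ a := by
  by_contra! ha
  apply hv0
  apply hC.eq_zero hv
  have := hC.smul_mem (a := (-a)⁻¹) (by simpa using ha.le) h
  rwa [smul_smul, inv_neg, neg_mul, inv_mul_cancel₀ ha.ne, neg_one_smul] at this

lemma nonneg_of_smul_unit_mem (hC : IsOrderUnitCone C u M) {a : ℝ} (h : a • u ∈ C) : 0 ≤ a :=
  hC.nonneg_of_smul_mem hC.unit_mem hC.unit_ne_zero h

lemma one_le (hC : IsOrderUnitCone C u M) : 1 ≤ M := by
  have h := hC.unit_sub_mem u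
  rw [hC.norm_unit] at h
  have := hC.nonneg_of_smul_unit_mem (a := M * 1 - 1) (by convert h using 1; module)
  linarith

lemma pos (hC : IsOrderUnitCone C u M) : 0 < M := by linarith [hC.one_le]

lemma unit_add_mem (hC : IsOrderUnitCone C u M) (v : X) : (M * ‖v‖) • u + v ∈ C := by
  simpa using hC.unit_sub_mem (-v)

lemma sub_smul_mem_of_le (hC : IsOrderUnitCone C u M) {a b : ℝ} {v w : X} (hv : v ∈ C)
    (h : w - a • v ∈ C) (hab : b ≤ a) : w - b • v ∈ C := by
  have := hC.add_mem h (hC.smul_mem (sub_nonneg.2 hab) hv)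
  convert this using 1; module

lemma smul_sub_mem_of_le (hC : IsOrderUnitCone C u M) {a b : ℝ} {v w : X} (hv : v ∈ C)
    (h : a • v - w ∈ C) (hab : a ≤ b) : b • v - w ∈ C := by
  have := hC.add_mem h (hC.smul_mem (sub_nonneg.2 hab) hv)
  convert this using 1; module

lemma sub_mem_trans (hC : IsOrderUnitCone C u M) {x y z : X} (h : y - x ∈ C) (h' : z - y ∈ C) :
    z - x ∈ C := by
  have := hC.add_mem h h'
  convert this using 1; module

lemma le_mul_norm (hC : IsOrderUnitCone C u M) {a : ℝ} {w : X} (h : w - a • u ∈ C) :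
    a ≤ M * ‖w‖ := by
  have := hC.nonneg_of_smul_unit_mem (a := M * ‖w‖ - a)
    (by convert hC.add_mem h (hC.unit_sub_mem w) using 1; module)
  linarith

lemma unit_sub_mem_of_norm_le (hC : IsOrderUnitCone C u M) {a : ℝ} {v : X} (h : M * ‖v‖ ≤ a) :
    a • u - v ∈ C :=
  hC.smul_sub_mem_of_le hC.unit_mem (hC.unit_sub_mem v) h

lemma unit_add_mem_of_norm_le (hC : IsOrderUnitCone C u M) {a : ℝ} {v : X} (h : M * ‖v‖ ≤ a) :
    a • u + v ∈ C := by
  simpa using hC.unit_sub_mem_of_norm_le (v := -v) (by simpa using h)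

lemma mem_interior (hC : IsOrderUnitCone C u M) {a : ℝ} {w : X} (ha : 0 < a)
    (h : w - a • u ∈ C) : w ∈ interior C := by
  rw [_root_.mem_interior]
  refine ⟨ball w (a / M), fun z hz => ?_, isOpen_ball, mem_ball_self (div_pos ha hC.pos)⟩
  rw [mem_ball, dist_eq_norm, lt_div_iff₀ hC.pos] at hz
  convert hC.add_mem h (hC.unit_add_mem_of_norm_le (a := a) (v := z - w) (by linarith)) using 1
  module

lemma convex (hC : IsOrderUnitCone C u M) : Convex ℝ C :=
  fun _ hx _ hy _ _ ha hb _ => hC.add_mem (hC.smul_mem ha hx) (hC.smul_mem hb hy)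

lemma isCone (hC : IsOrderUnitCone C u M) : IsCone C := by
  refine ⟨hC.isClosed, hC.convex, fun r hr x hx => hC.smul_mem hr.le hx, ?_⟩
  ext x
  constructor
  · rintro ⟨h, h'⟩
    exact hC.eq_zero h h'
  · rintro rfl
    exact ⟨hC.zero_mem, by simpa using hC.zero_mem⟩

/-- A compact subset of the interior of the cone is uniformly above a multiple of the unit. -/
lemma exists_unit_le_of_isCompact (hC : IsOrderUnitCone C u M) {K : Set X} (hK : IsCompact K)
    (hKC : K ⊆ interior C) : ∃ a : ℝ, 0 < a ∧ ∀ z ∈ K, z - a • u ∈ C := by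
  obtain ⟨δ, hδ, h⟩ := hK.exists_thickening_subset_open isOpen_interior hKC
  refine ⟨δ / 2, half_pos hδ, fun z hz => interior_subset (h ?_)⟩
  rw [mem_thickening_iff]
  refine ⟨z, hz, ?_⟩
  rw [dist_eq_norm, sub_sub_cancel_left, norm_neg, norm_smul, hC.norm_unit, Real.norm_eq_abs,
    abs_of_pos (half_pos hδ)]
  linarith

end IsOrderUnitCone

lemma StronglyOrderedCone.exists_isOrderUnitCone [Nontrivial X] {C : Set X}
    (hC : StronglyOrderedCone C) : ∃ (u : X) (M : ℝ), IsOrderUnitCone C u M := by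
  obtain ⟨⟨hcl, hconv, hsmul, hpt⟩, u₀, hu₀⟩ := hC
  have h0 : (0 : X) ∈ C := by
    have : (0 : X) ∈ C ∩ -C := by rw [hpt]; rfl
    exact this.1
  have hsm : ∀ {a : ℝ} {v : X}, 0 ≤ a → v ∈ C → a • v ∈ C := by
    intro a v ha hv
    rcases ha.eq_or_lt with rfl | ha
    · simpa using h0
    · exact hsmul a ha v hv
  have hadd : ∀ {v w : X}, v ∈ C → w ∈ C → v + w ∈ C := by
    intro v w hv hw
    have := hsmul 2 two_pos _ (hconv hv hw (a := 1 / 2) (b := 1 / 2) (by norm_num) (by norm_num)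
      (by norm_num))
    convert this using 1; module
  have hpt' : ∀ {v : X}, v ∈ C → -v ∈ C → v = 0 := by
    intro v hv hv'
    have : v ∈ C ∩ -C := ⟨hv, hv'⟩
    rwa [hpt] at this
  obtain ⟨ρ, hρ, hball⟩ := Metric.isOpen_iff.1 isOpen_interior u₀ hu₀
  have key : ∀ v : X, (2 / ρ * ‖v‖) • u₀ - v ∈ C := by
    intro v
    rcases eq_or_ne v 0 with rfl | hv
    · simpa using h0
    have hv' : 0 < ‖v‖ := norm_pos_iff.2 hv
    have h1 : u₀ - (ρ / (2 * ‖v‖)) • v ∈ C := by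
      apply interior_subset
      apply hball
      rw [mem_ball, dist_eq_norm, sub_sub_cancel_left, norm_neg, norm_smul, Real.norm_eq_abs,
        abs_of_pos (by positivity)]
      field_simp
      linarith
    have h2 := hsm (a := 2 / ρ * ‖v‖) (by positivity) h1
    convert h2 using 1
    rw [smul_sub, smul_smul]
    congr 1
    have : 2 / ρ * ‖v‖ * (ρ / (2 * ‖v‖)) = 1 := by field_simp
    rw [this, one_smul]
  have hu0 : u₀ ≠ 0 := by
    rintro rfl
    obtain ⟨v, hv⟩ := exists_ne (0 : X)
    exact hv (hpt' (by simpa using key (-v)) (by simpa using key v))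
  have hu0' : 0 < ‖u₀‖ := norm_pos_iff.2 hu0
  refine ⟨‖u₀‖⁻¹ • u₀, 2 / ρ * ‖u₀‖, hcl, hadd, hsm, hpt', ?_, ?_, ?_⟩
  · rw [norm_smul, norm_inv, norm_norm, inv_mul_cancel₀ hu0'.ne']
  · exact hsm (by positivity) (interior_subset hu₀)
  · intro v
    convert key v using 2
    rw [smul_smul]
    congr 1
    field_simp

/-- The cone of all `v` with `v ≥ (κ * ‖v‖) • u`. -/
def narrowCone (C : Set X) (u : X) (κ : ℝ) : Set X := {v | v - (κ * ‖v‖) • u ∈ C}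

namespace IsOrderUnitCone

variable {C : Set X} {u : X} {M κ : ℝ}

lemma narrowCone_subset (hC : IsOrderUnitCone C u M) (hκ : 0 ≤ κ) : narrowCone C u κ ⊆ C := by
  intro v hv
  have := hC.add_mem hv (hC.smul_mem (a := κ * ‖v‖) (by positivity) hC.unit_mem)
  simpa using this

lemma mem_narrowCone_of_le (hC : IsOrderUnitCone C u M) {b : ℝ} {w : X}
    (h : w - b • u ∈ C) (hb : κ * ‖w‖ ≤ b) : w ∈ narrowCone C u κ :=
  hC.sub_smul_mem_of_le hC.unit_mem h hb

lemma narrowCone_normal (hC : IsOrderUnitCone C u M) (hκ : 0 < κ) {v w : X}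
    (hv : v ∈ narrowCone C u κ) (hw : w - v ∈ narrowCone C u κ) : ‖v‖ ≤ M / κ * ‖w‖ := by
  have := hC.le_mul_norm (a := κ * ‖v‖) (w := w) (by
    have := hC.add_mem hv (hC.narrowCone_subset hκ.le hw)
    convert this using 1; module)
  rw [div_mul_eq_mul_div, le_div_iff₀ hκ]
  linarith

lemma isOrderUnitCone_narrowCone (hC : IsOrderUnitCone C u M) (hκ : 0 < κ) (hκ1 : κ < 1) :
    IsOrderUnitCone (narrowCone C u κ) u ((M + κ) / (1 - κ)) where
  isClosed := by
    have : Continuous fun v : X => v - (κ * ‖v‖) • u := by fun_prop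
    exact hC.isClosed.preimage this
  add_mem := by
    intro v w hv hw
    apply hC.mem_narrowCone_of_le (b := κ * ‖v‖ + κ * ‖w‖)
    · convert hC.add_mem hv hw using 1; module
    · rw [← mul_add]
      gcongr
      exact norm_add_le _ _
  smul_mem := by
    intro a v ha hv
    apply hC.mem_narrowCone_of_le (b := a * (κ * ‖v‖))
    · convert hC.smul_mem ha hv using 1; module
    · rw [norm_smul, Real.norm_eq_abs, abs_of_nonneg ha]
      linarith
  eq_zero := fun hv hv' => hC.eq_zero (hC.narrowCone_subset hκ.le hv)
    (hC.narrowCone_subset hκ.le hv')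
  norm_unit := hC.norm_unit
  unit_mem := by
    apply hC.mem_narrowCone_of_le (b := 1)
    · simpa using hC.zero_mem
    · rw [hC.norm_unit]; linarith
  unit_sub_mem := by
    intro v
    have h1 : 0 < 1 - κ := by linarith
    have hM := hC.pos
    set a := (M + κ) / (1 - κ) * ‖v‖ with ha
    have ha0 : 0 ≤ a := by positivity
    have e : a * (1 - κ) = (M + κ) * ‖v‖ := by rw [ha]; field_simp
    apply hC.mem_narrowCone_of_le (b := a - M * ‖v‖)
    · convert hC.unit_sub_mem v using 1; module
    · have h2 : ‖a • u - v‖ ≤ a + ‖v‖ := by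
        refine (norm_sub_le _ _).trans ?_
        rw [norm_smul, hC.norm_unit, Real.norm_eq_abs, abs_of_nonneg ha0, mul_one]
      nlinarith

end IsOrderUnitCone

end Cones

section LinearCocycles

variable {X : Type*} [NormedAddCommGroup X] [NormedSpace ℝ X]

/-- The product `L (n - 1) ∘ ⋯ ∘ L 0`. -/
def opProd (L : ℕ → X →L[ℝ] X) : ℕ → X →L[ℝ] X
  | 0 => ContinuousLinearMap.id ℝ X
  | n + 1 => (L n).comp (opProd L n)

@[simp] lemma opProd_zero_apply (L : ℕ → X →L[ℝ] X) (v : X) : opProd L 0 v = v := rfl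

@[simp] lemma opProd_succ_apply (L : ℕ → X →L[ℝ] X) (n : ℕ) (v : X) :
    opProd L (n + 1) v = L n (opProd L n v) := rfl

lemma opProd_add_apply (L : ℕ → X →L[ℝ] X) (m n : ℕ) (v : X) :
    opProd L (m + n) v = opProd (fun i => L (m + i)) n (opProd L m v) := by
  induction n with
  | zero => rfl
  | succ n ih => rw [← add_assoc, opProd_succ_apply, ih, opProd_succ_apply]

lemma norm_opProd_le {L : ℕ → X →L[ℝ] X} {Λ : ℝ} (hΛ : 0 ≤ Λ) {n : ℕ} (hL : ∀ i < n, ‖L i‖ ≤ Λ) :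
    ‖opProd L n‖ ≤ Λ ^ n := by
  induction n with
  | zero => simpa [opProd] using ContinuousLinearMap.norm_id_le
  | succ n ih =>
    calc ‖(L n).comp (opProd L n)‖ ≤ ‖L n‖ * ‖opProd L n‖ := ContinuousLinearMap.opNorm_comp_le _ _
      _ ≤ Λ * Λ ^ n := by
        gcongr
        · exact hL n n.lt_succ_self
        · exact ih fun i hi => hL i (hi.trans n.lt_succ_self)
      _ = Λ ^ (n + 1) := (pow_succ' _ _).symm

lemma exists_norm_opProd_sub_le (Λ : ℝ) (n : ℕ) {e : ℝ} (he : 0 < e) :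
    ∃ ε : ℝ, 0 < ε ∧ ∀ L T : ℕ → X →L[ℝ] X, (∀ i < n, ‖T i‖ ≤ Λ) → (∀ i < n, ‖L i - T i‖ ≤ ε) →
      ‖opProd L n - opProd T n‖ ≤ e := by
  wlog hΛ : 0 ≤ Λ generalizing Λ
  · obtain ⟨ε, hε, h⟩ := this 0 le_rfl
    exact ⟨ε, hε, fun L T hT => h L T fun i hi => (hT i hi).trans (le_of_not_ge hΛ)⟩
  induction n generalizing e with
  | zero => exact ⟨1, one_pos, fun L T _ _ => by simp [opProd, he.le]⟩
  | succ n ih =>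
    obtain ⟨ε, hε, h⟩ := ih (e := e / (2 * (Λ + 1))) (by positivity)
    refine ⟨min (min ε 1) (e / (2 * (Λ ^ n + 1))), by positivity, fun L T hT hLT => ?_⟩
    have h1 := h L T (fun i hi => hT i (hi.trans n.lt_succ_self))
      fun i hi => (hLT i (hi.trans n.lt_succ_self)).trans
        ((min_le_left _ _).trans (min_le_left _ _))
    have h2 := hLT n n.lt_succ_self
    have h3 := h2.trans ((min_le_left _ _).trans (min_le_right _ _))
    have h4 := h2.trans (min_le_right _ _)
    have h5 := norm_opProd_le hΛ fun i (hi : i < n) => hT i (hi.trans n.lt_succ_self)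
    have h6 : ‖L n‖ ≤ Λ + 1 := by
      have := norm_le_norm_add_norm_sub (T n) (L n)
      have := hT n n.lt_succ_self
      have := norm_sub_rev (L n) (T n)
      linarith
    have e1 : opProd L (n + 1) - opProd T (n + 1)
        = (L n).comp (opProd L n - opProd T n) + (L n - T n).comp (opProd T n) := by
      ext v; simp
    rw [e1]
    calc _ ≤ ‖L n‖ * ‖opProd L n - opProd T n‖ + ‖L n - T n‖ * ‖opProd T n‖ :=
          (norm_add_le _ _).trans (add_le_add (ContinuousLinearMap.opNorm_comp_le _ _)
            (ContinuousLinearMap.opNorm_comp_le _ _))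
      _ ≤ (Λ + 1) * (e / (2 * (Λ + 1))) + e / (2 * (Λ ^ n + 1)) * (Λ ^ n + 1) := by
          gcongr
          linarith
      _ = e := by field_simp; ring

/-- `L` maps the cone into its interior, with a lower bound `σ`. -/
def UniformlyPositive (C : Set X) (u : X) (σ : ℝ) (L : X →L[ℝ] X) : Prop :=
  ∀ v ∈ C, L v - (σ * ‖v‖) • u ∈ C

variable {C : Set X} {u : X} {M : ℝ}

namespace UniformlyPositive

lemma mem (hC : IsOrderUnitCone C u M) {σ : ℝ} (hσ : 0 ≤ σ) {L : X →L[ℝ] X}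
    (hL : UniformlyPositive C u σ L) {v : X} (hv : v ∈ C) : L v ∈ C := by
  have := hC.add_mem (hL v hv) (hC.smul_mem (a := σ * ‖v‖) (by positivity) hC.unit_mem)
  simpa using this

lemma le_norm (hC : IsOrderUnitCone C u M) {σ : ℝ} {L : X →L[ℝ] X}
    (hL : UniformlyPositive C u σ L) {v : X} (hv : v ∈ C) : σ / M * ‖v‖ ≤ ‖L v‖ := by
  have := hC.le_mul_norm (hL v hv)
  rw [div_mul_eq_mul_div, div_le_iff₀ hC.pos]
  linarith

lemma of_norm_sub_le (hC : IsOrderUnitCone C u M) {σ e : ℝ} {L T : X →L[ℝ] X}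
    (hT : UniformlyPositive C u σ T) (h : ‖L - T‖ ≤ e) :
    UniformlyPositive C u (σ - M * e) L := by
  intro v hv
  have h1 : ‖(L - T) v‖ ≤ e * ‖v‖ := (L - T).le_of_opNorm_le h v
  have h2 := hC.unit_add_mem_of_norm_le (a := M * e * ‖v‖) (v := (L - T) v)
    (by rw [mul_assoc]; exact mul_le_mul_of_nonneg_left h1 hC.pos.le)
  convert hC.add_mem (hT v hv) h2 using 1
  rw [_root_.sub_apply]
  module

lemma mono (hC : IsOrderUnitCone C u M) {σ τ : ℝ} {L : X →L[ℝ] X}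
    (hL : UniformlyPositive C u σ L) (h : τ ≤ σ) : UniformlyPositive C u τ L :=
  fun v hv => hC.sub_smul_mem_of_le hC.unit_mem (hL v hv) (by gcongr)

end UniformlyPositive

/-- The images of a bounded set under a compact family of compact operators. -/
lemma isCompact_closure_image2 [CompleteSpace X] {𝒯 : Set (X →L[ℝ] X)} (h𝒯 : IsCompact 𝒯)
    (hcpt : ∀ T ∈ 𝒯, IsCompactOperator T) (ρ : ℝ) :
    IsCompact (closure (image2 (fun (T : X →L[ℝ] X) v => T v) 𝒯 (closedBall 0 ρ))) := by
  refine (TotallyBounded.closure ?_).isCompact_of_isClosed isClosed_closure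
  rw [Metric.totallyBounded_iff]
  intro ε hε
  obtain ⟨t, ht𝒯, htf, ht⟩ := Metric.finite_approx_of_totallyBounded
    h𝒯.totallyBounded (ε / (2 * (|ρ| + 1))) (by positivity)
  have key : TotallyBounded (⋃ T ∈ t, (fun v => T v) '' closedBall (0 : X) ρ) := by
    refine (totallyBounded_biUnion htf).2 fun T hT => ?_
    have := (hcpt T (ht𝒯 hT)).isCompact_closure_image_closedBall (f := (T : X →ₗ[ℝ] X)) ρ
    exact this.totallyBounded.subset subset_closure
  obtain ⟨s, hsf, hs⟩ := Metric.totallyBounded_iff.1 key (ε / 2) (half_pos hε)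
  refine ⟨s, hsf, ?_⟩
  rintro _ ⟨S, hS, v, hv, rfl⟩
  have h1 := ht hS
  simp only [mem_iUnion, exists_prop] at h1
  obtain ⟨T, hT, hST⟩ := h1
  have h2 : T v ∈ ⋃ y ∈ s, ball y (ε / 2) := hs (by
    simp only [mem_iUnion, exists_prop]
    exact ⟨T, hT, v, hv, rfl⟩)
  simp only [mem_iUnion, exists_prop] at h2 ⊢
  obtain ⟨y, hy, hTy⟩ := h2
  refine ⟨y, hy, ?_⟩
  rw [mem_ball] at hTy hST ⊢
  have h3 : dist (S v) (T v) ≤ ε / 2 := by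
    rw [dist_eq_norm] at hST ⊢
    have hv' : ‖v‖ ≤ |ρ| + 1 := by
      rw [mem_closedBall_zero_iff] at hv
      linarith [le_abs_self ρ]
    calc ‖S v - T v‖ = ‖(S - T) v‖ := rfl
      _ ≤ ‖S - T‖ * ‖v‖ := (S - T).le_opNorm v
      _ ≤ ε / (2 * (|ρ| + 1)) * (|ρ| + 1) := by gcongr
      _ = ε / 2 := by field_simp
  calc dist (S v) y ≤ dist (S v) (T v) + dist (T v) y := dist_triangle _ _ _
    _ < ε := by linarith

/-- A compact family of compact strongly positive operators. -/
structure IsPositiveFamily (C : Set X) (𝒯 : Set (X →L[ℝ] X)) : Prop where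
  isCompact : IsCompact 𝒯
  compactOperator : ∀ T ∈ 𝒯, IsCompactOperator T
  stronglyPositive : ∀ T ∈ 𝒯, StronglyPositive C T

namespace IsPositiveFamily

variable {𝒯 : Set (X →L[ℝ] X)}

lemma apply_mem (h𝒯 : IsPositiveFamily C 𝒯) (hC : IsOrderUnitCone C u M) {T : X →L[ℝ] X}
    (hT : T ∈ 𝒯) {v : X} (hv : v ∈ C) : T v ∈ C := by
  rcases eq_or_ne v 0 with rfl | h
  · simpa using hC.zero_mem
  · exact interior_subset (h𝒯.stronglyPositive T hT v ⟨hv, h⟩)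

lemma opProd_mem (h𝒯 : IsPositiveFamily C 𝒯) (hC : IsOrderUnitCone C u M) {L : ℕ → X →L[ℝ] X}
    (hL : ∀ i, L i ∈ 𝒯) {v : X} (hv : v ∈ C) (n : ℕ) : opProd L n v ∈ C := by
  induction n with
  | zero => exact hv
  | succ n ih => exact h𝒯.apply_mem hC (hL n) ih

lemma exists_unit_le_apply_unit (h𝒯 : IsPositiveFamily C 𝒯) (hC : IsOrderUnitCone C u M) :
    ∃ b : ℝ, 0 < b ∧ ∀ T ∈ 𝒯, T u - b • u ∈ C := by
  obtain ⟨b, hb, h⟩ := hC.exists_unit_le_of_isCompact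
    (h𝒯.isCompact.image (f := fun T : X →L[ℝ] X => T u) (by fun_prop)) (by
      rintro _ ⟨T, hT, rfl⟩
      exact h𝒯.stronglyPositive T hT u ⟨hC.unit_mem, hC.unit_ne_zero⟩)
  exact ⟨b, hb, fun T hT => h _ ⟨T, hT, rfl⟩⟩

lemma exists_norm_le (h𝒯 : IsPositiveFamily C 𝒯) : ∃ Λ : ℝ, 1 ≤ Λ ∧ ∀ T ∈ 𝒯, ‖T‖ ≤ Λ := by
  obtain ⟨Λ, h⟩ := h𝒯.isCompact.isBounded.exists_norm_le
  exact ⟨max 1 Λ, le_max_left _ _, fun T hT => (h T hT).trans (le_max_right _ _)⟩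

/-- On positive vectors in the image of a ball, bounded away from zero, the operators of the family
are uniformly strongly positive. -/
lemma exists_unit_le_apply_apply [CompleteSpace X] (h𝒯 : IsPositiveFamily C 𝒯)
    (hC : IsOrderUnitCone C u M) (ρ : ℝ) {ε : ℝ} (hε : 0 < ε) :
    ∃ κ : ℝ, 0 < κ ∧ ∀ S ∈ 𝒯, ∀ T ∈ 𝒯, ∀ v : X, ∀ s : ℝ, 0 < s → ‖v‖ ≤ ρ * s → S v ∈ C →
      ε * s ≤ ‖S v‖ → T (S v) - (κ * s) • u ∈ C := by
  set Z := closure (image2 (fun (T : X →L[ℝ] X) v => T v) 𝒯 (closedBall 0 ρ)) ∩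
    (C ∩ {z | ε ≤ ‖z‖}) with hZ
  have hZc : IsCompact Z := (isCompact_closure_image2 h𝒯.isCompact h𝒯.compactOperator ρ).inter_right
    (hC.isClosed.inter (isClosed_le continuous_const continuous_norm))
  obtain ⟨κ, hκ, h⟩ := hC.exists_unit_le_of_isCompact
    ((h𝒯.isCompact.prod hZc).image (f := fun p : (X →L[ℝ] X) × X => p.1 p.2) (by fun_prop)) (by
      rintro _ ⟨⟨T, z⟩, ⟨hT, hz⟩, rfl⟩
      refine h𝒯.stronglyPositive T hT z ⟨hz.2.1, ?_⟩
      rintro rfl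
      have := hz.2.2
      simp only [Set.mem_ofPred_eq, norm_zero] at this
      linarith)
  refine ⟨κ, hκ, fun S hS T hT v s hs hv hSv hn => ?_⟩
  have h1 : S (s⁻¹ • v) ∈ Z := by
    refine ⟨subset_closure ⟨S, hS, s⁻¹ • v, ?_, rfl⟩, ?_, ?_⟩
    · rw [mem_closedBall_zero_iff, norm_smul, Real.norm_eq_abs, abs_of_pos (inv_pos.2 hs),
        inv_mul_le_iff₀ hs]
      linarith
    · rw [map_smul]
      exact hC.smul_mem (inv_pos.2 hs).le hSv
    · rw [Set.mem_ofPred_eq, map_smul, norm_smul, Real.norm_eq_abs, abs_of_pos (inv_pos.2 hs),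
        le_inv_mul_iff₀ hs]
      linarith
  have h2 := hC.smul_mem hs.le (h _ ⟨(T, _), ⟨hT, h1⟩, rfl⟩)
  convert h2 using 1
  simp only [map_smul, smul_sub, smul_smul, mul_inv_cancel₀ hs.ne', one_smul]
  rw [mul_comm]

end IsPositiveFamily

end LinearCocycles

section LinearCocycles

variable {X : Type*} [NormedAddCommGroup X] [NormedSpace ℝ X]
variable {C : Set X} {u : X} {M : ℝ}

namespace IsPositiveFamily

variable {𝒯 : Set (X →L[ℝ] X)}

lemma exists_unit_le_opProd_unit [CompleteSpace X] (h𝒯 : IsPositiveFamily C 𝒯)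
    (hC : IsOrderUnitCone C u M) :
    ∃ R : ℝ, 1 ≤ R ∧ ∀ L : ℕ → X →L[ℝ] X, (∀ i, L i ∈ 𝒯) → ∀ n,
      opProd L n u - (‖opProd L n u‖ / R) • u ∈ C := by
  obtain ⟨b, hb, hbT⟩ := h𝒯.exists_unit_le_apply_unit hC
  obtain ⟨Λ, hΛ1, hΛ⟩ := h𝒯.exists_norm_le
  have hΛ0 : 0 < Λ := by linarith
  obtain ⟨κ, hκ, hD⟩ := h𝒯.exists_unit_le_apply_apply hC (1 / b ^ 2) (ε := 1 / Λ) (by positivity)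
  set R := max 1 (max (Λ / b) (1 / κ)) with hR
  have hR1 : 1 ≤ R := le_max_left _ _
  have hR0 : 0 < R := by linarith
  have hRb : Λ / R ≤ b := by
    rw [div_le_iff₀ hR0, ← div_le_iff₀' hb]
    exact (le_max_left _ _).trans (le_max_right _ _)
  have hRκ : 1 / R ≤ κ := by
    rw [div_le_iff₀ hR0, ← div_le_iff₀' hκ]
    exact (le_max_right _ _).trans (le_max_right _ _)
  refine ⟨R, hR1, fun L hL n => ?_⟩
  induction n using Nat.twoStepInduction with
  | zero =>
    refine hC.sub_smul_mem_of_le hC.unit_mem (a := 1) (by simpa using hC.zero_mem) ?_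
    rw [opProd_zero_apply, hC.norm_unit]
    exact (div_le_one hR0).2 hR1
  | one =>
    refine hC.sub_smul_mem_of_le hC.unit_mem (hbT _ (hL 0)) (le_trans ?_ hRb)
    gcongr
    have := (L 0).le_of_opNorm_le (hΛ _ (hL 0)) u
    rwa [hC.norm_unit, mul_one] at this
  | more n ih _ =>
    set v := opProd L n u with hv
    have e2 : opProd L (n + 2) u = L (n + 1) (L n v) := rfl
    rw [e2]
    set s := ‖L (n + 1) (L n v)‖ with hs
    rcases (norm_nonneg (L (n + 1) (L n v))).eq_or_lt with h0 | h0
    · rw [hs, ← h0]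
      simpa using h𝒯.apply_mem hC (hL _) (h𝒯.apply_mem hC (hL n)
        (h𝒯.opProd_mem hC hL hC.unit_mem n))
    by_cases hcase : ‖v‖ ≤ 1 / b ^ 2 * s
    · have := hD _ (hL n) _ (hL (n + 1)) v s h0 hcase
        (h𝒯.apply_mem hC (hL n) (h𝒯.opProd_mem hC hL hC.unit_mem n)) (by
          have := (L (n + 1)).le_of_opNorm_le (hΛ _ (hL (n + 1))) (L n v)
          rw [div_mul_eq_mul_div, one_mul, div_le_iff₀ hΛ0]
          linarith)
      refine hC.sub_smul_mem_of_le hC.unit_mem this ?_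
      rw [div_eq_mul_one_div, mul_comm]
      exact mul_le_mul_of_nonneg_right hRκ h0.le
    · have h1 := h𝒯.apply_mem hC (hL (n + 1)) (h𝒯.apply_mem hC (hL n) ih)
      have h2 := h𝒯.apply_mem hC (hL (n + 1)) (hbT _ (hL n))
      have h3 := hC.smul_mem hb.le (hbT _ (hL (n + 1)))
      have h4 := hC.add_mem h1 (hC.smul_mem (a := ‖v‖ / R) (by positivity) (hC.add_mem h2 h3))
      refine hC.sub_smul_mem_of_le hC.unit_mem (a := ‖v‖ / R * b ^ 2) ?_ ?_
      · convert h4 using 1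
        simp only [map_sub, map_smul]
        module
      · rw [not_le, div_mul_eq_mul_div, one_mul, div_lt_iff₀ (by positivity)] at hcase
        rw [div_mul_eq_mul_div]
        gcongr

lemma exists_norm_opProd_unit_le_succ [CompleteSpace X] (h𝒯 : IsPositiveFamily C 𝒯)
    (hC : IsOrderUnitCone C u M) :
    ∃ c : ℝ, 0 < c ∧ ∀ L : ℕ → X →L[ℝ] X, (∀ i, L i ∈ 𝒯) → ∀ n,
      ‖opProd L n u‖ ≤ c * ‖opProd L (n + 1) u‖ := by
  obtain ⟨b, hb, hbT⟩ := h𝒯.exists_unit_le_apply_unit hC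
  obtain ⟨R, hR1, hR⟩ := h𝒯.exists_unit_le_opProd_unit hC
  have hR0 : 0 < R := by linarith
  have hM := hC.pos
  refine ⟨M * R / b, by positivity, fun L hL n => ?_⟩
  have h1 := h𝒯.apply_mem hC (hL n) (hR L hL n)
  have h2 := hC.smul_mem (a := ‖opProd L n u‖ / R) (by positivity) (hbT _ (hL n))
  have h3 : opProd L (n + 1) u - (‖opProd L n u‖ / R * b) • u ∈ C := by
    convert hC.add_mem h1 h2 using 1
    simp only [map_sub, map_smul, opProd_succ_apply]
    module
  have h4 := hC.le_mul_norm h3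
  rw [div_mul_eq_mul_div, div_le_iff₀ hR0] at h4
  rw [div_mul_eq_mul_div, le_div_iff₀ hb]
  linarith

lemma opProd_unit_ne_zero (h𝒯 : IsPositiveFamily C 𝒯)
    (hC : IsOrderUnitCone C u M) {L : ℕ → X →L[ℝ] X} (hL : ∀ i, L i ∈ 𝒯) :
    ∀ n, opProd L n u ≠ 0
  | 0 => hC.unit_ne_zero
  | n + 1 => by
    intro h
    have h1 := h𝒯.stronglyPositive _ (hL n) _
      ⟨h𝒯.opProd_mem hC hL hC.unit_mem n, h𝒯.opProd_unit_ne_zero hC hL n⟩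
    rw [← opProd_succ_apply, h] at h1
    obtain ⟨a, ha, h2⟩ := hC.exists_unit_le_of_isCompact isCompact_singleton
      (singleton_subset_iff.2 h1)
    have h3 := h2 0 rfl
    rw [zero_sub, ← neg_smul] at h3
    linarith [hC.nonneg_of_smul_unit_mem h3]

/-- The order unit grows at least as fast as any other vector. -/
lemma exists_norm_opProd_apply_le [CompleteSpace X] (h𝒯 : IsPositiveFamily C 𝒯)
    (hC : IsOrderUnitCone C u M) :
    ∃ K : ℝ, 1 ≤ K ∧ ∀ L : ℕ → X →L[ℝ] X, (∀ i, L i ∈ 𝒯) → ∀ n w,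
      ‖opProd L n w‖ ≤ K * ‖w‖ * ‖opProd L n u‖ := by
  obtain ⟨Λ, hΛ1, hΛ⟩ := h𝒯.exists_norm_le
  have hΛ0 : 0 < Λ := by linarith
  obtain ⟨c, hc, hcU⟩ := h𝒯.exists_norm_opProd_unit_le_succ hC
  obtain ⟨κ, hκ, hD⟩ := h𝒯.exists_unit_le_apply_apply hC (2 * c) (ε := 1 / 2) (by norm_num)
  have hM := hC.pos
  set K := max 1 (max (2 * M) (2 * M ^ 2 * Λ / κ)) with hK
  have hK1 : 1 ≤ K := le_max_left _ _
  have hK0 : 0 < K := by linarith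
  have hKM : 2 * M ≤ K := (le_max_left _ _).trans (le_max_right _ _)
  have hKκ : 2 * M ^ 2 * Λ / κ ≤ K := (le_max_right _ _).trans (le_max_right _ _)
  rw [div_le_iff₀ hκ] at hKκ
  refine ⟨K, hK1, fun L hL n w => ?_⟩
  induction n with
  | zero =>
    rw [opProd_zero_apply, opProd_zero_apply, hC.norm_unit, mul_one]
    nlinarith [norm_nonneg w]
  | succ n ih =>
    by_contra! hlt
    set s := ‖opProd L (n + 1) w‖ with hs
    set U := ‖opProd L (n + 1) u‖ with hU
    have hU0 : 0 ≤ U := norm_nonneg _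
    have hw0 : 0 ≤ ‖w‖ := norm_nonneg _
    have hs0 : 0 < s := lt_of_le_of_lt (by positivity) hlt
    have hp : ∀ k, (M * ‖w‖) • opProd L k u + opProd L k w ∈ C := fun k => by
      simpa using h𝒯.opProd_mem hC hL (hC.unit_add_mem w) k
    have hp' : ∀ k, (M * ‖w‖) • opProd L k u - opProd L k w ∈ C := fun k => by
      simpa using h𝒯.opProd_mem hC hL (hC.unit_sub_mem w) k
    have h1 : ‖w‖ * ‖opProd L n u‖ ≤ c * (‖w‖ * U) := by
      have := mul_le_mul_of_nonneg_left (hcU L hL n) hw0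
      linarith
    have hwU : K * (‖w‖ * U) < s := by linarith
    have hMs : M * (‖w‖ * U) ≤ s / 2 := by
      nlinarith [mul_nonneg hw0 hU0]
    have e1 : opProd L (n + 1) w = L n (opProd L n w) := rfl
    have e2 : opProd L (n + 1) u = L n (opProd L n u) := rfl
    have key := hD _ (hL n) _ (hL (n + 1)) ((M * ‖w‖) • opProd L n u + opProd L n w) s hs0 (by
      calc _ ≤ ‖(M * ‖w‖) • opProd L n u‖ + ‖opProd L n w‖ := norm_add_le _ _
        _ ≤ M * (‖w‖ * ‖opProd L n u‖) + K * (‖w‖ * ‖opProd L n u‖) := by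
          rw [norm_smul, Real.norm_of_nonneg (by positivity)]
          linarith
        _ ≤ M * (c * (‖w‖ * U)) + K * (c * (‖w‖ * U)) := by gcongr
        _ = c * (M * (‖w‖ * U) + K * (‖w‖ * U)) := by ring
        _ ≤ c * (s + s) := by gcongr; linarith
        _ = 2 * c * s := by ring)
      (h𝒯.apply_mem hC (hL n) (hp n)) (by
        rw [map_add, map_smul, ← e1, ← e2]
        have := norm_sub_le_norm_add (opProd L (n + 1) w) ((M * ‖w‖) • opProd L (n + 1) u)
        rw [norm_smul, Real.norm_of_nonneg (show 0 ≤ M * ‖w‖ by positivity),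
          add_comm (opProd L (n + 1) w)] at this
        linarith)
    have h2 : (2 * (M * ‖w‖)) • opProd L (n + 2) u - (κ * s) • u ∈ C := by
      convert hC.add_mem key (hp' (n + 2)) using 1
      simp only [map_add, map_smul, opProd_succ_apply]
      module
    have h3 := hC.le_mul_norm h2
    rw [norm_smul, Real.norm_of_nonneg (by positivity)] at h3
    have h4 : ‖opProd L (n + 2) u‖ ≤ Λ * U :=
      (L (n + 1)).le_of_opNorm_le (hΛ _ (hL (n + 1))) _
    have h5 : κ * s ≤ 2 * M ^ 2 * Λ * (‖w‖ * U) := by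
      calc _ ≤ _ := h3
        _ ≤ M * (2 * (M * ‖w‖) * (Λ * U)) := by gcongr
        _ = _ := by ring
    have h6 : 2 * M ^ 2 * Λ * (‖w‖ * U) ≤ K * κ * (‖w‖ * U) := by gcongr
    nlinarith

end IsPositiveFamily

end LinearCocycles

section LinearCocycles

variable {X : Type*} [NormedAddCommGroup X] [NormedSpace ℝ X]
variable {C : Set X} {u : X} {M : ℝ}

namespace IsPositiveFamily

variable {𝒯 : Set (X →L[ℝ] X)}

/-- A vector in an order interval spanned by the order unit gets trapped in a shorter interval. -/
lemma exists_shrink_interval [CompleteSpace X] (h𝒯 : IsPositiveFamily C 𝒯)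
    (hC : IsOrderUnitCone C u M) {e : ℝ} (he : 0 < e) :
    ∃ κ : ℝ, 0 < κ ∧ κ < 1 ∧ ∀ L : ℕ → X →L[ℝ] X, (∀ i, L i ∈ 𝒯) → ∀ n w α β,
      -(M * ‖w‖) ≤ α → α ≤ M * ‖w‖ → -(M * ‖w‖) ≤ β → β ≤ M * ‖w‖ →
      e * ‖w‖ < β - α →
      opProd L n w - α • opProd L n u ∈ C → β • opProd L n u - opProd L n w ∈ C →
      ∃ α' β', α ≤ α' ∧ α' ≤ β' ∧ β' ≤ β ∧ β' - α' ≤ (1 - κ) * (β - α) ∧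
      opProd L (n + 2) w - α' • opProd L (n + 2) u ∈ C ∧
      β' • opProd L (n + 2) u - opProd L (n + 2) w ∈ C := by
  obtain ⟨Λ, hΛ1, hΛ⟩ := h𝒯.exists_norm_le
  have hΛ0 : 0 < Λ := by linarith
  obtain ⟨c, hc, hcU⟩ := h𝒯.exists_norm_opProd_unit_le_succ hC
  obtain ⟨K, hK1, hK⟩ := h𝒯.exists_norm_opProd_apply_le hC
  obtain ⟨κ₀, hκ₀, hD⟩ := h𝒯.exists_unit_le_apply_apply hC ((K + M) * c / e) (ε := 1 / 2)
    (by norm_num)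
  have hM := hC.pos
  set κ := min (κ₀ / (M * Λ)) (1 / 2) with hκdef
  have hκ : 0 < κ := by positivity
  have hκ1 : κ ≤ 1 / 2 := min_le_right _ _
  have hκκ : κ * (M * Λ) ≤ κ₀ := by
    rw [← le_div_iff₀ (by positivity)]
    exact min_le_left _ _
  refine ⟨κ, hκ, by linarith, fun L hL n w α β hα hα' hβ hβ' hlen hw hw' => ?_⟩
  have hw0 : 0 ≤ ‖w‖ := norm_nonneg w
  have hd : 0 < β - α := lt_of_le_of_lt (by positivity) hlen
  have hU1 : 0 < ‖opProd L (n + 1) u‖ := norm_pos_iff.2 (h𝒯.opProd_unit_ne_zero hC hL _)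
  set s := (β - α) * ‖opProd L (n + 1) u‖ with hs
  have hs0 : 0 < s := by positivity
  have hpow : ∀ v ∈ C, L n v ∈ C := fun v hv => h𝒯.apply_mem hC (hL n) hv
  have hpow' : ∀ v ∈ C, L (n + 1) v ∈ C := fun v hv => h𝒯.apply_mem hC (hL _) hv
  have hbd : ∀ γ, |γ| ≤ M * ‖w‖ → ‖opProd L n w - γ • opProd L n u‖ ≤ (K + M) * c / e * s := by
    intro γ hγ
    have h1 := hcU L hL n
    calc _ ≤ ‖opProd L n w‖ + ‖γ • opProd L n u‖ := norm_sub_le _ _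
      _ ≤ K * ‖w‖ * ‖opProd L n u‖ + M * ‖w‖ * ‖opProd L n u‖ := by
        rw [norm_smul, Real.norm_eq_abs]
        gcongr
        exact hK L hL n w
      _ = (K + M) * ‖w‖ * ‖opProd L n u‖ := by ring
      _ ≤ (K + M) * ((β - α) / e) * (c * ‖opProd L (n + 1) u‖) := by
        gcongr
        rw [le_div_iff₀ he]
        linarith
      _ = _ := by rw [hs]; field_simp
  have hcl : ∀ v, ‖v‖ ≤ (K + M) * c / e * s → v ∈ C → 1 / 2 * s ≤ ‖L n v‖ →
      L (n + 1) (L n v) - (κ * (β - α)) • opProd L (n + 2) u ∈ C := by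
    intro v hv hvC hn
    have h1 := hD _ (hL n) _ (hL (n + 1)) v s hs0 hv (hpow v hvC) hn
    have h2 : ‖opProd L (n + 2) u‖ ≤ Λ * ‖opProd L (n + 1) u‖ :=
      (L (n + 1)).le_of_opNorm_le (hΛ _ (hL (n + 1))) _
    have h3 := hC.unit_sub_mem_of_norm_le (v := (κ * (β - α)) • opProd L (n + 2) u)
      (a := κ₀ * s) (by
        rw [norm_smul, Real.norm_of_nonneg (by positivity)]
        calc _ ≤ M * (κ * (β - α) * (Λ * ‖opProd L (n + 1) u‖)) := by gcongr
          _ = κ * (M * Λ) * s := by rw [hs]; ring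
          _ ≤ κ₀ * s := by gcongr)
    convert hC.add_mem h1 h3 using 1
    module
  have hsum : s ≤ ‖L n (opProd L n w - α • opProd L n u)‖
      + ‖L n (β • opProd L n u - opProd L n w)‖ := by
    refine le_trans (le_of_eq ?_) (norm_add_le _ _)
    rw [← map_add, show opProd L n w - α • opProd L n u + (β • opProd L n u - opProd L n w)
      = (β - α) • opProd L n u by module, map_smul, norm_smul, Real.norm_of_nonneg hd.le]
    rfl
  have hw2 : opProd L (n + 2) w - α • opProd L (n + 2) u ∈ C := by
    simpa using hpow' _ (hpow _ hw)
  have hw2' : β • opProd L (n + 2) u - opProd L (n + 2) w ∈ C := by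
    simpa using hpow' _ (hpow _ hw')
  rcases le_or_gt (1 / 2 * s) ‖L n (opProd L n w - α • opProd L n u)‖ with h | h
  · have h1 := hcl _ (hbd α (abs_le.2 ⟨hα, hα'⟩)) hw h
    refine ⟨α + κ * (β - α), β, ?_, ?_, le_rfl, ?_, ?_, hw2'⟩
    · nlinarith
    · nlinarith
    · nlinarith
    · convert h1 using 1
      simp only [map_sub, map_smul, opProd_succ_apply]
      module
  · have h1 := hcl _ (by rw [norm_sub_rev]; exact hbd β (abs_le.2 ⟨hβ, hβ'⟩)) hw' (by linarith)
    refine ⟨α, β - κ * (β - α), le_rfl, ?_, ?_, ?_, hw2, ?_⟩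
    · nlinarith
    · nlinarith
    · nlinarith
    · convert h1 using 1
      simp only [map_sub, map_smul, opProd_succ_apply]
      module

lemma exists_interval [CompleteSpace X] (h𝒯 : IsPositiveFamily C 𝒯)
    (hC : IsOrderUnitCone C u M) {e : ℝ} (he : 0 < e) :
    ∃ q : ℕ, ∀ L : ℕ → X →L[ℝ] X, (∀ i, L i ∈ 𝒯) → ∀ n, q ≤ n → ∀ w, ∃ α β : ℝ,
      |α| ≤ M * ‖w‖ ∧ β - α ≤ e * ‖w‖ ∧
      opProd L n w - α • opProd L n u ∈ C ∧ β • opProd L n u - opProd L n w ∈ C := by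
  have hM := hC.pos
  obtain ⟨κ, hκ, hκ1, hs⟩ := h𝒯.exists_shrink_interval hC he
  have step : ∀ L : ℕ → X →L[ℝ] X, (∀ i, L i ∈ 𝒯) → ∀ w, ∀ k : ℕ, ∃ α β : ℝ,
      -(M * ‖w‖) ≤ α ∧ α ≤ β ∧ β ≤ M * ‖w‖ ∧
      (β - α ≤ e * ‖w‖ ∨ β - α ≤ 2 * M * ‖w‖ * (1 - κ) ^ k) ∧
      opProd L (2 * k) w - α • opProd L (2 * k) u ∈ C ∧
      β • opProd L (2 * k) u - opProd L (2 * k) w ∈ C := by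
    intro L hL w k
    have hw0 : 0 ≤ ‖w‖ := norm_nonneg w
    induction k with
    | zero =>
      refine ⟨-(M * ‖w‖), M * ‖w‖, le_rfl, by nlinarith, le_rfl,
        Or.inr (by rw [pow_zero]; linarith), ?_, ?_⟩
      · have := hC.unit_add_mem w
        convert this using 1
        simp only [mul_zero, opProd_zero_apply]
        module
      · simpa using hC.unit_sub_mem w
    | succ k ih =>
      obtain ⟨α, β, h1, h2, h3, h4, h5, h6⟩ := ih
      rcases le_or_gt (β - α) (e * ‖w‖) with h | h
      · refine ⟨α, β, h1, h2, h3, Or.inl h, ?_, ?_⟩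
        · simpa [mul_add] using h𝒯.apply_mem hC (hL (2 * k + 1)) (h𝒯.apply_mem hC (hL (2 * k)) h5)
        · simpa [mul_add] using h𝒯.apply_mem hC (hL (2 * k + 1)) (h𝒯.apply_mem hC (hL (2 * k)) h6)
      · obtain ⟨α', β', g1, g2, g3, g4, g5, g6⟩ := hs L hL (2 * k) w α β h1 (h2.trans h3)
          (h1.trans h2) h3 h h5 h6
        refine ⟨α', β', h1.trans g1, g2, g3.trans h3, Or.inr ?_, g5, g6⟩
        have h7 := h4.resolve_left (not_le.2 h)
        calc β' - α' ≤ (1 - κ) * (β - α) := g4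
          _ ≤ (1 - κ) * (2 * M * ‖w‖ * (1 - κ) ^ k) := by gcongr
          _ = _ := by ring
  obtain ⟨k, hk⟩ := exists_pow_lt_of_lt_one (show 0 < e / (2 * M) by positivity)
    (show 1 - κ < 1 by linarith)
  refine ⟨2 * k, fun L hL n hn w => ?_⟩
  obtain ⟨α, β, h1, h2, h3, h4, h5, h6⟩ := step L hL w k
  refine ⟨α, β, abs_le.2 ⟨h1, h2.trans h3⟩, ?_, ?_⟩
  · rcases h4 with h4 | h4
    · exact h4
    · refine h4.trans ?_
      rw [lt_div_iff₀ (by positivity)] at hk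
      nlinarith [norm_nonneg w]
  · obtain ⟨m, rfl⟩ := Nat.exists_eq_add_of_le hn
    constructor
    · have := h𝒯.opProd_mem hC (L := fun i => L (2 * k + i)) (fun i => hL _) h5 m
      simpa only [map_sub, map_smul, ← opProd_add_apply] using this
    · have := h𝒯.opProd_mem hC (L := fun i => L (2 * k + i)) (fun i => hL _) h6 m
      simpa only [map_sub, map_smul, ← opProd_add_apply] using this

/-- Every vector becomes asymptotically parallel to the order unit. -/
lemma exists_norm_opProd_sub_smul_le [CompleteSpace X] (h𝒯 : IsPositiveFamily C 𝒯)
    (hC : IsOrderUnitCone C u M) {ε : ℝ} (hε : 0 < ε) :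
    ∃ q : ℕ, ∀ L : ℕ → X →L[ℝ] X, (∀ i, L i ∈ 𝒯) → ∀ n, q ≤ n → ∀ w, ∃ s : ℝ,
      ‖opProd L n w - s • opProd L n u‖ ≤ ε * ‖w‖ * ‖opProd L n u‖ := by
  obtain ⟨Λ, hΛ1, hΛ⟩ := h𝒯.exists_norm_le
  have hΛ0 : 0 < Λ := by linarith
  obtain ⟨c, hc, hcU⟩ := h𝒯.exists_norm_opProd_unit_le_succ hC
  obtain ⟨K, hK1, hK⟩ := h𝒯.exists_norm_opProd_apply_le hC
  obtain ⟨κ₀, hκ₀, hD⟩ := h𝒯.exists_unit_le_apply_apply hC ((K + M) * c) hε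
  have hM := hC.pos
  obtain ⟨q, hq⟩ := h𝒯.exists_interval hC (e := κ₀ / (2 * M * Λ)) (by positivity)
  refine ⟨q + 1, fun L hL n hn w => ?_⟩
  obtain ⟨n, rfl⟩ : ∃ m, n = m + 1 := ⟨n - 1, by omega⟩
  obtain ⟨α, β, h1, h2, h3, h4⟩ := hq L hL n (by omega) w
  refine ⟨α, ?_⟩
  by_contra! hlt
  have hU1 : 0 < ‖opProd L (n + 1) u‖ := norm_pos_iff.2 (h𝒯.opProd_unit_ne_zero hC hL _)
  have hw : 0 < ‖w‖ := by
    rcases (norm_nonneg w).eq_or_lt with h | h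
    · rw [norm_eq_zero.1 h.symm] at hlt h1
      have : α = 0 := by simpa using h1
      simp [this] at hlt
    · exact h
  set s := ‖w‖ * ‖opProd L (n + 1) u‖ with hs
  have hs0 : 0 < s := by positivity
  have key := hD _ (hL n) _ (hL (n + 1)) (opProd L n w - α • opProd L n u) s hs0 (by
    have h1' := hcU L hL n
    calc _ ≤ ‖opProd L n w‖ + ‖α • opProd L n u‖ := norm_sub_le _ _
      _ ≤ K * ‖w‖ * ‖opProd L n u‖ + M * ‖w‖ * ‖opProd L n u‖ := by
        rw [norm_smul, Real.norm_eq_abs]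
        gcongr
        exact hK L hL n w
      _ = (K + M) * ‖w‖ * ‖opProd L n u‖ := by ring
      _ ≤ (K + M) * ‖w‖ * (c * ‖opProd L (n + 1) u‖) := by gcongr
      _ = _ := by rw [hs]; ring) (h𝒯.apply_mem hC (hL n) h3) (by
    simp only [map_sub, map_smul, ← opProd_succ_apply]
    linarith)
  have h5 := h𝒯.apply_mem hC (hL (n + 1)) (h𝒯.apply_mem hC (hL n) h4)
  have h6 : (β - α) • opProd L (n + 2) u - (κ₀ * s) • u ∈ C := by
    convert hC.add_mem key h5 using 1
    simp only [map_sub, map_smul, ← opProd_succ_apply]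
    module
  have h7 := hC.le_mul_norm h6
  have h8 : ‖opProd L (n + 2) u‖ ≤ Λ * ‖opProd L (n + 1) u‖ :=
    (L (n + 1)).le_of_opNorm_le (hΛ _ (hL (n + 1))) _
  have hd0 : 0 ≤ β - α := by
    refine hC.nonneg_of_smul_mem (h𝒯.opProd_mem hC hL hC.unit_mem n)
      (h𝒯.opProd_unit_ne_zero hC hL n) ?_
    convert hC.add_mem h3 h4 using 1
    module
  rw [norm_smul, Real.norm_of_nonneg hd0] at h7
  have h9 : κ₀ * s ≤ κ₀ / 2 * s := by
    calc _ ≤ _ := h7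
      _ ≤ M * (κ₀ / (2 * M * Λ) * ‖w‖ * (Λ * ‖opProd L (n + 1) u‖)) := by gcongr
      _ = _ := by rw [hs]; field_simp
  nlinarith

/-- Long products of operators of the family are uniformly positive for a narrow cone. -/
lemma exists_uniformlyPositive_opProd [CompleteSpace X] (h𝒯 : IsPositiveFamily C 𝒯)
    (hC : IsOrderUnitCone C u M) :
    ∃ κ : ℝ, 0 < κ ∧ κ < 1 ∧ ∃ q : ℕ, ∀ n, q ≤ n → ∃ σ : ℝ, 0 < σ ∧
      ∀ L : ℕ → X →L[ℝ] X, (∀ i, L i ∈ 𝒯) →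
        UniformlyPositive (narrowCone C u κ) u σ (opProd L n) := by
  obtain ⟨b, hb, hbT⟩ := h𝒯.exists_unit_le_apply_unit hC
  obtain ⟨R, hR1, hR⟩ := h𝒯.exists_unit_le_opProd_unit hC
  have hR0 : 0 < R := by linarith
  have hM := hC.pos
  obtain ⟨q, hq⟩ := h𝒯.exists_norm_opProd_sub_smul_le hC
    (ε := 1 / (16 * R ^ 2 * (M + 1))) (by positivity)
  set ε := 1 / (16 * R ^ 2 * (M + 1)) with hε
  set κ := 1 / (4 * R) with hκ
  have hε0 : 0 < ε := by positivity
  have hκ0 : 0 < κ := by positivity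
  have hκ1 : κ < 1 := by rw [hκ, div_lt_one (by positivity)]; linarith
  have hMε : (M + 1) * ε = κ ^ 2 := by rw [hε, hκ]; field_simp; norm_num
  have hRκ : R * κ = 1 / 4 := by rw [hκ]; field_simp
  refine ⟨κ, hκ0, hκ1, q, fun n hn => ⟨κ ^ 2 * b ^ n / (M * (1 + κ)), by positivity,
    fun L hL v hv => ?_⟩⟩
  have hbn : ∀ n, opProd L n u - b ^ n • u ∈ C := by
    intro n
    induction n with
    | zero => simpa using hC.zero_mem
    | succ n ih =>
      have h1 := h𝒯.apply_mem hC (hL n) ih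
      have h2 := hC.smul_mem (pow_nonneg hb.le n) (hbT _ (hL n))
      convert hC.add_mem h1 h2 using 1
      simp only [map_sub, map_smul, ← opProd_succ_apply]
      module
  obtain ⟨s, hs⟩ := hq L hL n hn v
  set V := opProd L n v with hV
  set U := opProd L n u with hU
  have hv0 : 0 ≤ ‖v‖ := norm_nonneg v
  have hU0 : U ≠ 0 := h𝒯.opProd_unit_ne_zero hC hL n
  have hUC : U ∈ C := h𝒯.opProd_mem hC hL hC.unit_mem n
  have hUn : U - (‖U‖ / R) • u ∈ C := hR L hL n
  have hVU : V - (κ * ‖v‖) • U ∈ C := by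
    simpa only [map_sub, map_smul] using h𝒯.opProd_mem hC hL hv n
  have hlow : (κ - M * ε * R) * ‖v‖ ≤ s := by
    have h1 := hC.unit_sub_mem_of_norm_le (v := V - s • U) (a := M * (ε * ‖v‖ * ‖U‖)) (by gcongr)
    have h2 := hC.smul_mem (a := M * ε * ‖v‖ * R) (by positivity) hUn
    have h3 := hC.add_mem (hC.add_mem h1 h2) hVU
    have h4 : (s - (κ - M * ε * R) * ‖v‖) • U ∈ C := by
      convert h3 using 1
      have : M * (ε * ‖v‖ * ‖U‖) = M * ε * ‖v‖ * R * (‖U‖ / R) := by field_simp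
      rw [this]
      module
    linarith [hC.nonneg_of_smul_mem hUC hU0 h4]
  have hs2 : κ / 2 * ‖v‖ ≤ s := by
    refine le_trans (mul_le_mul_of_nonneg_right ?_ hv0) hlow
    have : M * ε * R ≤ κ ^ 2 * R := by rw [← hMε]; gcongr; linarith
    nlinarith
  have hs0 : 0 ≤ s := le_trans (by positivity) hs2
  have hVn : ‖V‖ ≤ (s + ε * ‖v‖) * ‖U‖ := by
    have := norm_le_norm_add_norm_sub (s • U) V
    rw [norm_smul, Real.norm_of_nonneg hs0] at this
    rw [norm_sub_rev] at hs
    linarith [norm_sub_rev (s • U) V]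
  have hVu : V - (2 * κ * ‖V‖) • u ∈ C := by
    have h1 := hC.unit_add_mem_of_norm_le (v := V - s • U) (a := M * (ε * ‖v‖ * ‖U‖)) (by gcongr)
    have h2 := hC.smul_mem hs0 hUn
    refine hC.sub_smul_mem_of_le hC.unit_mem
      (a := s * (‖U‖ / R) - M * (ε * ‖v‖ * ‖U‖)) ?_ ?_
    · convert hC.add_mem h1 h2 using 1
      module
    · have hR' : 1 / R = 4 * κ := by rw [hκ]; field_simp
      calc 2 * κ * ‖V‖ ≤ 2 * κ * ((s + ε * ‖v‖) * ‖U‖) := by gcongr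
        _ = (2 * κ * s + 2 * κ * (ε * ‖v‖)) * ‖U‖ := by ring
        _ ≤ (s * (4 * κ) - M * (ε * ‖v‖)) * ‖U‖ := by
          gcongr
          have h5 : (M + 1) * (ε * ‖v‖) ≤ 2 * κ * s := by
            calc _ = (M + 1) * ε * ‖v‖ := by ring
              _ = 2 * κ * (κ / 2 * ‖v‖) := by rw [hMε]; ring
              _ ≤ _ := by gcongr
          have h6 : 2 * κ * (ε * ‖v‖) ≤ 1 * (ε * ‖v‖) := by
            gcongr
            nlinarith
          linarith
        _ = _ := by rw [← hR']; ring
  have hVlow : κ * ‖v‖ * b ^ n ≤ M * ‖V‖ := by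
    refine hC.le_mul_norm (w := V) ?_
    convert hC.add_mem hVU (hC.smul_mem (a := κ * ‖v‖) (by positivity) (hbn n)) using 1
    rw [← hU]
    module
  set t := κ ^ 2 * b ^ n / (M * (1 + κ)) * ‖v‖ with ht
  have ht0 : 0 ≤ t := by positivity
  have htle : t * (1 + κ) ≤ κ * ‖V‖ := by
    rw [ht]
    calc _ = κ * (κ * ‖v‖ * b ^ n) / M := by field_simp
      _ ≤ κ * (M * ‖V‖) / M := by gcongr
      _ = _ := by field_simp
  refine hC.mem_narrowCone_of_le (b := 2 * κ * ‖V‖ - t) ?_ ?_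
  · convert hVu using 1
    module
  · have := norm_sub_le V (t • u)
    rw [norm_smul, hC.norm_unit, Real.norm_of_nonneg ht0, mul_one] at this
    nlinarith

end IsPositiveFamily

end LinearCocycles

section LinearCocycles

variable {X : Type*} [NormedAddCommGroup X] [NormedSpace ℝ X]
variable {C : Set X} {u : X} {M : ℝ}

lemma UniformlyPositive.opProd_add (hC : IsOrderUnitCone C u M) {σ τ : ℝ} (hσ : 0 ≤ σ) (hτ : 0 ≤ τ)
    {L : ℕ → X →L[ℝ] X} {m n : ℕ} (hm : UniformlyPositive C u σ (opProd L m))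
    (hn : UniformlyPositive C u τ (opProd (fun i => L (m + i)) n)) :
    UniformlyPositive C u (τ * (σ / M)) (opProd L (m + n)) := by
  intro v hv
  rw [opProd_add_apply]
  refine hC.sub_smul_mem_of_le hC.unit_mem (hn _ (hm.mem hC hσ hv)) ?_
  rw [mul_assoc]
  gcongr
  exact hm.le_norm hC hv

lemma exists_pos_le_of_lt (f : ℕ → ℝ) (hf : ∀ n, 0 < f n) (N : ℕ) :
    ∃ ε : ℝ, 0 < ε ∧ ∀ n < N, ε ≤ f n := by
  induction N with
  | zero => exact ⟨1, one_pos, fun n hn => absurd hn n.not_lt_zero⟩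
  | succ N ih =>
    obtain ⟨ε, hε, h⟩ := ih
    refine ⟨min ε (f N), lt_min hε (hf N), fun n hn => ?_⟩
    rcases Nat.lt_succ_iff_lt_or_eq.1 hn with h' | rfl
    · exact (min_le_left _ _).trans (h n h')
    · exact min_le_right _ _

/-- Long products of operators close to a compact family of compact strongly positive operators are
uniformly positive for a narrow cone. -/
lemma IsPositiveFamily.exists_robust [CompleteSpace X] {𝒯 : Set (X →L[ℝ] X)}
    (h𝒯 : IsPositiveFamily C 𝒯) (hC : IsOrderUnitCone C u M) :
    ∃ κ ε : ℝ, ∃ q : ℕ, 0 < κ ∧ κ < 1 ∧ 0 < ε ∧ 0 < q ∧ ∀ n, q ≤ n → ∃ σ : ℝ, 0 < σ ∧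
      ∀ L : ℕ → X →L[ℝ] X, (∀ i < n, ∃ T ∈ 𝒯, ‖L i - T‖ ≤ ε) →
        UniformlyPositive (narrowCone C u κ) u σ (opProd L n) := by
  obtain ⟨Λ, -, hΛ⟩ := h𝒯.exists_norm_le
  obtain ⟨κ, hκ, hκ1, q, hq⟩ := h𝒯.exists_uniformlyPositive_opProd hC
  have hC' := hC.isOrderUnitCone_narrowCone hκ hκ1
  set M' := (M + κ) / (1 - κ) with hM'
  have hM0 := hC'.pos
  have hpert : ∀ n, ∃ ε : ℝ, 0 < ε ∧ (0 < n ∧ q ≤ n → ∃ σ : ℝ, 0 < σ ∧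
      ∀ L : ℕ → X →L[ℝ] X, (∀ i < n, ∃ T ∈ 𝒯, ‖L i - T‖ ≤ ε) →
        UniformlyPositive (narrowCone C u κ) u σ (opProd L n)) := by
    intro n
    by_cases hn : 0 < n ∧ q ≤ n
    · obtain ⟨σ, hσ, h⟩ := hq n hn.2
      obtain ⟨ε, hε, hε'⟩ :=
        exists_norm_opProd_sub_le (X := X) Λ n (e := σ / (2 * M')) (by positivity)
      refine ⟨ε, hε, fun _ => ⟨σ / 2, half_pos hσ, fun L hL => ?_⟩⟩
      have hLT : ∀ i, ∃ T, T ∈ 𝒯 ∧ (i < n → ‖L i - T‖ ≤ ε) := fun i => by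
        by_cases hi : i < n
        · obtain ⟨T, hT, h'⟩ := hL i hi
          exact ⟨T, hT, fun _ => h'⟩
        · obtain ⟨T, hT, -⟩ := hL 0 hn.1
          exact ⟨T, hT, fun h => absurd h hi⟩
      choose T hT hT' using hLT
      refine ((h T hT).of_norm_sub_le hC' (hε' L T (fun i _ => hΛ _ (hT i)) hT')).mono hC' ?_
      field_simp
      linarith
    · exact ⟨1, one_pos, fun h => absurd h hn⟩
  choose f hf hf' using hpert
  set q' := max q 1 with hq'
  obtain ⟨ε, hε, hεf⟩ := exists_pos_le_of_lt f hf (2 * q')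
  refine ⟨κ, ε, q', hκ, hκ1, hε, by omega, fun n => ?_⟩
  induction n using Nat.strong_induction_on with
  | _ n ih =>
    intro hn
    rcases lt_or_ge n (2 * q') with h | h
    · obtain ⟨σ, hσ, hσ'⟩ := hf' n (by omega)
      refine ⟨σ, hσ, fun L hL => hσ' L fun i hi => ?_⟩
      obtain ⟨T, hT, h'⟩ := hL i hi
      exact ⟨T, hT, h'.trans (hεf n h)⟩
    · obtain ⟨σ, hσ, hσ'⟩ := ih (n - q') (by omega) (by omega)
      obtain ⟨τ, hτ, hτ'⟩ := hf' q' (by omega)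
      refine ⟨τ * (σ / M'), by positivity, fun L hL => ?_⟩
      have := UniformlyPositive.opProd_add hC' hσ.le hτ.le (m := n - q') (n := q')
        (hσ' L fun i hi => hL i (by omega)) (hτ' (fun i => L (n - q' + i)) fun i hi => by
          obtain ⟨T, hT, h'⟩ := hL (n - q' + i) (by omega)
          exact ⟨T, hT, h'.trans (hεf q' (by omega))⟩)
      rwa [Nat.sub_add_cancel (by omega)] at this

end LinearCocycles

section Auxiliary

lemma exists_one_add_pow_lt {a : ℝ} (ha : 1 < a) (p : ℕ) : ∃ ρ : ℝ, 0 < ρ ∧ (1 + ρ) ^ p < a := by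
  have h : ContinuousAt (fun ρ : ℝ => (1 + ρ) ^ p) 0 := by fun_prop
  have h1 : ∀ᶠ ρ in 𝓝[>] (0 : ℝ), (1 + ρ) ^ p < a :=
    (h.eventually (gt_mem_nhds (by simpa using ha))).filter_mono nhdsWithin_le_nhds
  obtain ⟨ρ, h2, h3⟩ := (h1.and self_mem_nhdsWithin).exists
  exact ⟨ρ, h3, h2⟩

/-- Pliss-type lemma: a sequence that decays linearly and cannot drop fast has, for any colouring
with `N` colours, two maximal times of the same colour at bounded distance. -/
lemma exists_maximal_times {S : ℕ → ℝ} {l B c : ℝ} {N T N₀ : ℕ} (hl : 0 < l) (hB : 0 ≤ B)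
    (hT : N * B < T * l) (hS : ∀ n, S n - B ≤ S (n + 1)) (hc : ∀ n, N₀ ≤ n → S n ≤ c - n * l)
    {ι : Type*} (t : Finset ι) (ht : t.card ≤ N) (f : ℕ → ι) (hf : ∀ n, f n ∈ t) :
    ∃ n k, 0 < k ∧ k ≤ T ∧ f n = f (n + k) ∧ ∀ m, n ≤ m → S m ≤ S n := by
  classical
  by_contra! hcon
  set good : ℕ → Prop := fun n => ∀ m, n ≤ m → S m ≤ S n with hgood
  have hbdd : ∀ n, BddAbove (range fun i => S (n + i)) := by
    have h1 : BddAbove (S '' (Finset.range N₀ : Set ℕ)) :=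
      ((Finset.finite_toSet _).image S).bddAbove
    obtain ⟨b, hb⟩ := h1
    refine fun n => ⟨max b c, ?_⟩
    rintro _ ⟨i, rfl⟩
    rcases lt_or_ge (n + i) N₀ with h | h
    · exact (hb ⟨n + i, by simpa using h, rfl⟩).trans (le_max_left _ _)
    · refine (hc _ h).trans (le_trans ?_ (le_max_right _ _))
      have : (0 : ℝ) ≤ (n + i : ℕ) * l := by positivity
      linarith
  set m : ℕ → ℝ := fun n => ⨆ i, S (n + i) with hm
  have hSm : ∀ n, S n ≤ m n := fun n => le_ciSup (hbdd n) 0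
  have hstep : ∀ n, m n - m (n + 1) ≤ if good n then B else 0 := by
    intro n
    split_ifs with h
    · have h1 : m n ≤ S n := ciSup_le fun i => h _ (Nat.le_add_right _ _)
      linarith [hS n, hSm (n + 1)]
    · rw [sub_nonpos]
      refine ciSup_le fun i => ?_
      rcases i with _ | i
      · simp only [hgood, not_forall, not_le] at h
        obtain ⟨j, hj, hlt⟩ := h
        obtain ⟨i, rfl⟩ := Nat.exists_eq_add_of_le hj
        rcases i with _ | i
        · exact absurd hlt (lt_irrefl _)
        · refine hlt.le.trans ?_
          have : S (n + 1 + i) ≤ m (n + 1) := le_ciSup (hbdd (n + 1)) i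
          rwa [show n + 1 + i = n + (i + 1) by omega] at this
      · have : S (n + 1 + i) ≤ m (n + 1) := le_ciSup (hbdd (n + 1)) i
        rwa [show n + 1 + i = n + (i + 1) by omega] at this
  have hwin : ∀ a, ((Finset.Ico a (a + T)).filter good).card ≤ N := by
    intro a
    by_contra! hlt
    obtain ⟨x, hx, y, hy, hxy, hfxy⟩ := Finset.exists_ne_map_eq_of_card_lt_of_maps_to
      (lt_of_le_of_lt ht hlt) (f := f) (fun n _ => hf n)
    simp only [Finset.mem_filter, Finset.mem_Ico] at hx hy
    rcases lt_or_gt_of_ne hxy with h | h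
    · obtain ⟨j, h1, h2⟩ := hcon x (y - x) (by omega) (by omega)
        (by rw [hfxy]; congr 1; omega)
      exact absurd (hx.2 j h1) (not_le.2 h2)
    · obtain ⟨j, h1, h2⟩ := hcon y (x - y) (by omega) (by omega)
        (by rw [← hfxy]; congr 1; omega)
      exact absurd (hy.2 j h1) (not_le.2 h2)
  have hblock : ∀ a, m a - m (a + T) ≤ N * B := by
    intro a
    have h1 : ∀ j, m a - m (a + j) ≤ ((Finset.Ico a (a + j)).filter good).card * B := by
      intro j
      induction j with
      | zero => simp
      | succ j ih =>
        have h2 := hstep (a + j)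
        rw [← add_assoc, Finset.card_filter, Finset.sum_Ico_succ_top (by omega),
          ← Finset.card_filter]
        push_cast
        split_ifs at h2 ⊢ <;> linarith
    refine (h1 T).trans ?_
    gcongr
    exact hwin a
  have hblocks : ∀ k : ℕ, m 0 - m (k * T) ≤ k * (N * B) := by
    intro k
    induction k with
    | zero => simp
    | succ k ih =>
      have := hblock (k * T)
      rw [Nat.succ_mul]
      push_cast
      linarith
  have hmle : ∀ n, N₀ ≤ n → m n ≤ c - n * l := fun n hn => ciSup_le fun i => by
    refine (hc _ (by omega)).trans ?_
    push_cast
    nlinarith [Nat.cast_nonneg (α := ℝ) i]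
  have hT0 : 0 < T := by
    rcases T.eq_zero_or_pos with rfl | h
    · have : (0 : ℝ) ≤ N * B := by positivity
      simp at hT
      linarith
    · exact h
  obtain ⟨k, hk⟩ := exists_nat_gt ((c - m 0) / (T * l - N * B))
  rw [div_lt_iff₀ (by linarith)] at hk
  have h1 := hblocks (k + N₀)
  have h2 := hmle ((k + N₀) * T) (by nlinarith)
  push_cast at h1 h2
  have : (0 : ℝ) ≤ N₀ * (T * l - N * B) := by
    have : 0 ≤ T * l - N * B := by linarith
    positivity
  nlinarith

lemma exists_forall_norm_sub_lt_of_isCompact {X Y : Type*} [NormedAddCommGroup X]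
    [NormedAddCommGroup Y] {f : X → Y}
    (hf : Continuous f) {K : Set X} (hK : IsCompact K) {e : ℝ} (he : 0 < e) :
    ∃ δ : ℝ, 0 < δ ∧ ∀ x ∈ K, ∀ y, ‖y - x‖ < δ → ‖f y - f x‖ < e := by
  have h := hK.uniformContinuousAt_of_continuousAt f (fun a _ => hf.continuousAt)
    (Metric.dist_mem_uniformity he)
  obtain ⟨δ, hδ, h'⟩ := Metric.mem_uniformity_dist.1 h
  refine ⟨δ, hδ, fun x hx y hxy => ?_⟩
  have := h' (a := x) (b := y) (by rwa [dist_comm, dist_eq_norm]) hx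
  rwa [Set.mem_ofPred_eq, dist_comm, dist_eq_norm] at this

lemma omegaMap_eq_of_tendsto {X : Type*} [NormedAddCommGroup X] {G : X → X} (hG : Continuous G)
    {x z : X} {n₁ k : ℕ} (hk : 0 < k)
    (hlim : Tendsto (fun j => G^[n₁ + j * k] x) atTop (𝓝 z)) :
    omegaMap G x = {y | ∃ n, y = G^[n] z} := by
  have hlim' : ∀ i, Tendsto (fun j => G^[n₁ + j * k + i] x) atTop (𝓝 (G^[i] z)) := fun i => by
    have := ((hG.iterate i).tendsto z).comp hlim
    refine this.congr fun j => ?_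
    rw [Function.comp_apply, ← Function.iterate_add_apply, add_comm]
  apply Subset.antisymm
  · intro y hy
    set O : Set X := (fun i => G^[i] z) '' (Finset.range k : Set ℕ) with hO
    have hOfin : O.Finite := (Finset.finite_toSet _).image _
    have hOne : O.Nonempty := ⟨z, 0, by simpa using hk, rfl⟩
    have hyO : infDist y O = 0 := by
      refine le_antisymm (le_of_forall_pos_le_add fun ε hε => ?_) infDist_nonneg
      have h1 : ∀ᶠ j in atTop, ∀ i ∈ Finset.range k, dist (G^[n₁ + j * k + i] x) (G^[i] z) < ε :=
        (Finset.eventually_all _).2 fun i _ => (Metric.tendsto_nhds.1 (hlim' i)) ε hε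
      obtain ⟨J, hJ⟩ := eventually_atTop.1 h1
      have h2 : y ∈ closure {y | ∃ n, n₁ + J * k ≤ n ∧ y = G^[n] x} := mem_iInter.1 hy _
      have h3 : {y | ∃ n, n₁ + J * k ≤ n ∧ y = G^[n] x} ⊆ {w | infDist w O ≤ 0 + ε} := by
        rintro _ ⟨n, hn, rfl⟩
        have h4 := Nat.div_add_mod (n - n₁) k
        have h5 : J ≤ (n - n₁) / k := (Nat.le_div_iff_mul_le hk).2 (by omega)
        have h6 := Nat.mod_lt (n - n₁) hk
        have h7 := hJ _ h5 ((n - n₁) % k) (by simpa using h6)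
        rw [show n₁ + (n - n₁) / k * k + (n - n₁) % k = n by
          rw [mul_comm ((n - n₁) / k)]; omega] at h7
        rw [Set.mem_ofPred_eq, zero_add]
        exact (infDist_le_dist_of_mem (mem_image_of_mem _ (by simpa using h6))).trans h7.le
      have h4 : IsClosed {w | infDist w O ≤ 0 + ε} :=
        isClosed_le (continuous_infDist_pt O) continuous_const
      exact closure_minimal h3 h4 h2
    have := (hOfin.isClosed.mem_iff_infDist_zero hOne).2 hyO
    obtain ⟨i, -, rfl⟩ := this
    exact ⟨i, rfl⟩
  · rintro _ ⟨i, rfl⟩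
    refine mem_iInter.2 fun m => ?_
    refine mem_closure_of_tendsto (hlim' i) ?_
    filter_upwards [eventually_ge_atTop m] with j hj
    exact ⟨_, by nlinarith, rfl⟩

variable {X : Type*} [NormedAddCommGroup X] [NormedSpace ℝ X]

lemma norm_sub_sub_fderiv_le {G : X → X} (hG : ContDiff ℝ 1 G) {x : X} {δ e : ℝ}
    (h : ∀ y, ‖y - x‖ < δ → ‖fderiv ℝ G y - fderiv ℝ G x‖ ≤ e) {y : X} (hy : ‖y - x‖ < δ) :
    ‖G y - G x - fderiv ℝ G x (y - x)‖ ≤ e * ‖y - x‖ := by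
  have hd : ∀ z ∈ ball x δ, DifferentiableAt ℝ G z :=
    fun z _ => (hG.differentiable one_ne_zero).differentiableAt
  refine (convex_ball x δ).norm_image_sub_le_of_norm_fderiv_le' hd
    (fun z hz => h z (by rwa [mem_ball, dist_eq_norm] at hz))
    (mem_ball_self ((norm_nonneg _).trans_lt hy)) (by rwa [mem_ball, dist_eq_norm])

lemma exists_norm_sub_sub_fderiv_le {G : X → X} (hG : ContDiff ℝ 1 G) {K : Set X}
    (hK : IsCompact K) {e : ℝ} (he : 0 < e) :
    ∃ δ : ℝ, 0 < δ ∧ ∀ x ∈ K, ∀ y, ‖y - x‖ < δ →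
      ‖G y - G x - fderiv ℝ G x (y - x)‖ ≤ e * ‖y - x‖ := by
  obtain ⟨δ, hδ, h⟩ := exists_forall_norm_sub_lt_of_isCompact
    (hG.continuous_fderiv one_ne_zero) hK he
  exact ⟨δ, hδ, fun x hx y hy => norm_sub_sub_fderiv_le hG (fun z hz => (h x hx z hz).le) hy⟩

/-- Monotone sequences in compact sets converge if the cone is normal. -/
lemma exists_tendsto_of_monotone {C : Set X} {u : X} {M ν : ℝ} (hC : IsOrderUnitCone C u M)
    (hν : ∀ v w : X, v ∈ C → w - v ∈ C → ‖v‖ ≤ ν * ‖w‖) {K : Set X} (hK : IsCompact K)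
    {y : ℕ → X} (hy : ∀ n, y n ∈ K) (hmono : ∀ n, y (n + 1) - y n ∈ C) :
    ∃ z ∈ K, Tendsto y atTop (𝓝 z) := by
  obtain ⟨z, hz, φ, hφ, hlim⟩ := hK.tendsto_subseq hy
  have hle : ∀ m n, m ≤ n → y n - y m ∈ C := fun m n hmn => by
    induction n, hmn using Nat.le_induction with
    | base => simpa using hC.zero_mem
    | succ n _ ih => exact hC.sub_mem_trans ih (hmono n)
  have hlez : ∀ n, z - y n ∈ C := fun n => by
    refine hC.isClosed.mem_of_tendsto (hlim.sub_const (y n)) ?_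
    filter_upwards [eventually_ge_atTop n] with m hm
    exact hle _ _ (hm.trans (hφ.id_le m))
  refine ⟨z, hz, ?_⟩
  have hν0 : 0 ≤ ν := by
    have := hν u u hC.unit_mem (by simpa using hC.zero_mem)
    rw [hC.norm_unit] at this
    linarith
  rw [Metric.tendsto_atTop] at hlim ⊢
  intro ε hε
  obtain ⟨m, hm⟩ := hlim (ε / (ν + 1)) (by positivity)
  refine ⟨φ m, fun n hn => ?_⟩
  have h1 := hν (z - y n) (z - y (φ m)) (hlez n) (by simpa using hle _ _ hn)
  have h2 := hm m le_rfl
  rw [dist_comm, dist_eq_norm] at h2 ⊢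
  rw [lt_div_iff₀ (by positivity)] at h2
  have h3 : ‖z - y (φ m)‖ = ‖z - (y ∘ φ) m‖ := rfl
  nlinarith [norm_nonneg (z - y (φ m))]

lemma spectralRadius_le_one_of_growth [CompleteSpace X] [Nontrivial X] (T : X →L[ℝ] X)
    (h : ∀ a : ℝ, 1 < a → ∃ c : ℝ, ∀ l : ℕ, ‖T ^ l‖ ≤ c * a ^ l) : spectralRadius ℝ T ≤ 1 := by
  refine iSup₂_le fun μ hμ => ?_
  rw [← ENNReal.coe_one, ENNReal.coe_le_coe, ← NNReal.coe_le_coe, coe_nnnorm, NNReal.coe_one]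
  by_contra! hlt
  obtain ⟨a, ha, ha'⟩ := exists_between hlt
  obtain ⟨c, hc⟩ := h a ha
  have h1 : ∀ l : ℕ, (‖μ‖ / a) ^ l ≤ c := fun l => by
    have h2 := spectrum.norm_le_norm_of_mem (spectrum.pow_mem_pow T l hμ)
    rw [norm_pow] at h2
    rw [div_pow, div_le_iff₀ (by positivity)]
    exact h2.trans (hc l)
  obtain ⟨l, hl⟩ := pow_unbounded_of_one_lt c ((one_lt_div (by linarith)).2 ha')
  exact absurd (h1 l) (not_le.2 hl)

lemma fderiv_iterate_eq_opProd {G : X → X} (hG : Differentiable ℝ G) (x : X) (n : ℕ) :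
    fderiv ℝ (G^[n]) x = opProd (fun i => fderiv ℝ G (G^[i] x)) n := by
  induction n with
  | zero => exact fderiv_id
  | succ n ih =>
    rw [Function.iterate_succ', fderiv_comp x hG.differentiableAt (hG.iterate n).differentiableAt,
      ih]
    rfl

end Auxiliary

section MonotoneMaps

variable {X : Type*} [NormedAddCommGroup X] [NormedSpace ℝ X]
variable {C : Set X} {u : X} {M ν : ℝ}

namespace IsOrderUnitCone

lemma smul_pow_sub_mem (hC : IsOrderUnitCone C u M) {A : ℕ → X →L[ℝ] X}
    (hA : ∀ n, ∀ v ∈ C, A n v ∈ C) {a b : ℝ} (ha : 0 ≤ a) (hb : 0 ≤ b) {v w : ℕ → X}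
    (h0 : v 0 - w 0 ∈ C) (hv : ∀ n, a • v (n + 1) - A n (v n) ∈ C)
    (hw : ∀ n, b • A n (w n) - w (n + 1) ∈ C) (n : ℕ) : (a * b) ^ n • v n - w n ∈ C := by
  induction n with
  | zero => simpa using h0
  | succ n ih =>
    have h1 := hC.smul_mem (a := (a * b) ^ n * b) (by positivity) (hv n)
    have h2 := hC.smul_mem hb (hA n _ ih)
    convert hC.add_mem (hC.add_mem h1 h2) (hw n) using 1
    simp only [map_sub, map_smul]
    module

lemma norm_le_of_unit_bound (hC : IsOrderUnitCone C u M)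
    (hν : ∀ v w : X, v ∈ C → w - v ∈ C → ‖v‖ ≤ ν * ‖w‖) {T : X →L[ℝ] X}
    (hT : ∀ v ∈ C, T v ∈ C) : ‖T‖ ≤ (2 * ν + 1) * M * ‖T u‖ := by
  have hM := hC.pos
  have hν0 : 0 ≤ ν := by
    have := hν u u hC.unit_mem (by simpa using hC.zero_mem)
    rw [hC.norm_unit] at this
    linarith
  refine T.opNorm_le_bound (by positivity) fun w => ?_
  have h1 := hT _ (hC.unit_add_mem w)
  have h2 := hT _ (hC.unit_sub_mem w)
  rw [map_add, map_smul] at h1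
  rw [map_sub, map_smul] at h2
  have h3 := hν _ ((2 * (M * ‖w‖)) • T u) h1 (by convert h2 using 1; module)
  rw [norm_smul, Real.norm_of_nonneg (by positivity)] at h3
  have h4 := norm_sub_le ((M * ‖w‖) • T u + T w) ((M * ‖w‖) • T u)
  rw [add_sub_cancel_left, norm_smul, Real.norm_of_nonneg (by positivity)] at h4
  linarith

end IsOrderUnitCone

lemma UniformlyPositive.smul_apply_add_mem (hC : IsOrderUnitCone C u M) {σ : ℝ} {T : X →L[ℝ] X}
    (hT : UniformlyPositive C u σ T) {v r : X} (hv : v ∈ C) {e τ : ℝ} (hτ : 0 ≤ τ)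
    (hr : ‖r‖ ≤ e * ‖v‖) (he : M * e ≤ τ * σ) : τ • T v + r ∈ C := by
  have h1 := hC.smul_mem hτ (hT v hv)
  have h2 := hC.unit_add_mem_of_norm_le (v := r) (a := τ * (σ * ‖v‖)) (by
    calc _ ≤ M * (e * ‖v‖) := mul_le_mul_of_nonneg_left hr hC.pos.le
      _ = M * e * ‖v‖ := by ring
      _ ≤ τ * σ * ‖v‖ := by gcongr
      _ = _ := by ring)
  convert hC.add_mem h1 h2 using 1
  module

/-- Birkhoff-Hopf type contraction: vectors that stay incomparable to zero decay relatively to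
positive vectors. -/
lemma norm_opProd_le_of_forall_notMem (hC : IsOrderUnitCone C u M)
    (hν : ∀ v w : X, v ∈ C → w - v ∈ C → ‖v‖ ≤ ν * ‖w‖) {σ Λ a : ℝ} (hσ : 0 < σ) (hΛ : 0 < Λ)
    (hσΛ : σ ≤ 2 * M * Λ) (ha : 0 < a)
    {L : ℕ → X →L[ℝ] X} (hL : ∀ i, UniformlyPositive C u σ (L i)) (hLΛ : ∀ i, ‖L i‖ ≤ Λ)
    {v w : X} (hv : v - a • u ∈ C) {n : ℕ} (hw : opProd L n w ∉ C) (hw' : -opProd L n w ∉ C) :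
    ‖opProd L n w‖ ≤
      2 * M * (ν + 1) / a * (1 - σ / (2 * M * Λ)) ^ n * ‖w‖ * ‖opProd L n v‖ := by
  have hM := hC.pos
  have hν0 : 0 ≤ ν := by
    have := hν u u hC.unit_mem (by simpa using hC.zero_mem)
    rw [hC.norm_unit] at this
    linarith
  set κ := σ / (2 * M * Λ) with hκ
  have hκ1 : κ ≤ 1 := by rw [hκ]; exact (div_le_one (by positivity)).2 hσΛ
  have hvC : v ∈ C := by
    simpa using hC.add_mem hv (hC.smul_mem ha.le hC.unit_mem)
  have hVC : ∀ n, opProd L n v ∈ C := fun n => by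
    induction n with
    | zero => exact hvC
    | succ n ih => exact (hL n).mem hC hσ.le ih
  have hw0 : 0 ≤ ‖w‖ := norm_nonneg w
  have step : ∀ n, ∃ α β : ℝ, opProd L n w - α • opProd L n v ∈ C ∧
      β • opProd L n v - opProd L n w ∈ C ∧ α ≤ β ∧ β - α ≤ 2 * M / a * ‖w‖ * (1 - κ) ^ n := by
    intro n
    induction n with
    | zero =>
      have h1 := hC.smul_mem (a := M * ‖w‖ / a) (by positivity) hv
      have h2 : (M * ‖w‖ / a) * a = M * ‖w‖ := by field_simp
      refine ⟨-(M * ‖w‖ / a), M * ‖w‖ / a, ?_, ?_, ?_, le_of_eq ?_⟩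
      · have h3 := hC.unit_add_mem w
        rw [← h2] at h3
        convert hC.add_mem h1 h3 using 1
        simp only [opProd_zero_apply]
        module
      · have h3 := hC.unit_sub_mem w
        rw [← h2] at h3
        convert hC.add_mem h1 h3 using 1
        simp only [opProd_zero_apply]
        module
      · have : 0 ≤ M * ‖w‖ / a := by positivity
        linarith
      · ring
    | succ n ih =>
      obtain ⟨α, β, h1, h2, h3, h4⟩ := ih
      set V := opProd L n v with hV
      set W := opProd L n w with hW
      have hd : 0 ≤ β - α := sub_nonneg.2 h3
      have hcl : ∀ p ∈ C, (β - α) * ‖V‖ / 2 ≤ ‖p‖ → L n p - (κ * (β - α)) • L n V ∈ C := by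
        intro p hp hpn
        have g1 := hL n p hp
        have g2 := hC.unit_sub_mem_of_norm_le (v := (κ * (β - α)) • L n V) (a := σ * ‖p‖) (by
          rw [norm_smul, Real.norm_of_nonneg (by positivity)]
          calc _ ≤ M * (κ * (β - α) * (Λ * ‖V‖)) := by
                gcongr
                exact (L n).le_of_opNorm_le (hLΛ n) V
            _ = σ * ((β - α) * ‖V‖ / 2) := by rw [hκ]; field_simp
            _ ≤ _ := by gcongr)
        convert hC.add_mem g1 g2 using 1
        module
      have hsum : (β - α) * ‖V‖ ≤ ‖W - α • V‖ + ‖β • V - W‖ := by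
        refine le_trans (le_of_eq ?_) (norm_add_le _ _)
        rw [show W - α • V + (β • V - W) = (β - α) • V by module, norm_smul,
          Real.norm_of_nonneg hd]
      have hlen : (1 - κ) * (β - α) ≤ 2 * M / a * ‖w‖ * (1 - κ) ^ (n + 1) := by
        calc _ ≤ (1 - κ) * (2 * M / a * ‖w‖ * (1 - κ) ^ n) := by
              gcongr
          _ = _ := by ring
      have hκ0 : 0 ≤ κ := by positivity
      rcases le_or_gt ((β - α) * ‖V‖ / 2) ‖W - α • V‖ with h | h
      · refine ⟨α + κ * (β - α), β, ?_, ?_, by nlinarith, by linarith⟩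
        · convert hcl _ h1 h using 1
          simp only [map_sub, map_smul, opProd_succ_apply]
          module
        · simpa only [map_sub, map_smul, opProd_succ_apply] using (hL n).mem hC hσ.le h2
      · refine ⟨α, β - κ * (β - α), ?_, ?_, by nlinarith, by linarith⟩
        · simpa only [map_sub, map_smul, opProd_succ_apply] using (hL n).mem hC hσ.le h1
        · convert hcl _ h2 (by linarith) using 1
          simp only [map_sub, map_smul, opProd_succ_apply]
          module
  obtain ⟨α, β, h1, h2, h3, h4⟩ := step n
  have hα : α ≤ 0 := by
    by_contra! h
    exact hw (by simpa using hC.add_mem h1 (hC.smul_mem h.le (hVC n)))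
  have hβ : 0 ≤ β := by
    by_contra! h
    refine hw' ?_
    convert hC.add_mem h2 (hC.smul_mem (a := -β) (by linarith) (hVC n)) using 1
    module
  have h5 := hν _ ((β - α) • opProd L n v) h1 (by convert h2 using 1; module)
  rw [norm_smul, Real.norm_of_nonneg (by linarith)] at h5
  have h6 := norm_add_le (opProd L n w - α • opProd L n v) (α • opProd L n v)
  rw [sub_add_cancel, norm_smul, Real.norm_of_nonpos hα] at h6
  have hV0 := norm_nonneg (opProd L n v)
  calc ‖opProd L n w‖ ≤ ν * ((β - α) * ‖opProd L n v‖) + -α * ‖opProd L n v‖ := by linarith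
    _ ≤ (ν + 1) * (β - α) * ‖opProd L n v‖ := by nlinarith
    _ ≤ (ν + 1) * (2 * M / a * ‖w‖ * (1 - κ) ^ n) * ‖opProd L n v‖ := by gcongr
    _ = _ := by ring

/-- A `C¹` map leaving `D` invariant, sending `D` to `K`, which is uniformly strongly monotone on
`D` together with its derivative. -/
structure IsMonotoneMap (C : Set X) (u : X) (σ Λ : ℝ) (K D : Set X) (G : X → X) : Prop where
  contDiff : ContDiff ℝ 1 G
  mapsTo : ∀ x ∈ D, G x ∈ D
  mapsTo_compact : ∀ x ∈ D, G x ∈ K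
  sub_mem : ∀ x ∈ D, ∀ y ∈ D, y - x ∈ C → G y - G x - (σ * ‖y - x‖) • u ∈ C
  uniformlyPositive : ∀ x ∈ D, UniformlyPositive C u σ (fderiv ℝ G x)
  norm_fderiv_le : ∀ x ∈ D, ‖fderiv ℝ G x‖ ≤ Λ

namespace IsMonotoneMap

variable {σ Λ : ℝ} {K D : Set X} {G : X → X}

lemma iterate_mem (hG : IsMonotoneMap C u σ Λ K D G) {x : X} (hx : x ∈ D) (n : ℕ) :
    G^[n] x ∈ D := by
  induction n with
  | zero => exact hx
  | succ n ih =>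
    rw [Function.iterate_succ_apply']
    exact hG.mapsTo _ ih

lemma iterate_succ_mem (hG : IsMonotoneMap C u σ Λ K D G) {x : X} (hx : x ∈ D) (n : ℕ) :
    G^[n + 1] x ∈ K := by
  rw [Function.iterate_succ_apply']
  exact hG.mapsTo_compact _ (hG.iterate_mem hx n)

lemma iterate_sub_mem (hC : IsOrderUnitCone C u M) (hσ : 0 < σ)
    (hG : IsMonotoneMap C u σ Λ K D G) {x y : X} (hx : x ∈ D) (hy : y ∈ D) (h : y - x ∈ C)
    (n : ℕ) : G^[n] y - G^[n] x ∈ C := by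
  induction n with
  | zero => exact h
  | succ n ih =>
    rw [Function.iterate_succ_apply', Function.iterate_succ_apply']
    have := hC.add_mem (hG.sub_mem _ (hG.iterate_mem hx n) _ (hG.iterate_mem hy n) ih)
      (hC.smul_mem (a := σ * ‖G^[n] y - G^[n] x‖) (by positivity) hC.unit_mem)
    simpa using this

lemma iterate_sub_ne_zero (hC : IsOrderUnitCone C u M) (hσ : 0 < σ)
    (hG : IsMonotoneMap C u σ Λ K D G) {x y : X} (hx : x ∈ D) (hy : y ∈ D) (h : y - x ∈ C)
    (h0 : y - x ≠ 0) (n : ℕ) : G^[n] y - G^[n] x ≠ 0 := by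
  induction n with
  | zero => exact h0
  | succ n ih =>
    intro heq
    have h1 := hC.le_mul_norm (hG.sub_mem _ (hG.iterate_mem hx n) _ (hG.iterate_mem hy n)
      (hG.iterate_sub_mem hC hσ hx hy h n))
    rw [← Function.iterate_succ_apply' G, ← Function.iterate_succ_apply' G, heq, norm_zero,
      mul_zero] at h1
    have := mul_pos hσ (norm_pos_iff.2 ih)
    linarith

/-- If arbitrarily good shadowing by a comparable point is possible, then the order unit has
subexponential growth along the orbit. -/
lemma exists_growth (hC : IsOrderUnitCone C u M)
    (hν : ∀ v w : X, v ∈ C → w - v ∈ C → ‖v‖ ≤ ν * ‖w‖) (hσ : 0 < σ) (hK : IsCompact K)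
    (hG : IsMonotoneMap C u σ Λ K D G) {x : X} (hx : x ∈ D)
    (h : ∀ δ : ℝ, 0 < δ → ∃ y ∈ D, (y - x ∈ C ∨ x - y ∈ C) ∧ y ≠ x ∧
      ∃ N, ∀ n, N ≤ n → ‖G^[n] x - G^[n] y‖ < δ) {ρ : ℝ} (hρ : 0 < ρ) :
    ∃ (c : ℝ) (N : ℕ), 0 < c ∧ ∀ n, N ≤ n →
      ‖opProd (fun i => fderiv ℝ G (G^[i] x)) n u‖ ≤ c * (1 + ρ) ^ n := by
  have hM := hC.pos
  have hν0 : 0 ≤ ν := by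
    have := hν u u hC.unit_mem (by simpa using hC.zero_mem)
    rw [hC.norm_unit] at this
    linarith
  set e := ρ * σ / ((1 + ρ) * M) with he
  have he0 : 0 < e := by positivity
  obtain ⟨δ, hδ, hlin⟩ := exists_norm_sub_sub_fderiv_le hG.contDiff hK he0
  obtain ⟨y, hy, hcomp, hne, N, hN⟩ := h δ hδ
  obtain ⟨d, hdC, hd0, hdu, hdd⟩ : ∃ d : ℕ → X, (∀ n, d n ∈ C) ∧ (∀ n, d n ≠ 0) ∧
      (∀ n, d (n + 1) - (σ * ‖d n‖) • u ∈ C) ∧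
      ((∀ n, d n = G^[n] y - G^[n] x) ∨ (∀ n, d n = -(G^[n] y - G^[n] x))) := by
    rcases hcomp with h | h
    · refine ⟨fun n => G^[n] y - G^[n] x, hG.iterate_sub_mem hC hσ hx hy h,
        hG.iterate_sub_ne_zero hC hσ hx hy h (sub_ne_zero.2 hne), fun n => ?_, Or.inl fun n => rfl⟩
      simp only [Function.iterate_succ_apply']
      exact hG.sub_mem _ (hG.iterate_mem hx n) _ (hG.iterate_mem hy n)
        (hG.iterate_sub_mem hC hσ hx hy h n)
    · refine ⟨fun n => G^[n] x - G^[n] y, hG.iterate_sub_mem hC hσ hy hx h,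
        hG.iterate_sub_ne_zero hC hσ hy hx h (sub_ne_zero.2 hne.symm), fun n => ?_,
        Or.inr fun n => by simp⟩
      simp only [Function.iterate_succ_apply']
      exact hG.sub_mem _ (hG.iterate_mem hy n) _ (hG.iterate_mem hx n)
        (hG.iterate_sub_mem hC hσ hy hx h n)
  have hdnorm : ∀ n, N ≤ n → ‖d n‖ < δ := fun n hn => by
    have := hN n hn
    rcases hdd with h | h
    · rwa [h, norm_sub_rev]
    · rwa [h, norm_neg, norm_sub_rev]
  have hdlin : ∀ n, N + 1 ≤ n →
      ‖d (n + 1) - fderiv ℝ G (G^[n] x) (d n)‖ ≤ e * ‖d n‖ := fun n hn => by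
    obtain ⟨m, rfl⟩ : ∃ m, n = m + 1 := ⟨n - 1, by omega⟩
    have h1 := hlin _ (hG.iterate_succ_mem hx m) (G^[m + 1] y)
      (by rw [norm_sub_rev]; exact hN _ (by omega))
    rcases hdd with h | h
    · rw [h, h, Function.iterate_succ_apply' G (m + 1), Function.iterate_succ_apply' G (m + 1)]
      exact h1
    · rw [h, h, map_neg, norm_neg, Function.iterate_succ_apply' G (m + 1),
        Function.iterate_succ_apply' G (m + 1), ← neg_sub', norm_neg]
      exact h1
  set A := fun i => fderiv ℝ G (G^[i] x) with hA
  have hAp : ∀ n, UniformlyPositive C u σ (A n) := fun n =>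
    hG.uniformlyPositive _ (hG.iterate_mem hx n)
  set a := σ * ‖d N‖ with ha
  have ha0 : 0 < a := mul_pos hσ (norm_pos_iff.2 (hd0 N))
  set b := M * ‖opProd A (N + 1) u‖ / a with hb
  have hb0 : 0 ≤ b := by positivity
  have key := hC.smul_pow_sub_mem (A := fun n => A (N + 1 + n))
    (fun n v hv => (hAp _).mem hC hσ.le hv) (a := 1 + ρ) (b := 1) (by positivity) zero_le_one
    (v := fun n => b • d (N + 1 + n))
    (w := fun n => opProd A (N + 1 + n) u) (by
      have h1 := hC.smul_mem hb0 (hdu N)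
      have h2 := hC.unit_sub_mem (opProd A (N + 1) u)
      convert hC.add_mem h1 h2 using 1
      have : M * ‖opProd A (N + 1) u‖ = b * a := by rw [hb]; field_simp
      rw [this]
      simp only [add_zero]
      module) (fun n => by
      have h1 := (hAp (N + 1 + n)).smul_apply_add_mem hC (hdC (N + 1 + n)) hρ.le
        (r := (1 + ρ) • (d (N + 1 + n + 1) - A (N + 1 + n) (d (N + 1 + n)))) (e := (1 + ρ) * e)
        (by
          rw [norm_smul, Real.norm_of_nonneg (by positivity), mul_assoc]
          exact mul_le_mul_of_nonneg_left (hdlin _ (by omega)) (by positivity))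
        (by rw [he]; field_simp; exact le_rfl)
      convert hC.smul_mem hb0 h1 using 1
      simp only [map_smul, add_assoc]
      module) (fun n => by
      simpa [← add_assoc] using hC.zero_mem)
  have hUC : ∀ n, opProd A n u ∈ C := fun n => by
    induction n with
    | zero => exact hC.unit_mem
    | succ n ih => exact (hAp n).mem hC hσ.le ih
  refine ⟨ν * b * δ + 1, N + 1, by positivity, fun n hn => ?_⟩
  obtain ⟨m, rfl⟩ := Nat.exists_eq_add_of_le hn
  have h1 := hν _ _ (hUC (N + 1 + m)) (key m)
  rw [mul_one, norm_smul, norm_smul, Real.norm_of_nonneg (by positivity),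
    Real.norm_of_nonneg hb0] at h1
  have h2 := hdnorm (N + 1 + m) (by omega)
  have h3 : (1 + ρ) ^ m ≤ (1 + ρ) ^ (N + 1 + m) := pow_le_pow_right₀ (by linarith) (by omega)
  calc _ ≤ _ := h1
    _ ≤ ν * ((1 + ρ) ^ (N + 1 + m) * (b * δ)) := by gcongr
    _ = ν * b * δ * (1 + ρ) ^ (N + 1 + m) := by ring
    _ ≤ _ := by gcongr; linarith

end IsMonotoneMap

end MonotoneMaps

section CloseReturns

variable {X : Type*} [NormedAddCommGroup X] [NormedSpace ℝ X]
variable {C : Set X} {u : X} {M ν : ℝ}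

lemma exists_clm_apply_eq (T : X →L[ℝ] X) {v w : X} {e : ℝ} (he : 0 ≤ e)
    (h : ‖w - T v‖ ≤ e * ‖v‖) : ∃ L : X →L[ℝ] X, ‖L - T‖ ≤ e ∧ L v = w := by
  rcases eq_or_ne v 0 with rfl | hv
  · refine ⟨T, by simpa using he, ?_⟩
    simp only [norm_zero, mul_zero, map_zero, sub_zero] at h ⊢
    exact (norm_le_zero_iff.1 h).symm
  · obtain ⟨f, hf, hfv⟩ := exists_dual_vector ℝ v (norm_ne_zero_iff.2 hv)
    have hv' : 0 < ‖v‖ := norm_pos_iff.2 hv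
    refine ⟨T + f.smulRight (‖v‖⁻¹ • (w - T v)), ?_, ?_⟩
    · rw [add_sub_cancel_left, ContinuousLinearMap.norm_smulRight_apply, hf, one_mul, norm_smul,
        norm_inv, norm_norm, inv_mul_le_iff₀ hv', mul_comm]
      exact h
    · simp only [_root_.add_apply, ContinuousLinearMap.smulRight_apply, hfv, smul_smul]
      simp [hv'.ne']

namespace IsMonotoneMap

variable {σ Λ : ℝ} {K D : Set X} {G : X → X}

lemma exists_tendsto_of_iterate_sub_mem (hC : IsOrderUnitCone C u M)
    (hν : ∀ v w : X, v ∈ C → w - v ∈ C → ‖v‖ ≤ ν * ‖w‖) (hσ : 0 < σ) (hK : IsCompact K)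
    (hG : IsMonotoneMap C u σ Λ K D G) {x : X} (hx : x ∈ D) (hxK : x ∈ K) {k m : ℕ}
    (h : G^[m + k] x - G^[m] x ∈ C ∨ -(G^[m + k] x - G^[m] x) ∈ C) :
    ∃ z ∈ K, ∃ n₁, Tendsto (fun j => G^[n₁ + j * k] x) atTop (𝓝 z) := by
  have hmem : ∀ n, G^[n] x ∈ K := fun n => by
    cases n with
    | zero => exact hxK
    | succ n => exact hG.iterate_succ_mem hx n
  have e1 : ∀ j, G^[m + j * k] x = G^[j * k] (G^[m] x) := fun j => by
    rw [add_comm, Function.iterate_add_apply]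
  have e2 : ∀ j, G^[m + (j + 1) * k] x = G^[j * k] (G^[m + k] x) := fun j => by
    rw [← Function.iterate_add_apply]
    congr 1
    ring
  rcases h with h | h
  · obtain ⟨z, hz, hlim⟩ := exists_tendsto_of_monotone hC hν hK
      (y := fun j => G^[m + j * k] x) (fun j => hmem _) (fun j => by
        rw [e2, e1]
        exact hG.iterate_sub_mem hC hσ (hG.iterate_mem hx _) (hG.iterate_mem hx _) h _)
    exact ⟨z, hz, m, hlim⟩
  · obtain ⟨z, hz, hlim⟩ := exists_tendsto_of_monotone hC hν hK.neg
      (y := fun j => -G^[m + j * k] x) (fun j => by simpa using hmem _) (fun j => by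
        rw [e2, e1, neg_sub_neg]
        exact hG.iterate_sub_mem hC hσ (hG.iterate_mem hx _) (hG.iterate_mem hx _)
          (by simpa using h) _)
    exact ⟨-z, by simpa using hz, m, by simpa using hlim.neg⟩

/-- A close return of an orbit along which the order unit grows slowly forces convergence of the
orbit to a cycle. -/
lemma exists_tendsto_of_close_return (hC : IsOrderUnitCone C u M)
    (hν : ∀ v w : X, v ∈ C → w - v ∈ C → ‖v‖ ≤ ν * ‖w‖) (hσ : 0 < σ) (hΛ : 0 ≤ Λ)
    (hK : IsCompact K) (hG : IsMonotoneMap C u σ Λ K D G) {x : X} (hx : x ∈ D) (hxK : x ∈ K)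
    {v : X} {a : ℝ} (ha : 0 < a) (hv : v - a • u ∈ C) {ρ : ℝ} (hρ : 0 < ρ)
    (hgrow : ∀ j, ‖opProd (fun i => fderiv ℝ G (G^[i] x)) j v‖ ≤ (1 + ρ) ^ (2 * j))
    {e δ : ℝ} (he : 0 ≤ e) (he₁ : M * e ≤ σ / 2) (he₂ : M * e ≤ ρ * σ)
    (hlin : ∀ x ∈ D, x ∈ K → ∀ y ∈ D, ‖y - x‖ < δ →
      ‖G y - G x - fderiv ℝ G x (y - x)‖ ≤ e * ‖y - x‖)
    (hr : (1 - σ / 2 / (2 * M * (Λ + σ))) * (1 + ρ) ^ 3 < 1) {δ' : ℝ} {k : ℕ} (hk : 0 < k)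
    (hclose : ‖G^[k] x - x‖ < δ') (hδ' : 2 * M * (ν + 1) / a * ν * δ' ≤ δ) :
    ∃ z ∈ K, ∃ n₁, Tendsto (fun j => G^[n₁ + j * k] x) atTop (𝓝 z) := by
  have hM := hC.pos
  have hM1 := hC.one_le
  have hν1 : 1 ≤ ν := by
    have := hν u u hC.unit_mem (by simpa using hC.zero_mem)
    rw [hC.norm_unit] at this
    linarith
  have hν0 : 0 < ν := by linarith
  set d : ℕ → X := fun i => G^[i + k] x - G^[i] x with hd
  by_cases hA : ∃ m, d m ∈ C ∨ -d m ∈ C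
  · obtain ⟨m, hm⟩ := hA
    exact hG.exists_tendsto_of_iterate_sub_mem hC hν hσ hK hx hxK hm
  push Not at hA
  have hmem : ∀ n, G^[n] x ∈ K := fun n => by
    cases n with
    | zero => exact hxK
    | succ n => exact hG.iterate_succ_mem hx n
  set T := fun i => fderiv ℝ G (G^[i] x) with hT
  have hTp : ∀ n, UniformlyPositive C u σ (T n) := fun n =>
    hG.uniformlyPositive _ (hG.iterate_mem hx n)
  have hex : ∀ i, ∃ L : X →L[ℝ] X, ‖L - T i‖ ≤ e ∧ (‖d i‖ < δ → L (d i) = d (i + 1)) := by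
    intro i
    by_cases h : ‖d i‖ < δ
    · have h1 := hlin _ (hG.iterate_mem hx i) (hmem i) _ (hG.iterate_mem hx (i + k)) h
      obtain ⟨L, h2, h3⟩ := exists_clm_apply_eq (T i) (v := d i) (w := d (i + 1)) he (by
        simp only [hd, add_right_comm i 1 k, Function.iterate_succ_apply' G] at h1 ⊢
        exact h1)
      exact ⟨L, h2, fun _ => h3⟩
    · exact ⟨T i, by simpa using he, fun h' => absurd h' h⟩
  choose L hLT hLd using hex
  have hLp : ∀ i, UniformlyPositive C u (σ / 2) (L i) := fun i =>
    ((hTp i).of_norm_sub_le hC (hLT i)).mono hC (by linarith)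
  have hLΛ : ∀ i, ‖L i‖ ≤ Λ + σ := fun i => by
    have h1 := norm_add_le (L i - T i) (T i)
    rw [sub_add_cancel] at h1
    have h2 := hG.norm_fderiv_le _ (hG.iterate_mem hx i)
    have h3 := hLT i
    have h4 : e ≤ M * e := le_mul_of_one_le_left he hM1
    change ‖T i‖ ≤ Λ at h2
    linarith
  have hvC : v ∈ C := by
    simpa using hC.add_mem hv (hC.smul_mem ha.le hC.unit_mem)
  have hVC : ∀ n, opProd L n v ∈ C := fun n => by
    induction n with
    | zero => exact hvC
    | succ n ih => exact (hLp n).mem hC (by positivity) ih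
  have hVn : ∀ n, ‖opProd L n v‖ ≤ ν * ((1 + ρ) ^ 3) ^ n := fun n => by
    have h1 := hC.smul_pow_sub_mem (A := T) (fun n v hv => (hTp n).mem hC hσ.le hv) (a := 1)
      (b := 1 + ρ) zero_le_one (by positivity) (v := fun n => opProd T n v)
      (w := fun n => opProd L n v) (by simpa using hC.zero_mem)
      (fun n => by simpa using hC.zero_mem) (fun n => by
        have := (hTp n).smul_apply_add_mem hC (hVC n) hρ.le
          (r := -((L n - T n) (opProd L n v))) (e := e)
          (by rw [norm_neg]; exact (L n - T n).le_of_opNorm_le (hLT n) _) he₂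
        convert this using 1
        simp only [_root_.sub_apply, opProd_succ_apply]
        module) n
    have h2 := hν _ _ (hVC n) h1
    rw [one_mul, norm_smul, Real.norm_of_nonneg (by positivity)] at h2
    calc _ ≤ _ := h2
      _ ≤ ν * ((1 + ρ) ^ n * (1 + ρ) ^ (2 * n)) := by
        gcongr
        exact hgrow n
      _ = _ := by rw [← pow_add, ← pow_mul]; congr 2; ring
  set θ := 1 - σ / 2 / (2 * M * (Λ + σ)) with hθ
  have hσΛ : σ / 2 ≤ 2 * M * (Λ + σ) := by nlinarith
  have hθ0 : 0 ≤ θ := by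
    rw [hθ, sub_nonneg]
    exact (div_le_one (by positivity)).2 hσΛ
  set K₀ := 2 * M * (ν + 1) / a * ν with hK₀
  have hK₀0 : 0 < K₀ := by positivity
  set r := θ * (1 + ρ) ^ 3 with hrdef
  have hr0 : 0 ≤ r := by positivity
  have hbound : ∀ j, d j = opProd L j (d 0) → ‖d j‖ ≤ K₀ * r ^ j * ‖d 0‖ := fun j hj => by
    have h1 := norm_opProd_le_of_forall_notMem hC hν (half_pos hσ) (by positivity) hσΛ ha hLp hLΛ
      hv (w := d 0) (n := j) (by rw [← hj]; exact (hA j).1) (by rw [← hj]; exact (hA j).2)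
    rw [hj]
    calc _ ≤ _ := h1
      _ ≤ 2 * M * (ν + 1) / a * θ ^ j * ‖d 0‖ * (ν * ((1 + ρ) ^ 3) ^ j) := by
        gcongr
        exact hVn j
      _ = _ := by rw [hK₀, hrdef, mul_pow]; ring
  have hd0 : K₀ * ‖d 0‖ < δ := by
    have : ‖d 0‖ < δ' := by simpa [hd] using hclose
    exact (mul_lt_mul_of_pos_left this hK₀0).trans_le hδ'
  have hdj : ∀ j, d j = opProd L j (d 0) := fun j => by
    induction j with
    | zero => rfl
    | succ j ih =>
      rw [opProd_succ_apply, ← ih, hLd]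
      refine lt_of_le_of_lt ((hbound j ih).trans ?_) hd0
      gcongr
      exact mul_le_of_le_one_right hK₀0.le (pow_le_one₀ hr0 hr.le)
  have hcauchy : CauchySeq fun j => G^[0 + j * k] x := by
    refine cauchySeq_of_le_geometric (r ^ k) (K₀ * ‖d 0‖) (pow_lt_one₀ hr0 hr hk.ne') fun j => ?_
    rw [dist_comm, dist_eq_norm]
    have h1 := hbound (j * k) (hdj _)
    have h2 : G^[0 + (j + 1) * k] x - G^[0 + j * k] x = d (j * k) := by
      simp only [hd, zero_add, add_mul, one_mul]
    rw [h2]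
    calc _ ≤ _ := h1
      _ = _ := by rw [mul_comm j k, pow_mul]; ring
  obtain ⟨z, hz, hlim⟩ := cauchySeq_tendsto_of_isComplete hK.isComplete (fun j => hmem _) hcauchy
  exact ⟨z, hz, 0, hlim⟩

end IsMonotoneMap

end CloseReturns

section Alternative

variable {X : Type*} [NormedAddCommGroup X] [NormedSpace ℝ X]
variable {C : Set X} {u : X} {M ν : ℝ}

lemma UniformlyPositive.opProd_ne_zero (hC : IsOrderUnitCone C u M) {σ : ℝ} (hσ : 0 < σ)
    {L : ℕ → X →L[ℝ] X} (hL : ∀ i, UniformlyPositive C u σ (L i)) (n : ℕ) :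
    opProd L n u ∈ C ∧ opProd L n u ≠ 0 := by
  induction n with
  | zero => exact ⟨hC.unit_mem, hC.unit_ne_zero⟩
  | succ n ih =>
    refine ⟨(hL n).mem hC hσ.le ih.1, fun h => ?_⟩
    have h1 := (hL n).le_norm hC ih.1
    rw [opProd_succ_apply] at h
    rw [h, norm_zero] at h1
    have := mul_pos (div_pos hσ hC.pos) (norm_pos_iff.2 ih.2)
    linarith

namespace IsMonotoneMap

variable {σ Λ : ℝ} {K D : Set X} {G : X → X}

/-- Slow growth of the order unit along an orbit converging to a cycle passes to the cycle. -/
lemma exists_norm_opProd_le_of_tendsto (hC : IsOrderUnitCone C u M)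
    (hν : ∀ v w : X, v ∈ C → w - v ∈ C → ‖v‖ ≤ ν * ‖w‖) (hσ : 0 < σ)
    (hG : IsMonotoneMap C u σ Λ K D G) {x : X} (hx : x ∈ D) {ρ : ℝ} (hρ : 0 < ρ) {c : ℝ} {N : ℕ}
    (hgrow : ∀ n, N ≤ n → ‖opProd (fun i => fderiv ℝ G (G^[i] x)) n u‖ ≤ c * (1 + ρ) ^ n)
    {z : X} {n₁ k : ℕ} (hk : 0 < k) (hz : G^[k] z = z)
    (hlim : Tendsto (fun j => G^[n₁ + j * k] x) atTop (𝓝 z)) :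
    ∃ b : ℝ, ∀ n, ‖opProd (fun i => fderiv ℝ G (G^[i] z)) n‖ ≤ b * ((1 + ρ) ^ 2) ^ n := by
  have hM := hC.pos
  have hν0 : 0 ≤ ν := by
    have := hν u u hC.unit_mem (by simpa using hC.zero_mem)
    rw [hC.norm_unit] at this
    linarith
  have hcont : Continuous (fderiv ℝ G) := hG.contDiff.continuous_fderiv one_ne_zero
  have hGc : Continuous G := hG.contDiff.continuous
  set A := fun i => fderiv ℝ G (G^[i] x) with hA
  set T := fun i => fderiv ℝ G (G^[i] z) with hT
  have hlim' : ∀ i, Tendsto (fun j => A (n₁ + j * k + i)) atTop (𝓝 (T i)) := fun i => by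
    have h1 := ((hcont.comp (hGc.iterate i)).tendsto z).comp hlim
    refine h1.congr fun j => ?_
    simp only [hA, Function.comp_apply, ← Function.iterate_add_apply]
    rw [add_comm]
  have hAp : ∀ n, UniformlyPositive C u σ (A n) := fun n =>
    hG.uniformlyPositive _ (hG.iterate_mem hx n)
  have hTp : ∀ n, UniformlyPositive C u σ (T n) := fun n v hv => by
    have h1 : Tendsto (fun j => A (n₁ + j * k + n) v - (σ * ‖v‖) • u) atTop
        (𝓝 (T n v - (σ * ‖v‖) • u)) :=
      (((ContinuousLinearMap.apply ℝ X v).continuous.tendsto _).comp (hlim' n)).sub_const _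
    exact hC.isClosed.mem_of_tendsto h1 (Eventually.of_forall fun j => hAp _ v hv)
  have hTper : ∀ i, T (i + k) = T i := fun i => by
    simp only [hT]
    rw [Function.iterate_add_apply, hz]
  set e := ρ * σ / M with he
  have he0 : 0 < e := by positivity
  have hev : ∀ᶠ j in atTop, ∀ i ∈ Finset.range k, ‖A (n₁ + j * k + i) - T i‖ ≤ e := by
    refine (Filter.eventually_all_finset _).2 fun i _ => ?_
    filter_upwards [(Metric.tendsto_nhds.1 (hlim' i)) e he0] with j hj
    rw [← dist_eq_norm]
    exact hj.le
  obtain ⟨J, hJ⟩ := Filter.eventually_atTop.1 hev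
  have hclose : ∀ i, ∀ j, J ≤ j → ‖A (n₁ + j * k + i) - T i‖ ≤ e := by
    intro i
    induction i using Nat.strong_induction_on with
    | _ i ih =>
      intro j hj
      rcases lt_or_ge i k with h | h
      · exact hJ j hj i (Finset.mem_range.2 h)
      · obtain ⟨i', rfl⟩ := Nat.exists_eq_add_of_le' h
        have := ih i' (by omega) (j + 1) (by omega)
        rw [hTper]
        convert this using 4
        ring
  set j := max J (N + 1) with hj
  obtain ⟨N₀, hN₀⟩ : ∃ N₀, n₁ + j * k = N₀ + 1 := by
    refine ⟨n₁ + j * k - 1, ?_⟩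
    have h1 : 1 ≤ j := le_trans (by omega) (le_max_right J (N + 1))
    have h2 : 1 * 1 ≤ j * k := Nat.mul_le_mul h1 hk
    omega
  have hN₁ : N ≤ N₀ + 1 := by
    have h1 : N + 1 ≤ j := le_max_right _ _
    have h2 : j * 1 ≤ j * k := Nat.mul_le_mul_left _ hk
    omega
  have hcl : ∀ i, ‖A (N₀ + 1 + i) - T i‖ ≤ e := fun i => by
    have := hclose i j (le_max_left _ _)
    rwa [hN₀] at this
  have hU := UniformlyPositive.opProd_ne_zero hC hσ hAp
  set a := σ * ‖opProd A N₀ u‖ with ha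
  have ha0 : 0 < a := mul_pos hσ (norm_pos_iff.2 (hU N₀).2)
  have hTC : ∀ n, ∀ v ∈ C, opProd T n v ∈ C := fun n v hv => by
    induction n with
    | zero => exact hv
    | succ n ih => exact (hTp n).mem hC hσ.le ih
  have key := hC.smul_pow_sub_mem (A := T) (fun n v hv => (hTp n).mem hC hσ.le hv)
    (a := 1 + ρ) (b := 1) (by positivity) zero_le_one
    (v := fun n => a⁻¹ • opProd A (N₀ + 1 + n) u) (w := fun n => opProd T n u) (by
      have h1 := hC.smul_mem (inv_nonneg.2 ha0.le) (hAp N₀ _ (hU N₀).1)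
      rw [smul_sub, smul_smul, ← ha, inv_mul_cancel₀ ha0.ne', one_smul] at h1
      exact h1) (fun n => by
      have h1 := (hAp (N₀ + 1 + n)).smul_apply_add_mem hC (hU (N₀ + 1 + n)).1 hρ.le
        (r := (A (N₀ + 1 + n) - T n) (opProd A (N₀ + 1 + n) u)) (e := e)
        ((A (N₀ + 1 + n) - T n).le_of_opNorm_le (hcl n) _)
        (by rw [he, mul_div_cancel₀ _ hM.ne'])
      convert hC.smul_mem (inv_nonneg.2 ha0.le) h1 using 1
      simp only [map_smul, ← add_assoc, opProd_succ_apply, _root_.sub_apply]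
      module) (fun n => by simpa using hC.zero_mem)
  refine ⟨(2 * ν + 1) * M * (ν * a⁻¹ * c * (1 + ρ) ^ (N₀ + 1)), fun n => ?_⟩
  have h1 := hC.norm_le_of_unit_bound hν (hTC n)
  have h2 := hν _ _ (hTC n u hC.unit_mem) (key n)
  rw [mul_one, norm_smul, norm_smul, Real.norm_of_nonneg (by positivity),
    Real.norm_of_nonneg (by positivity)] at h2
  have h3 := hgrow (N₀ + 1 + n) (by omega)
  calc _ ≤ _ := h1
    _ ≤ (2 * ν + 1) * M * (ν * ((1 + ρ) ^ n * (a⁻¹ * (c * (1 + ρ) ^ (N₀ + 1 + n))))) := by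
      gcongr
      exact h2.trans (by gcongr)
    _ = _ := by rw [pow_add, ← pow_mul, mul_comm 2 n, pow_mul]; ring

lemma isLinStableCycleLe_of_tendsto [CompleteSpace X] [Nontrivial X] (hC : IsOrderUnitCone C u M)
    (hν : ∀ v w : X, v ∈ C → w - v ∈ C → ‖v‖ ≤ ν * ‖w‖) (hσ : 0 < σ)
    (hG : IsMonotoneMap C u σ Λ K D G) {x : X} (hx : x ∈ D)
    (hgrow : ∀ ρ : ℝ, 0 < ρ → ∃ (c : ℝ) (N : ℕ), 0 < c ∧ ∀ n, N ≤ n →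
      ‖opProd (fun i => fderiv ℝ G (G^[i] x)) n u‖ ≤ c * (1 + ρ) ^ n)
    {z : X} {n₁ k m : ℕ} (hk : 0 < k) (hkm : k ≤ m)
    (hlim : Tendsto (fun j => G^[n₁ + j * k] x) atTop (𝓝 z)) :
    IsLinStableCycleLe G m (omegaMap G x) := by
  have hGc : Continuous G := hG.contDiff.continuous
  have hGd : Differentiable ℝ G := hG.contDiff.differentiable one_ne_zero
  have hz : G^[k] z = z := by
    refine tendsto_nhds_unique ?_ ((tendsto_add_atTop_iff_nat 1).2 hlim)
    have h1 := ((hGc.iterate k).tendsto z).comp hlim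
    refine h1.congr fun j => ?_
    simp only [Function.comp_apply, ← Function.iterate_add_apply]
    congr 1
    ring
  have hper : Function.IsPeriodicPt G k z := hz
  set p := Function.minimalPeriod G z with hp
  have hpz : G^[p] z = z := Function.isPeriodicPt_minimalPeriod G z
  refine ⟨p, hper.minimalPeriod_pos hk, (hper.minimalPeriod_le hk).trans hkm, z, hpz,
    fun l hl hlp h => Function.not_isPeriodicPt_of_pos_of_lt_minimalPeriod hl.ne' hlp h, ?_,
    omegaMap_eq_of_tendsto hGc hk hlim⟩
  refine spectralRadius_le_one_of_growth _ fun a ha => ?_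
  obtain ⟨ρ, hρ, hρa⟩ := exists_one_add_pow_lt ha (2 * p)
  obtain ⟨c, N, hc, hN⟩ := hgrow ρ hρ
  obtain ⟨b, hb⟩ := hG.exists_norm_opProd_le_of_tendsto hC hν hσ hx hρ hN hk hz hlim
  have hb0 : 0 ≤ b := by
    have := hb 0
    rw [pow_zero, mul_one] at this
    exact (norm_nonneg _).trans this
  refine ⟨b, fun l => ?_⟩
  have h1 : HasFDerivAt (G^[p]) (fderiv ℝ (G^[p]) z) z := (hGd.iterate p z).hasFDerivAt
  have h2 := (h1.iterate hpz l).fderiv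
  rw [← Function.iterate_mul, fderiv_iterate_eq_opProd hGd] at h2
  rw [← h2]
  calc _ ≤ _ := hb _
    _ = b * ((1 + ρ) ^ (2 * p)) ^ l := by rw [← pow_mul, ← pow_mul, mul_assoc]
    _ ≤ _ := by gcongr

/-- The dynamics alternative for uniformly strongly monotone maps. -/
theorem exists_alternative [CompleteSpace X] [Nontrivial X] (hC : IsOrderUnitCone C u M)
    (hν : ∀ v w : X, v ∈ C → w - v ∈ C → ‖v‖ ≤ ν * ‖w‖) {σ Λ : ℝ} (hσ : 0 < σ) (hΛ : 0 ≤ Λ) :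
    ∃ e : ℝ, 0 < e ∧ ∀ δ : ℝ, 0 < δ → ∀ K : Set X, IsCompact K → ∃ m : ℕ, 0 < m ∧
      ∀ (D : Set X) (G : X → X), IsMonotoneMap C u σ Λ K D G →
        (∀ x ∈ D, x ∈ K → ∀ y ∈ D, ‖y - x‖ < δ →
          ‖G y - G x - fderiv ℝ G x (y - x)‖ ≤ e * ‖y - x‖) →
        ∀ x ∈ D, IsLinStableCycleLe G m (omegaMap G x) ∨
          ∃ δ : ℝ≥0, 0 < δ ∧ ∀ y ∈ D, (coneLT C y x ∨ coneLT C x y) →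
            (δ : ℝ≥0∞) ≤ atTop.limsup fun n : ℕ => (‖G^[n] x - G^[n] y‖₊ : ℝ≥0∞) := by
  have hM := hC.pos
  have hM1 := hC.one_le
  have hν1 : 1 ≤ ν := by
    have := hν u u hC.unit_mem (by simpa using hC.zero_mem)
    rw [hC.norm_unit] at this
    linarith
  have hν0 : 0 < ν := by linarith
  obtain ⟨ρ, hρ, hr⟩ : ∃ ρ : ℝ, 0 < ρ ∧ (1 - σ / 2 / (2 * M * (Λ + σ))) * (1 + ρ) ^ 3 < 1 := by
    set θ := 1 - σ / 2 / (2 * M * (Λ + σ)) with hθ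
    have hθ1 : θ < 1 := by
      have : 0 < σ / 2 / (2 * M * (Λ + σ)) := by positivity
      linarith
    rcases le_or_gt θ 0 with h | h
    · refine ⟨1, one_pos, lt_of_le_of_lt (mul_nonpos_of_nonpos_of_nonneg h ?_) one_pos⟩
      positivity
    · obtain ⟨ρ, h1, h2⟩ := exists_one_add_pow_lt ((one_lt_inv₀ h).2 hθ1) 3
      refine ⟨ρ, h1, ?_⟩
      calc _ < θ * θ⁻¹ := mul_lt_mul_of_pos_left h2 h
        _ = 1 := mul_inv_cancel₀ h.ne'
  have hq : 0 < min (1 / 2) ρ := lt_min (by norm_num) hρ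
  have hMe : M * (σ / M * min (1 / 2) ρ) = σ * min (1 / 2) ρ := by field_simp
  refine ⟨σ / M * min (1 / 2) ρ, by positivity, fun δ hδ K hK => ?_⟩
  have hl : 0 < Real.log (1 + ρ) := Real.log_pos (by linarith)
  set l := Real.log (1 + ρ) with hldef
  set a := σ / (Λ + σ) with ha
  have ha0 : 0 < a := by positivity
  set δ' := δ / (2 * M * (ν + 1) / a * ν) with hδ'
  have hδ'0 : 0 < δ' := by positivity
  obtain ⟨t, -, htfin, ht⟩ := hK.finite_cover_balls (half_pos hδ'0)
  set B := max 0 (2 * l - Real.log (σ / M)) with hB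
  have hB0 : 0 ≤ B := le_max_left _ _
  set N := htfin.toFinset.card with hN
  obtain ⟨T, hT⟩ := exists_nat_gt (N * B / l)
  rw [div_lt_iff₀ hl] at hT
  refine ⟨T, ?_, fun D G hG hlin x hx => ?_⟩
  · have h1 : (0 : ℝ) < T := by
      by_contra! h
      have : (T : ℝ) * l ≤ 0 := mul_nonpos_of_nonpos_of_nonneg h hl.le
      have : 0 ≤ N * B := by positivity
      linarith
    exact_mod_cast h1
  by_cases hsep : ∃ δ : ℝ≥0, 0 < δ ∧ ∀ y ∈ D, (coneLT C y x ∨ coneLT C x y) →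
      (δ : ℝ≥0∞) ≤ atTop.limsup fun n : ℕ => (‖G^[n] x - G^[n] y‖₊ : ℝ≥0∞)
  · exact Or.inr hsep
  left
  push Not at hsep
  have hshadow : ∀ δ : ℝ, 0 < δ → ∃ y ∈ D, (y - x ∈ C ∨ x - y ∈ C) ∧ y ≠ x ∧
      ∃ N, ∀ n, N ≤ n → ‖G^[n] x - G^[n] y‖ < δ := fun δ hδ => by
    lift δ to ℝ≥0 using hδ.le
    obtain ⟨y, hy, hcomp, hlt⟩ := hsep δ (by exact_mod_cast hδ)
    refine ⟨y, hy, ?_, ?_, ?_⟩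
    · exact hcomp.symm.imp (fun h => h.1) (fun h => h.1)
    · rcases hcomp with h | h
      · exact fun hyx => h.2 (by simp [hyx])
      · exact fun hyx => h.2 (by simp [hyx])
    · obtain ⟨N, hN⟩ := Filter.eventually_atTop.1 (Filter.eventually_lt_of_limsup_lt hlt)
      refine ⟨N, fun n hn => ?_⟩
      have := hN n hn
      rw [ENNReal.coe_lt_coe] at this
      exact_mod_cast this
  have hgrow : ∀ ρ : ℝ, 0 < ρ → ∃ (c : ℝ) (N : ℕ), 0 < c ∧ ∀ n, N ≤ n →
      ‖opProd (fun i => fderiv ℝ G (G^[i] x)) n u‖ ≤ c * (1 + ρ) ^ n := fun ρ hρ =>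
    hG.exists_growth hC hν hσ hK hx hshadow hρ
  obtain ⟨c, N₀, hc, hN₀⟩ := hgrow ρ hρ
  set A := fun i => fderiv ℝ G (G^[i] x) with hA
  have hAp : ∀ n, UniformlyPositive C u σ (A n) := fun n =>
    hG.uniformlyPositive _ (hG.iterate_mem hx n)
  have hU := UniformlyPositive.opProd_ne_zero hC hσ hAp
  have hU0 : ∀ n, 0 < ‖opProd A n u‖ := fun n => norm_pos_iff.2 (hU n).2
  set S : ℕ → ℝ := fun n => Real.log ‖opProd A (n + 1) u‖ - 2 * (n + 1) * l with hS
  have hcover : ∀ n, ∃ y ∈ t, G^[n + 1] x ∈ ball y (δ' / 2) := fun n => by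
    simpa using ht (hG.iterate_succ_mem hx n)
  choose f hft hfb using hcover
  obtain ⟨n, k, hk, hkT, hfeq, hmax⟩ := exists_maximal_times (S := S) (B := B)
    (c := Real.log c - l) (N₀ := N₀) hl hB0 hT (fun n => by
      have h1 := (hAp (n + 1)).le_norm hC (hU (n + 1)).1
      have h2 := Real.log_le_log (mul_pos (by positivity) (hU0 (n + 1))) h1
      rw [Real.log_mul (by positivity) (hU0 (n + 1)).ne'] at h2
      have h3 : 2 * l - Real.log (σ / M) ≤ B := le_max_right _ _
      simp only [hS, opProd_succ_apply A (n + 1)]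
      push_cast
      linarith) (fun n hn => by
      have h1 := Real.log_le_log (hU0 _) (hN₀ (n + 1) (by omega))
      rw [Real.log_mul hc.ne' (by positivity), Real.log_pow] at h1
      simp only [hS]
      push_cast at h1
      linarith) htfin.toFinset le_rfl f (fun n => by simpa using hft n)
  have hx' := hG.iterate_mem hx (n + 1)
  set x' := G^[n + 1] x with hx'def
  have hAeq : (fun i => fderiv ℝ G (G^[i] x')) = fun i => A (n + 1 + i) := by
    funext i
    simp only [hA, hx'def, ← Function.iterate_add_apply]
    rw [add_comm]
  set U := opProd A (n + 1) u with hUdef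
  have hUn : 0 < ‖U‖ := hU0 _
  obtain ⟨z, hz, n₁, hlim⟩ := hG.exists_tendsto_of_close_return hC hν hσ hΛ hK hx'
    (hG.iterate_succ_mem hx n) (v := ‖U‖⁻¹ • U) ha0 (by
      have h1 := hAp n _ (hU n).1
      have h2 : ‖U‖ ≤ (Λ + σ) * ‖opProd A n u‖ := by
        refine (A n).le_of_opNorm_le ?_ _
        have := hG.norm_fderiv_le _ (hG.iterate_mem hx n)
        linarith
      have h3 := hC.sub_smul_mem_of_le (b := a * ‖U‖) hC.unit_mem h1 (by
        rw [ha, div_mul_eq_mul_div, div_le_iff₀ (by positivity)]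
        calc _ ≤ σ * ((Λ + σ) * ‖opProd A n u‖) := by gcongr
          _ = _ := by ring)
      have h4 := hC.smul_mem (inv_nonneg.2 hUn.le) h3
      rw [smul_sub, smul_smul, mul_comm a, inv_mul_cancel_left₀ hUn.ne'] at h4
      exact h4) hρ (fun j => by
      rw [hAeq, map_smul, ← opProd_add_apply, norm_smul, norm_inv, norm_norm,
        inv_mul_le_iff₀ hUn]
      have h1 := hmax (n + j) (by omega)
      simp only [hS] at h1
      rw [← Real.log_le_log_iff (hU0 _) (by positivity), Real.log_mul hUn.ne' (by positivity),
        Real.log_pow, show n + 1 + j = n + j + 1 by ring]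
      push_cast at h1 ⊢
      linarith) (by positivity : 0 ≤ σ / M * min (1 / 2) ρ)
    (by rw [hMe]; nlinarith [min_le_left (1 / 2) ρ])
    (by rw [hMe]; nlinarith [min_le_right (1 / 2) ρ]) hlin hr hk (δ' := δ') (by
      have h1 := hfb n
      have h2 := hfb (n + k)
      rw [← hfeq, mem_ball] at h2
      rw [mem_ball] at h1
      rw [hx'def, ← Function.iterate_add_apply, show k + (n + 1) = n + k + 1 by ring,
        ← dist_eq_norm]
      linarith [dist_triangle_right (G^[n + k + 1] x) (G^[n + 1] x) (f n)])
    (by rw [hδ']; exact (mul_div_cancel₀ _ (by positivity)).le)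
  refine hG.isLinStableCycleLe_of_tendsto hC hν hσ hx hgrow (n₁ := n₁ + (n + 1)) hk hkT
    (hlim.congr fun j => ?_)
  rw [hx'def, ← Function.iterate_add_apply]
  congr 1
  ring

end IsMonotoneMap

end Alternative

section Hulls

variable {X : Type*} [NormedAddCommGroup X] [NormedSpace ℝ X]

/-- A `C¹` increment is given by an averaged derivative along the segment. -/
lemma exists_averaged_fderiv [CompleteSpace X] {G : X → X} (hG : ContDiff ℝ 1 G) (x y : X) :
    ∃ L : X →L[ℝ] X, L (y - x) = G y - G x ∧ ∀ S : Set (X →L[ℝ] X), IsClosed S → Convex ℝ S →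
      (∀ z ∈ segment ℝ x y, fderiv ℝ G z ∈ S) → L ∈ S := by
  have hcont : Continuous fun t : ℝ => fderiv ℝ G (x + t • (y - x)) :=
    (hG.continuous_fderiv one_ne_zero).comp (by fun_prop)
  refine ⟨∫ t in (0 : ℝ)..1, fderiv ℝ G (x + t • (y - x)), ?_, fun S hS hSc h => ?_⟩
  · rw [ContinuousLinearMap.intervalIntegral_apply (hcont.intervalIntegrable _ _)]
    have h1 : ∀ t : ℝ, HasDerivAt (fun t : ℝ => G (x + t • (y - x)))
        (fderiv ℝ G (x + t • (y - x)) (y - x)) t := fun t => by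
      have h2 : HasDerivAt (fun t : ℝ => x + t • (y - x)) (y - x) t := by
        simpa using ((hasDerivAt_id t).smul_const (y - x)).const_add x
      exact ((hG.differentiable one_ne_zero).differentiableAt.hasFDerivAt).comp_hasDerivAt t h2
    rw [intervalIntegral.integral_eq_sub_of_hasDerivAt (fun t _ => h1 t)
      ((hcont.clm_apply continuous_const).intervalIntegrable _ _)]
    simp
  · rw [intervalIntegral.integral_of_le zero_le_one]
    have : IsProbabilityMeasure (volume.restrict (Ioc (0 : ℝ) 1)) := ⟨by simp⟩
    refine hSc.integral_mem hS ?_ ((hcont.intervalIntegrable 0 1).1)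
    refine (ae_restrict_iff' measurableSet_Ioc).2 (Eventually.of_forall fun t ht => h _ ?_)
    rw [segment_eq_image']
    exact ⟨t, ⟨ht.1.le, ht.2⟩, rfl⟩

lemma IsCompactMap.isCompactOperator_fderiv [CompleteSpace X] {G : X → X} (hG : IsCompactMap G)
    {x : X} (hx : DifferentiableAt ℝ G x) : IsCompactOperator (fderiv ℝ G x) := by
  refine (isCompactOperator_iff_isCompact_closure_image_closedBall
    (fderiv ℝ G x : X →ₗ[ℝ] X) one_pos).2 ?_
  refine TotallyBounded.isCompact_of_isClosed (TotallyBounded.closure ?_) isClosed_closure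
  rw [Metric.totallyBounded_iff]
  intro e he
  obtain ⟨δ, hδ, h⟩ := Metric.eventually_nhds_iff.1
    (hx.hasFDerivAt.isLittleO.def (half_pos he))
  have hδ2 := half_pos hδ
  have h1 : TotallyBounded ((fun y => (δ / 2)⁻¹ • (y - G x)) ''
      closure (G '' closedBall x (δ / 2))) :=
    ((hG _ isBounded_closedBall).image (by fun_prop)).totallyBounded
  obtain ⟨t, ht, hcov⟩ := Metric.totallyBounded_iff.1 h1 (e / 2) (half_pos he)
  refine ⟨t, ht, ?_⟩
  rintro _ ⟨w, hw, rfl⟩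
  rw [mem_closedBall, dist_zero_right] at hw
  have h2 : ‖(δ / 2) • w‖ ≤ δ / 2 := by
    rw [norm_smul, Real.norm_of_nonneg hδ2.le]
    exact mul_le_of_le_one_right hδ2.le hw
  have h3 := h (y := x + (δ / 2) • w) (by rw [dist_eq_norm, add_sub_cancel_left]; linarith)
  rw [add_sub_cancel_left, map_smul] at h3
  have h4 := hcov ⟨_, subset_closure ⟨x + (δ / 2) • w, by
    rwa [mem_closedBall, dist_eq_norm, add_sub_cancel_left], rfl⟩, rfl⟩
  simp only [mem_iUnion₂, exists_prop] at h4 ⊢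
  obtain ⟨y, hy, h5⟩ := h4
  refine ⟨y, hy, ?_⟩
  rw [mem_ball] at h5 ⊢
  have h6 : dist (fderiv ℝ G x w) ((δ / 2)⁻¹ • (G (x + (δ / 2) • w) - G x)) ≤ e / 2 := by
    rw [dist_comm, dist_eq_norm]
    have h7 : (δ / 2)⁻¹ • (G (x + (δ / 2) • w) - G x) - fderiv ℝ G x w =
        (δ / 2)⁻¹ • (G (x + (δ / 2) • w) - G x - (δ / 2) • fderiv ℝ G x w) := by
      rw [smul_sub _ (_ - _), inv_smul_smul₀ hδ2.ne']
    rw [h7, norm_smul, norm_inv, Real.norm_of_nonneg hδ2.le, inv_mul_le_iff₀ hδ2]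
    calc _ ≤ _ := h3
      _ ≤ e / 2 * (δ / 2) := by gcongr
      _ = _ := mul_comm _ _
  have h8 := dist_triangle (fderiv ℝ G x w) ((δ / 2)⁻¹ • (G (x + (δ / 2) • w) - G x)) y
  change dist (fderiv ℝ G x w) y < e
  linarith

lemma IsCompact.isCompact_closedConvexHull {E : Type*} [NormedAddCommGroup E] [NormedSpace ℝ E]
    [CompleteSpace E] {S : Set E} (hS : IsCompact S) : IsCompact (closedConvexHull ℝ S) := by
  rw [closedConvexHull_eq_closure_convexHull]
  exact hS.totallyBounded.convexHull.closure.isCompact_of_isClosed isClosed_closure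

variable {C : Set X} {u : X} {M : ℝ}

lemma IsOrderUnitCone.isPositiveFamily_closedConvexHull [CompleteSpace X]
    (hC : IsOrderUnitCone C u M) {S : Set (X →L[ℝ] X)} (hS : IsCompact S)
    (hcpt : ∀ T ∈ S, IsCompactOperator T) (hpos : ∀ T ∈ S, StronglyPositive C T) :
    IsPositiveFamily C (closedConvexHull ℝ S) where
  isCompact := hS.isCompact_closedConvexHull
  compactOperator := by
    refine closedConvexHull_min hcpt ?_ isClosed_setOfPred_isCompactOperator
    intro T hT T' hT' a b _ _ _
    exact (IsCompactOperator.smul hT a).add (IsCompactOperator.smul hT' b)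
  stronglyPositive := by
    intro T hT v hv
    have hSv : IsCompact ((fun T : X →L[ℝ] X => T v) '' S) :=
      hS.image (ContinuousLinearMap.apply ℝ X v).continuous
    obtain ⟨a, ha, h⟩ := hC.exists_unit_le_of_isCompact hSv (by
      rintro _ ⟨T, hT, rfl⟩
      exact hpos T hT v hv)
    refine hC.mem_interior ha (closedConvexHull_min (t := {T : X →L[ℝ] X | T v - a • u ∈ C})
      (fun T hT => h _ ⟨T, hT, rfl⟩) ?_ ?_ hT)
    · intro T hT T' hT' b c hb hc hbc
      have := hC.add_mem (hC.smul_mem hb hT) (hC.smul_mem hc hT')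
      change b • T v + c • T' v - a • u ∈ C
      convert this using 1
      obtain rfl : c = 1 - b := by linarith
      module
    · exact hC.isClosed.preimage
        (((ContinuousLinearMap.apply ℝ X v).continuous).sub continuous_const)

end Hulls

section Trapping

variable {X : Type*} [NormedAddCommGroup X]

lemma IsAttractor.exists_trapping_nhd {F₀ : X → X} {A : Set X} (hA : IsAttractor F₀ A)
    (hF₀ : Continuous F₀) {δ : ℝ} (hδ : 0 < δ) :
    ∃ (D : Set X) (δ' : ℝ) (q : ℕ), IsOpen D ∧ A ⊆ D ∧ D ⊆ thickening δ A ∧ 0 < δ' ∧ δ' ≤ δ ∧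
      thickening δ' A ⊆ D ∧ (∀ x ∈ D, ∀ n, F₀^[n] x ∈ thickening δ A) ∧
      ∀ x ∈ D, ∀ n, q ≤ n → F₀^[n] x ∈ thickening (δ' / 2) A := by
  obtain ⟨hne, hcpt, hinv, hattr, -⟩ := hA
  have hbdd : IsBounded (thickening δ A) := hcpt.isBounded.thickening
  have hinv' : ∀ n, ∀ x ∈ A, F₀^[n] x ∈ A := fun n x hx => by
    induction n with
    | zero => exact hx
    | succ n ih =>
      rw [Function.iterate_succ_apply', ← hinv]
      exact mem_image_of_mem _ ih
  obtain ⟨N, hN⟩ := hattr _ hbdd δ hδ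
  set D := ⋂ j ∈ Finset.range (N + 1), F₀^[j] ⁻¹' thickening δ A with hD
  have hDo : IsOpen D := isOpen_biInter_finset fun j _ =>
    isOpen_thickening.preimage (hF₀.iterate j)
  have hAD : A ⊆ D := fun x hx => by
    simp only [hD, mem_iInter, mem_preimage]
    exact fun j _ => self_subset_thickening hδ A (hinv' j x hx)
  have hDj : ∀ x ∈ D, ∀ j, j ≤ N → F₀^[j] x ∈ thickening δ A := fun x hx j hj => by
    simp only [hD, mem_iInter, mem_preimage, Finset.mem_range] at hx
    exact hx j (by omega)
  have hDV : D ⊆ thickening δ A := fun x hx => hDj x hx 0 (Nat.zero_le _)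
  obtain ⟨δ₁, hδ₁, h₁⟩ := hcpt.exists_thickening_subset_open hDo hAD
  have hδ' : 0 < min δ₁ δ := lt_min hδ₁ hδ
  obtain ⟨q, hq⟩ := hattr _ hbdd (min δ₁ δ / 2) (half_pos hδ')
  refine ⟨D, min δ₁ δ, q, hDo, hAD, hDV, hδ', min_le_right _ _,
    (thickening_mono (min_le_left _ _) A).trans h₁, fun x hx n => ?_, fun x hx n hn => ?_⟩
  · rcases le_or_gt n N with h | h
    · exact hDj x hx n h
    · exact (mem_thickening_iff_infDist_lt hne).2 (hN n h.le x (hDV hx))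
  · exact (mem_thickening_iff_infDist_lt hne).2 (hq n hn x (hDV hx))

lemma mem_thickening_of_norm_sub_le {A : Set X} {a b d : ℝ} {x y : X} (hx : x ∈ thickening a A)
    (h : ‖y - x‖ ≤ b) (hd : a + b ≤ d) : y ∈ thickening d A := by
  obtain ⟨z, hz, hxz⟩ := mem_thickening_iff.1 hx
  refine mem_thickening_iff.2 ⟨z, hz, ?_⟩
  have := dist_triangle y x z
  rw [dist_eq_norm y x] at this
  linarith

/-- Trapping neighbourhoods persist under uniformly small perturbations. -/
lemma iterate_mem_of_norm_sub_le {F₀ G : X → X} {A D W : Set X} {δ δ' Λ η : ℝ} {q : ℕ}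
    (hδ' : 0 < δ') (hδδ' : δ' ≤ δ) (hD : thickening δ' A ⊆ D)
    (hDV : ∀ x ∈ D, ∀ n, F₀^[n] x ∈ thickening δ A)
    (hDq : ∀ x ∈ D, ∀ n, q ≤ n → F₀^[n] x ∈ thickening (δ' / 2) A)
    (hW : thickening (2 * δ) A ⊆ W) (hΛ : 0 ≤ Λ)
    (hLip : ∀ x ∈ W, ∀ y ∈ W, ‖F₀ x - F₀ y‖ ≤ Λ * ‖x - y‖)
    (hG : ∀ x ∈ thickening (2 * δ) A, ‖G x - F₀ x‖ ≤ η) (hη : 0 ≤ η)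
    (hηq : η * (Λ + 1) ^ (2 * q) ≤ δ' / 2) (hq : 0 < q) {x : X} (hx : x ∈ D) :
    (∀ n, q ≤ n → G^[n] x ∈ D) ∧ ∀ n, G^[n] x ∈ thickening (2 * δ) A := by
  have hthick : ∀ x ∈ D, ∀ n, ‖G^[n] x - F₀^[n] x‖ ≤ δ' / 2 → G^[n] x ∈ thickening (2 * δ) A :=
    fun x hx n h => mem_thickening_of_norm_sub_le (hDV x hx n) h (by linarith)
  have hpow : ∀ n, n ≤ 2 * q → η * (Λ + 1) ^ n ≤ δ' / 2 := fun n hn =>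
    le_trans (mul_le_mul_of_nonneg_left (pow_le_pow_right₀ (by linarith) hn) hη) hηq
  have hclose : ∀ x ∈ D, ∀ n, n ≤ 2 * q → ‖G^[n] x - F₀^[n] x‖ ≤ η * (Λ + 1) ^ n := by
    intro x hx n hn
    induction n with
    | zero => simpa using hη
    | succ n ih =>
      have h1 := ih (by omega)
      have h2 := hthick x hx n (h1.trans (hpow n (by omega)))
      have h3 : F₀^[n] x ∈ thickening (2 * δ) A := thickening_mono (by linarith) A (hDV x hx n)
      rw [Function.iterate_succ_apply', Function.iterate_succ_apply']
      have h4 := norm_add_le (G (G^[n] x) - F₀ (G^[n] x)) (F₀ (G^[n] x) - F₀ (F₀^[n] x))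
      rw [sub_add_sub_cancel] at h4
      have h5 := hLip _ (hW h2) _ (hW h3)
      have h6 := hG _ h2
      have h7 : Λ * ‖G^[n] x - F₀^[n] x‖ ≤ Λ * (η * (Λ + 1) ^ n) := by gcongr
      have h8 : η ≤ η * (Λ + 1) ^ n :=
        le_mul_of_one_le_right hη (one_le_pow₀ (by linarith))
      calc _ ≤ η * (Λ + 1) ^ n + Λ * (η * (Λ + 1) ^ n) := by linarith
        _ = _ := by ring
  have hclose' : ∀ x ∈ D, ∀ n, n ≤ 2 * q → ‖G^[n] x - F₀^[n] x‖ ≤ δ' / 2 := fun x hx n hn =>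
    (hclose x hx n hn).trans (hpow n hn)
  have hmem : ∀ x ∈ D, ∀ n, q ≤ n → n ≤ 2 * q → G^[n] x ∈ D := fun x hx n hn hn' =>
    hD (mem_thickening_of_norm_sub_le (hDq x hx n hn) (hclose' x hx n hn') (by linarith))
  have hall : ∀ n, ∀ x ∈ D, (q ≤ n → G^[n] x ∈ D) ∧ G^[n] x ∈ thickening (2 * δ) A := by
    intro n
    induction n using Nat.strong_induction_on with
    | _ n ih =>
      intro x hx
      rcases le_or_gt n (2 * q) with h | h
      · exact ⟨fun hn => hmem x hx n hn h, hthick x hx n (hclose' x hx n h)⟩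
      · obtain ⟨m, rfl⟩ := Nat.exists_eq_add_of_le' (show q ≤ n by omega)
        have h1 := ih m (by omega) _ (hmem x hx q le_rfl (by omega))
        rw [Function.iterate_add_apply]
        exact ⟨fun _ => h1.1 (by omega), h1.2⟩
  exact ⟨fun n hn => (hall n x hx).1 hn, fun n => (hall n x hx).2⟩

/-- Differences of two orbits are transported by products of averaged derivatives. -/
lemma exists_opProd_eq_iterate_sub [NormedSpace ℝ X] [CompleteSpace X] {G : X → X}
    (hG : ContDiff ℝ 1 G) (x y : X) : ∃ L : ℕ → X →L[ℝ] X,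
      (∀ n, opProd L n (y - x) = G^[n] y - G^[n] x) ∧ ∀ i, ∀ S : Set (X →L[ℝ] X), IsClosed S → Convex ℝ S →
        (∀ z ∈ segment ℝ (G^[i] x) (G^[i] y), fderiv ℝ G z ∈ S) → L i ∈ S := by
  choose L hL hLS using fun i => exists_averaged_fderiv hG (G^[i] x) (G^[i] y)
  refine ⟨L, fun n => ?_, hLS⟩
  induction n with
  | zero => rfl
  | succ n ih =>
    rw [opProd_succ_apply, ih, hL, Function.iterate_succ_apply', Function.iterate_succ_apply']

end Trapping

section Iterates

variable {X : Type*} [NormedAddCommGroup X] [NormedSpace ℝ X] [CompleteSpace X]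
variable {C : Set X} {u : X} {M σ Λ : ℝ} {q : ℕ} {𝒮 : Set (X →L[ℝ] X)} {G : X → X} {D K W : Set X}

lemma exists_opProd_eq_iterate_sub_of_mem (h𝒮 : IsClosed 𝒮) (h𝒮c : Convex ℝ 𝒮)
    (hG : ContDiff ℝ 1 G)
    (hseg : ∀ x ∈ W, ∀ y ∈ W, ∀ z ∈ segment ℝ x y, fderiv ℝ G z ∈ 𝒮)
    (hW : ∀ x ∈ D, ∀ n, G^[n] x ∈ W) {x y : X} (hx : x ∈ D) (hy : y ∈ D) :
    ∃ L : ℕ → X →L[ℝ] X, (∀ i, L i ∈ 𝒮) ∧ (∀ n, opProd L n (y - x) = G^[n] y - G^[n] x) ∧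
      ∀ i e, (∀ z ∈ segment ℝ (G^[i] x) (G^[i] y),
        ‖fderiv ℝ G z - fderiv ℝ G (G^[i] x)‖ ≤ e) → ‖L i - fderiv ℝ G (G^[i] x)‖ ≤ e := by
  obtain ⟨L, h1, h2⟩ := exists_opProd_eq_iterate_sub hG x y
  refine ⟨L, fun i => h2 i 𝒮 h𝒮 h𝒮c (hseg _ (hW x hx i) _ (hW y hy i)), h1, fun i e h => ?_⟩
  have := h2 i (closedBall (fderiv ℝ G (G^[i] x)) e) isClosed_closedBall (convex_closedBall _ _)
    (fun z hz => by rw [mem_closedBall, dist_eq_norm]; exact h z hz)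
  rwa [mem_closedBall, dist_eq_norm] at this

lemma isMonotoneMap_iterate (h𝒮 : IsClosed 𝒮) (h𝒮c : Convex ℝ 𝒮) (hΛ : 0 ≤ Λ)
    (h𝒮Λ : ∀ T ∈ 𝒮, ‖T‖ ≤ Λ)
    (hpos : ∀ L : ℕ → X →L[ℝ] X, (∀ i, L i ∈ 𝒮) → UniformlyPositive C u σ (opProd L q))
    (hq : 0 < q) (hG : ContDiff ℝ 1 G)
    (hseg : ∀ x ∈ W, ∀ y ∈ W, ∀ z ∈ segment ℝ x y, fderiv ℝ G z ∈ 𝒮)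
    (hW : ∀ x ∈ D, ∀ n, G^[n] x ∈ W) (hD : ∀ x ∈ D, G^[q] x ∈ D) (hK : ∀ x ∈ W, G x ∈ K) :
    IsMonotoneMap C u σ (Λ ^ q) K D (G^[q]) where
  contDiff := by
    clear hpos hq hD
    induction q with
    | zero => exact contDiff_id
    | succ n ih => exact Function.iterate_succ' G n ▸ hG.comp ih
  mapsTo := hD
  mapsTo_compact x hx := by
    obtain ⟨p, rfl⟩ := Nat.exists_eq_add_of_le' hq
    rw [Function.iterate_succ_apply']
    exact hK _ (hW x hx p)
  sub_mem x hx y hy h := by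
    obtain ⟨L, h1, h2, -⟩ := exists_opProd_eq_iterate_sub_of_mem h𝒮 h𝒮c hG hseg hW hx hy
    rw [← h2 q]
    exact hpos L h1 _ h
  uniformlyPositive x hx := by
    rw [fderiv_iterate_eq_opProd (hG.differentiable one_ne_zero)]
    exact hpos _ fun i => hseg _ (hW x hx i) _ (hW x hx i) _ (left_mem_segment ℝ _ _)
  norm_fderiv_le x hx := by
    rw [fderiv_iterate_eq_opProd (hG.differentiable one_ne_zero)]
    exact norm_opProd_le hΛ fun i _ =>
      h𝒮Λ _ (hseg _ (hW x hx i) _ (hW x hx i) _ (left_mem_segment ℝ _ _))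

lemma norm_iterate_sub_sub_fderiv_le (h𝒮 : IsClosed 𝒮) (h𝒮c : Convex ℝ 𝒮) (hΛ : 0 ≤ Λ)
    (h𝒮Λ : ∀ T ∈ 𝒮, ‖T‖ ≤ Λ) (hG : ContDiff ℝ 1 G)
    (hseg : ∀ x ∈ W, ∀ y ∈ W, ∀ z ∈ segment ℝ x y, fderiv ℝ G z ∈ 𝒮)
    (hW : ∀ x ∈ D, ∀ n, G^[n] x ∈ W) (hK : ∀ x ∈ W, G x ∈ K) {e e₂ δ₀ δ₁ : ℝ}
    (hpert : ∀ L T : ℕ → X →L[ℝ] X, (∀ i < q, ‖T i‖ ≤ Λ) → (∀ i < q, ‖L i - T i‖ ≤ e₂) →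
      ‖opProd L q - opProd T q‖ ≤ e)
    (hunif : ∀ x ∈ K, ∀ y ∈ W, ∀ z ∈ segment ℝ x y, x ∈ W → ‖z - x‖ < δ₁ →
      ‖fderiv ℝ G z - fderiv ℝ G x‖ ≤ e₂)
    (hδ : (Λ + 1) ^ q * δ₀ ≤ δ₁) {x y : X} (hx : x ∈ D) (hxK : x ∈ K) (hy : y ∈ D)
    (hxy : ‖y - x‖ < δ₀) :
    ‖G^[q] y - G^[q] x - fderiv ℝ (G^[q]) x (y - x)‖ ≤ e * ‖y - x‖ := by
  obtain ⟨L, h1, h2, h3⟩ := exists_opProd_eq_iterate_sub_of_mem h𝒮 h𝒮c hG hseg hW hx hy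
  have hmem : ∀ n, G^[n] x ∈ K := fun n => by
    cases n with
    | zero => exact hxK
    | succ n =>
      rw [Function.iterate_succ_apply']
      exact hK _ (hW x hx n)
  rw [fderiv_iterate_eq_opProd (hG.differentiable one_ne_zero), ← h2 q, ← _root_.sub_apply]
  refine ContinuousLinearMap.le_of_opNorm_le _ (hpert _ _ (fun i _ =>
    h𝒮Λ _ (hseg _ (hW x hx i) _ (hW x hx i) _ (left_mem_segment ℝ _ _))) fun i hi => ?_) _
  refine h3 i _ fun z hz => hunif _ (hmem i) _ (hW y hy i) _ hz (hW x hx i) ?_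
  calc ‖z - G^[i] x‖ ≤ ‖G^[i] y - G^[i] x‖ := norm_sub_le_of_mem_segment hz
    _ = ‖opProd L i (y - x)‖ := by rw [h2]
    _ ≤ Λ ^ i * ‖y - x‖ :=
      (opProd L i).le_of_opNorm_le (norm_opProd_le hΛ fun i _ => h𝒮Λ _ (h1 i)) _
    _ ≤ (Λ + 1) ^ i * ‖y - x‖ := by gcongr; linarith
    _ ≤ (Λ + 1) ^ q * ‖y - x‖ := by gcongr; linarith
    _ < (Λ + 1) ^ q * δ₀ := by gcongr
    _ ≤ δ₁ := hδ

end Iterates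

section Robust

variable {X : Type*} [NormedAddCommGroup X] [NormedSpace ℝ X]

lemma IsOrderUnitCone.narrowCone_subset_interior {C : Set X} {u : X} {M κ : ℝ}
    (hC : IsOrderUnitCone C u M) (hκ : 0 < κ) : narrowCone C u κ ⊆ interior C ∪ {0} := by
  intro v hv
  rcases eq_or_ne v 0 with rfl | h0
  · exact Or.inr rfl
  · exact Or.inl (hC.mem_interior (mul_pos hκ (norm_pos_iff.2 h0)) hv)

lemma UniformlyPositive.mem_interior {C : Set X} {u : X} {M σ : ℝ} {L : X →L[ℝ] X}
    (hL : UniformlyPositive C u σ L) (hC : IsOrderUnitCone C u M) (hσ : 0 < σ) {v : X}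
    (hv : v ∈ C \ {0}) : L v ∈ interior C :=
  hC.mem_interior (mul_pos hσ (norm_pos_iff.2 hv.2)) (hL v hv.1)

/-- Maps that are `C¹`-close to a strongly monotone compact map with a compact attractor are
eventually strongly monotone near the attractor, and satisfy the dynamics alternative there. -/
theorem IsAttractor.exists_robust_alternative [CompleteSpace X] [Nontrivial X] {C : Set X}
    (hC : StronglyOrderedCone C) {F₀ : X → X} (hF₀ : ContDiff ℝ 1 F₀) (hcpt : IsCompactMap F₀)
    (hpos : ∀ x, StronglyPositive C (fderiv ℝ F₀ x)) {A : Set X} (hA : IsAttractor F₀ A)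
    {K : Set X} (hK : IsCompact K) {c : X} {r : ℝ} (hAball : A ⊆ ball c r) :
    ∃ (C₁ D₁ : Set X) (q m : ℕ) (η : ℝ), IsCone C₁ ∧ (interior C₁).Nonempty ∧
      C₁ ⊆ interior C ∪ {0} ∧ IsOpen D₁ ∧ D₁ ⊆ ball c r ∧ A ⊆ D₁ ∧ 0 < q ∧ 0 < m ∧ 0 < η ∧
      ∀ G : X → X, ContDiff ℝ 1 G → (∀ x ∈ ball c r, G x ∈ K) →
        (∀ x ∈ ball c r, ‖G x - F₀ x‖ ≤ η) →
        (∀ x ∈ ball c r, ‖fderiv ℝ G x - fderiv ℝ F₀ x‖ ≤ η) →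
        (∀ n, q ≤ n → (∀ x ∈ D₁, G^[n] x ∈ D₁) ∧
          ∀ x ∈ D₁, ∀ y ∈ D₁, coneLT C₁ x y → coneLLT C₁ (G^[n] x) (G^[n] y)) ∧
        ∀ x ∈ D₁, IsLinStableCycleLe (G^[q]) m (omegaMap (G^[q]) x) ∨
          ∃ δ : ℝ≥0, 0 < δ ∧ ∀ y ∈ D₁, (coneLT C₁ y x ∨ coneLT C₁ x y) →
            (δ : ℝ≥0∞) ≤ atTop.limsup
              fun n : ℕ => (‖(G^[q])^[n] x - (G^[q])^[n] y‖₊ : ℝ≥0∞) := by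
  obtain ⟨u, M, hC⟩ := hC.exists_isOrderUnitCone
  have hDF := hF₀.continuous_fderiv one_ne_zero
  have hdiff := hF₀.differentiable one_ne_zero
  have hAc : IsCompact A := hA.2.1
  set Kc := closedConvexHull ℝ A with hKc
  have hKcc : IsCompact Kc := hAc.isCompact_closedConvexHull
  have hAK : A ⊆ Kc := subset_closedConvexHull
  set 𝒯 := closedConvexHull ℝ (fderiv ℝ F₀ '' Kc) with h𝒯def
  have h𝒯 : IsPositiveFamily C 𝒯 := by
    refine hC.isPositiveFamily_closedConvexHull (hKcc.image hDF) ?_ ?_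
    · rintro _ ⟨x, -, rfl⟩
      exact hcpt.isCompactOperator_fderiv (hdiff x)
    · rintro _ ⟨x, -, rfl⟩
      exact hpos x
  obtain ⟨κ, ε, q₀, hκ, hκ1, hε, hq₀, hrob⟩ := h𝒯.exists_robust hC
  have hC₁ := hC.isOrderUnitCone_narrowCone hκ hκ1
  obtain ⟨b, hb1, hb⟩ := h𝒯.exists_norm_le
  set Λ := b + ε with hΛdef
  have hΛ : 0 ≤ Λ := by positivity
  set 𝒮 := cthickening ε 𝒯 with h𝒮def
  have h𝒮 : IsClosed 𝒮 := isClosed_cthickening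
  have h𝒮c : Convex ℝ 𝒮 := convex_closedConvexHull.cthickening ε
  have h𝒮𝒯 : ∀ L ∈ 𝒮, ∃ T ∈ 𝒯, ‖L - T‖ ≤ ε := fun L hL => by
    rw [h𝒮def, h𝒯.isCompact.cthickening_eq_biUnion_closedBall hε.le] at hL
    simpa [dist_eq_norm] using hL
  have h𝒮Λ : ∀ L ∈ 𝒮, ‖L‖ ≤ Λ := fun L hL => by
    obtain ⟨T, hT, h⟩ := h𝒮𝒯 L hL
    have := norm_le_norm_add_norm_sub' L T
    linarith [hb T hT]
  obtain ⟨ρ, hρ, hρball⟩ := hAc.exists_thickening_subset_open isOpen_ball hAball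
  obtain ⟨δc, hδc, hclose⟩ := exists_forall_norm_sub_lt_of_isCompact hDF hKcc (half_pos hε)
  obtain ⟨δ, hδ, hδρ, hδδc⟩ : ∃ δ : ℝ, 0 < δ ∧ 2 * δ ≤ ρ ∧ 2 * δ ≤ δc :=
    ⟨min ρ δc / 2, by positivity, by linarith [min_le_left ρ δc], by linarith [min_le_right ρ δc]⟩
  set W := thickening (2 * δ) A with hWdef
  have hWball : W ⊆ ball c r := (thickening_mono hδρ A).trans hρball
  set Wc := thickening (2 * δ) Kc with hWcdef
  have hWc : Convex ℝ Wc := convex_closedConvexHull.thickening _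
  have hWWc : W ⊆ Wc := thickening_subset_of_subset _ hAK
  have hmem : ∀ z ∈ Wc, ∀ L : X →L[ℝ] X, ‖L - fderiv ℝ F₀ z‖ ≤ ε / 2 → L ∈ 𝒮 := by
    intro z hz L hL
    obtain ⟨a, ha, hza⟩ := mem_thickening_iff.1 hz
    rw [dist_eq_norm] at hza
    refine mem_cthickening_of_dist_le _ (fderiv ℝ F₀ a) _ _
      (subset_closedConvexHull (mem_image_of_mem _ ha)) ?_
    rw [dist_eq_norm]
    linarith [norm_sub_le_norm_sub_add_norm_sub L (fderiv ℝ F₀ z) (fderiv ℝ F₀ a),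
      hclose a ha z (hza.trans_le hδδc)]
  have hLip : ∀ x ∈ Wc, ∀ y ∈ Wc, ‖F₀ x - F₀ y‖ ≤ Λ * ‖x - y‖ := fun x hx y hy =>
    hWc.norm_image_sub_le_of_norm_fderiv_le (fun z _ => hdiff z)
      (fun z hz => h𝒮Λ _ (hmem z hz _ (by simpa using (half_pos hε).le))) hy hx
  obtain ⟨D, δ', q₁, hDo, hAD, -, hδ', hδδ', hDthick, hDV, hDq⟩ :=
    hA.exists_trapping_nhd hF₀.continuous hδ
  set q := max q₀ q₁ with hqdef
  have hq : 0 < q := hq₀.trans_le (le_max_left _ _)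
  obtain ⟨σ, hσ, hσpos⟩ := hrob q (le_max_left _ _)
  obtain ⟨e, he, halt⟩ := IsMonotoneMap.exists_alternative hC₁
    (fun v w => hC.narrowCone_normal hκ) hσ (pow_nonneg hΛ q)
  obtain ⟨e₂, he₂, hpert⟩ := exists_norm_opProd_sub_le (X := X) Λ q he
  obtain ⟨δ₁, hδ₁, hunif⟩ := exists_forall_norm_sub_lt_of_isCompact hDF hK (half_pos he₂)
  have hΛq : 0 < (Λ + 1) ^ q := by positivity
  obtain ⟨m, hm, halt⟩ := halt (δ₁ / (Λ + 1) ^ q) (by positivity) K hK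
  have hΛ2q : 0 < (Λ + 1) ^ (2 * q) := by positivity
  obtain ⟨η, hη, hηε, hηe, hηδ⟩ : ∃ η : ℝ, 0 < η ∧ η ≤ ε / 2 ∧ η ≤ e₂ / 4 ∧
      η ≤ δ' / 2 / (Λ + 1) ^ (2 * q) :=
    ⟨min (ε / 2) (min (e₂ / 4) (δ' / 2 / (Λ + 1) ^ (2 * q))), by positivity, min_le_left _ _,
      (min_le_right _ _).trans (min_le_left _ _), (min_le_right _ _).trans (min_le_right _ _)⟩
  rw [le_div_iff₀ hΛ2q] at hηδ
  have hq₁ : q₁ ≤ q := le_max_right _ _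
  have hDW : D ⊆ W := fun x hx => thickening_mono (by linarith) A (hDV x hx 0)
  refine ⟨narrowCone C u κ, D, q, m, η, hC₁.isCone, ⟨u, hC₁.mem_interior one_pos ?_⟩,
    hC.narrowCone_subset_interior hκ, hDo, hDW.trans hWball, hAD, hq, hm, hη,
    fun G hG hGK hG0 hG1 => ?_⟩
  · simpa using hC₁.zero_mem
  have hiter : ∀ x ∈ D, (∀ n, q ≤ n → G^[n] x ∈ D) ∧ ∀ n, G^[n] x ∈ W := fun x hx =>
    iterate_mem_of_norm_sub_le hδ' hδδ' hDthick hDV (fun x hx n hn => hDq x hx n (hq₁.trans hn))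
      hWWc hΛ hLip (fun x hx => hG0 x (hWball hx)) hη.le hηδ hq hx
  have hsegball : ∀ x ∈ W, ∀ y ∈ W, segment ℝ x y ⊆ ball c r := fun x hx y hy =>
    (convex_ball c r).segment_subset (hWball hx) (hWball hy)
  have hseg : ∀ x ∈ W, ∀ y ∈ W, ∀ z ∈ segment ℝ x y, fderiv ℝ G z ∈ 𝒮 := fun x hx y hy z hz =>
    hmem z (hWc.segment_subset (hWWc hx) (hWWc hy) hz) _
      ((hG1 z (hsegball x hx y hy hz)).trans hηε)
  have hW : ∀ x ∈ D, ∀ n, G^[n] x ∈ W := fun x hx => (hiter x hx).2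
  have hWK : ∀ x ∈ W, G x ∈ K := fun x hx => hGK x (hWball hx)
  refine ⟨fun n hn => ⟨fun x hx => (hiter x hx).1 n hn, fun x hx y hy hxy => ?_⟩,
    halt D _ (isMonotoneMap_iterate h𝒮 h𝒮c hΛ h𝒮Λ
      (fun L hL => hσpos L fun i _ => h𝒮𝒯 _ (hL i)) hq hG hseg hW
      (fun x hx => (hiter x hx).1 q le_rfl) hWK)
    fun x hx hxK y hy hxy => norm_iterate_sub_sub_fderiv_le h𝒮 h𝒮c hΛ h𝒮Λ hG hseg hW hWK hpert
      ?_ (mul_div_cancel₀ δ₁ hΛq.ne').le hx hxK hy hxy⟩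
  · obtain ⟨L, h1, h2, -⟩ := exists_opProd_eq_iterate_sub_of_mem h𝒮 h𝒮c hG hseg hW hx hy
    obtain ⟨σ', hσ', h⟩ := hrob n ((le_max_left _ _).trans hn)
    rw [coneLLT, ← h2]
    exact (h L fun i _ => h𝒮𝒯 _ (h1 i)).mem_interior hC₁ hσ' hxy
  · intro a haK y hy z hz ha hza
    have hz' := hG1 z (hsegball a ha y hy hz)
    have ha' := hG1 a (hWball ha)
    have := hunif a haK z hza
    rw [norm_sub_rev] at ha'
    linarith [norm_sub_le_norm_sub_add_norm_sub (fderiv ℝ G z) (fderiv ℝ F₀ z) (fderiv ℝ G a),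
      norm_sub_le_norm_sub_add_norm_sub (fderiv ℝ F₀ z) (fderiv ℝ F₀ a) (fderiv ℝ G a)]

end Robust

/-- **`C¹`-robustness for the sharpened dynamics alternative**: for sufficiently
`C¹`-small perturbations, there are a solid cone `C₁ ⊆ Int C ∪ {0}`, an open bounded
`D₁` with `B₁ ⊇ D₁ ⊇ A`, integers `q, m₁ > 0` and `ε₁ > 0` satisfying (i) forward
invariance and strong monotonicity of high iterates of `F_ε` on `D₁` w.r.t. `C₁`, and
(ii) the dynamics alternative for `F_ε^q` on `D₁`. -/
theorem robust_sharpened_alternative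
    {X : Type*} [NormedAddCommGroup X] [NormedSpace ℝ X] [CompleteSpace X]
    [TopologicalSpace.SeparableSpace X]
    (C : Set X) (hC : StronglyOrderedCone C)
    (F₀ : X → X) (hC1 : ContDiff ℝ 1 F₀) (hcpt : IsCompactMap F₀)
    (hpos : ∀ x : X, StronglyPositive C (fderiv ℝ F₀ x))
    (hdiss : PointwiseDissipative F₀)
    (A : Set X) (hA : IsAttractor F₀ A)
    (ε₀ : ℝ) (hε₀ : 0 < ε₀) (F : ℝ → X → X)
    (hFC1 : ContDiffOn ℝ 1 (fun p : ℝ × X => F p.1 p.2)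
      (Icc (-ε₀) ε₀ ×ˢ (univ : Set X)))
    (hFcpt : ∀ B : Set (ℝ × X), B ⊆ Icc (-ε₀) ε₀ ×ˢ (univ : Set X) → IsBounded B →
      IsCompact (closure ((fun p : ℝ × X => F p.1 p.2) '' B)))
    (c : X) (r : ℝ) (hr : 0 < r) (hAball : A ⊆ ball c r) :
    ∃ η : ℝ, 0 < η ∧
      ((∀ ε ∈ Icc (-ε₀) ε₀, ∀ x ∈ ball c r,
          ‖F ε x - F₀ x‖ + ‖fderiv ℝ (F ε) x - fderiv ℝ F₀ x‖ < η) →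
        ∃ (C₁ D₁ : Set X) (q m₁ : ℕ) (ε₁ : ℝ),
          IsCone C₁ ∧ (interior C₁).Nonempty ∧ C₁ ⊆ interior C ∪ {0} ∧
          IsOpen D₁ ∧ IsBounded D₁ ∧ D₁ ⊆ ball c r ∧ A ⊆ D₁ ∧
          0 < q ∧ 0 < m₁ ∧ 0 < ε₁ ∧
          ∀ ε ∈ Ioo (-ε₁) ε₁,
            (∀ n : ℕ, q ≤ n → (F ε)^[n] '' D₁ ⊆ D₁ ∧
              ∀ x ∈ D₁, ∀ y ∈ D₁, coneLT C₁ x y →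
                coneLLT C₁ ((F ε)^[n] x) ((F ε)^[n] y)) ∧
            (∀ x ∈ D₁,
              IsLinStableCycleLe ((F ε)^[q]) m₁ (omegaMap ((F ε)^[q]) x) ∨
                ∃ δ : ℝ≥0, 0 < δ ∧ ∀ y ∈ D₁, (coneLT C₁ y x ∨ coneLT C₁ x y) →
                  (δ : ℝ≥0∞) ≤ atTop.limsup
                    fun n : ℕ => (‖((F ε)^[q])^[n] x - ((F ε)^[q])^[n] y‖₊ : ℝ≥0∞))) := by
  have hGC : ∀ ε ∈ Icc (-ε₀) ε₀, ContDiff ℝ 1 (F ε) := fun ε hε =>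
    hFC1.comp_contDiff (f := fun x : X => (ε, x)) (by fun_prop) fun x => ⟨hε, mem_univ x⟩
  rcases subsingleton_or_nontrivial X with hX | hX
  · refine ⟨1, one_pos, fun _ => ⟨C, ball c r, 1, 1, 1, hC.1, hC.2, fun x _ => ?_, isOpen_ball,
      isBounded_ball, subset_rfl, hAball, one_pos, one_pos, one_pos, fun ε _ => ⟨fun n _ => ⟨?_,
        fun x _ y _ h => ?_⟩, fun x _ => Or.inr ⟨1, one_pos, fun y _ h => ?_⟩⟩⟩⟩
    · exact Or.inr (Subsingleton.elim x 0)
    · rintro _ ⟨x, hx, rfl⟩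
      rwa [Subsingleton.elim ((F ε)^[n] x) x]
    · exact absurd (Subsingleton.elim _ _) h.2
    · exact h.elim (fun h => absurd (Subsingleton.elim _ _) h.2)
        fun h => absurd (Subsingleton.elim _ _) h.2
  obtain ⟨C₁, D₁, q, m, η, h1, h2, h3, h4, h5, h6, h7, h8, hη, h⟩ :=
    hA.exists_robust_alternative hC hC1 hcpt hpos (hFcpt (Icc (-ε₀) ε₀ ×ˢ ball c r)
      (prod_mono subset_rfl (subset_univ _)) ((isBounded_Icc _ _).prod isBounded_ball)) hAball
  refine ⟨η, hη, fun hclose => ⟨C₁, D₁, q, m, ε₀, h1, h2, h3, h4, isBounded_ball.subset h5, h5, h6,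
    h7, h8, hε₀, fun ε hε => ?_⟩⟩
  have hε' := Ioo_subset_Icc_self hε
  obtain ⟨hmono, halt⟩ := h (F ε) (hGC ε hε')
    (fun x hx => subset_closure ⟨(ε, x), ⟨hε', hx⟩, rfl⟩)
    (fun x hx => by linarith [hclose ε hε' x hx, norm_nonneg (fderiv ℝ (F ε) x - fderiv ℝ F₀ x)])
    (fun x hx => by linarith [hclose ε hε' x hx, norm_nonneg (F ε x - F₀ x)])
  exact ⟨fun n hn => ⟨image_subset_iff.2 (hmono n hn).1, (hmono n hn).2⟩, halt⟩

end
end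

section
/- Let X be a Banach space, h : X → X a C¹ map, and x ∈ X a point whose orbit {hⁿx : n ≥ 0} is relatively compact. Then for every integer k ≥ 1, λ₁(x,h) ≤ (1/k)·λ₁(x,h^k), where λ₁(x,g) := limsup_{n→∞} (log‖Dgⁿ(x)‖)/n for a C¹ map g. -/
open Filter Topology MeasureTheory Set Bornology Metric
open scoped ENNReal NNReal

noncomputable section

/-- If a real sequence `u` satisfies `u n ≤ u (k * (n / k)) + B` for large `n`, its upper growth
rate is controlled along the multiples of `k`. -/
theorem limsup_div_le_inv_mul_limsup_mul_div {u : ℕ → ℝ} {k : ℕ} (hk : 1 ≤ k) {B : ℝ}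
    (hu : ∀ᶠ n in atTop, u n ≤ u (k * (n / k)) + B) :
    atTop.limsup (fun n : ℕ => ((u n / n : ℝ) : EReal)) ≤
      ((1 / (k : ℝ) : ℝ) : EReal) * atTop.limsup fun n : ℕ => ((u (k * n) / n : ℝ) : EReal) := by
  have hk0 : (0 : ℝ) < k := by exact_mod_cast hk
  set L := atTop.limsup fun n : ℕ => ((u (k * n) / n : ℝ) : EReal)
  have key : ∀ c : ℝ, L < c →
      atTop.limsup (fun n : ℕ => ((u n / n : ℝ) : EReal)) ≤ ((c / k : ℝ) : EReal) := by
    intro c hc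
    have hlarge : Tendsto (fun n : ℕ => n / k) atTop atTop := Nat.tendsto_div_const_atTop (by omega)
    have hev := hlarge.eventually (eventually_lt_of_limsup_lt hc)
    have hlim : Tendsto (fun n : ℕ => c / k + (|c| + B) / (n : ℝ)) atTop (𝓝 (c / k)) := by
      simpa using (tendsto_const_div_atTop_nhds_zero_nat (|c| + B)).const_add (c / k)
    have hlim' := (continuous_coe_real_ereal.tendsto (c / k)).comp hlim
    rw [← hlim'.limsup_eq]
    refine limsup_le_limsup ?_
    filter_upwards [hu, hev, hlarge.eventually_gt_atTop 0, eventually_gt_atTop 0]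
      with n hn hlt hq hn0
    simp only [Function.comp_apply, EReal.coe_le_coe_iff]
    have hq' : (0 : ℝ) < (n / k : ℕ) := by exact_mod_cast hq
    have hn' : (0 : ℝ) < n := by exact_mod_cast hn0
    rw [EReal.coe_lt_coe_iff, div_lt_iff₀ hq'] at hlt
    have h1 : ((n / k : ℕ) : ℝ) ≤ n / k := Nat.cast_div_le
    have h2 : (n : ℝ) / k ≤ (n / k : ℕ) + 1 := by
      rw [div_le_iff₀ hk0]
      exact_mod_cast (Nat.lt_div_mul_add (a := n) (b := k) (by omega)).le.trans (by lia)
    have h3 : c * (n / k : ℕ) ≤ c * (n / k) + |c| := by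
      have h4 : |c * ((n / k : ℕ) - (n : ℝ) / k)| ≤ |c| * 1 := by
        rw [abs_mul]
        exact mul_le_mul_of_nonneg_left (abs_le.2 ⟨by linarith, by linarith⟩) (abs_nonneg c)
      linarith [le_abs_self (c * ((n / k : ℕ) - (n : ℝ) / k))]
    rw [div_le_iff₀ hn', add_mul, div_mul_cancel₀ _ hn'.ne', div_mul_eq_mul_div, ← mul_div_assoc']
    linarith
  by_contra! hcon
  obtain ⟨d, hd, hd'⟩ := EReal.lt_iff_exists_real_btwn.1 hcon
  have hLd : L < ((k * d : ℝ) : EReal) := by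
    clear_value L
    induction L with
    | bot => exact EReal.bot_lt_coe _
    | coe a =>
      norm_cast at hd ⊢
      rwa [one_div_mul_eq_div, div_lt_iff₀' hk0] at hd
    | top => exact absurd hd (by simp [EReal.coe_mul_top_of_pos (inv_pos.2 hk0)])
  have := key _ hLd
  rw [mul_div_cancel_left₀ d hk0.ne'] at this
  exact this.not_gt hd'

section Iterate

variable {X : Type*} [NormedAddCommGroup X] [NormedSpace ℝ X] {h : X → X} {x : X} {C : ℝ}

/-- The derivative of an additional `r` iterates grows at most by the factor `C ^ r`, where `C`
bounds the derivative along the orbit. -/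
theorem norm_fderiv_iterate_add_le (hd : Differentiable ℝ h) (hC : 0 ≤ C)
    (hb : ∀ n : ℕ, ‖fderiv ℝ h (h^[n] x)‖ ≤ C) (m r : ℕ) :
    ‖fderiv ℝ (h^[m + r]) x‖ ≤ C ^ r * ‖fderiv ℝ (h^[m]) x‖ := by
  induction r with
  | zero => simp
  | succ r ih =>
    rw [← add_assoc, Function.iterate_succ', fderiv_comp x (hd _) (hd.iterate _ x)]
    calc _ ≤ ‖fderiv ℝ h (h^[m + r] x)‖ * ‖fderiv ℝ (h^[m + r]) x‖ :=
          ContinuousLinearMap.opNorm_comp_le _ _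
      _ ≤ C * (C ^ r * ‖fderiv ℝ (h^[m]) x‖) := by gcongr; exact hb _
      _ = C ^ (r + 1) * ‖fderiv ℝ (h^[m]) x‖ := by ring

/-- If the derivative of `h` is bounded along the orbit, the logarithmic growth at `n` exceeds the
one at the previous multiple of `k` by at most a constant, also when derivatives vanish. -/
theorem eventually_log_norm_fderiv_iterate_le (hd : Differentiable ℝ h) (hC : 1 ≤ C)
    (hb : ∀ n : ℕ, ‖fderiv ℝ h (h^[n] x)‖ ≤ C) {k : ℕ} (hk : 1 ≤ k) :
    ∀ᶠ n in atTop, Real.log ‖fderiv ℝ (h^[n]) x‖ ≤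
      Real.log ‖fderiv ℝ (h^[k * (n / k)]) x‖ + k * Real.log C := by
  have hstep := norm_fderiv_iterate_add_le hd (zero_le_one.trans hC) hb
  by_cases hz : ∃ N, ‖fderiv ℝ (h^[N]) x‖ = 0
  · obtain ⟨N, hN⟩ := hz
    have hvanish : ∀ n, N ≤ n → ‖fderiv ℝ (h^[n]) x‖ = 0 := by
      intro n hn
      obtain ⟨r, rfl⟩ := Nat.exists_eq_add_of_le hn
      exact le_antisymm (by simpa [hN] using hstep N r) (norm_nonneg _)
    filter_upwards [eventually_ge_atTop (N + k)] with n hn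
    have hmod := Nat.div_add_mod n k
    have hlt := Nat.mod_lt n hk
    rw [hvanish n (by omega), hvanish (k * (n / k)) (by omega)]
    simpa using mul_nonneg k.cast_nonneg (Real.log_nonneg hC)
  · push Not at hz
    refine Eventually.of_forall fun n => ?_
    have hle := hstep (k * (n / k)) (n % k)
    rw [Nat.div_add_mod] at hle
    have hpow : C ^ (n % k) ≤ C ^ k := pow_le_pow_right₀ hC (Nat.mod_lt n hk).le
    have hlog := Real.log_le_log ((norm_nonneg _).lt_of_ne' (hz n))
      (hle.trans (mul_le_mul_of_nonneg_right hpow (norm_nonneg _)))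
    rwa [Real.log_mul (by positivity) (hz _), Real.log_pow, add_comm] at hlog

end Iterate

/-- For a point with relatively compact orbit, `λ₁(x,h) ≤ (1/k) · λ₁(x,h^k)` for every
integer `k ≥ 1`. -/
theorem lambdaOne_le_inv_smul_lambdaOne_iterate
    {X : Type*} [NormedAddCommGroup X] [NormedSpace ℝ X]
    (h : X → X) (hC1 : ContDiff ℝ 1 h) (x : X)
    (horb : IsCompact (closure {y : X | ∃ n : ℕ, y = h^[n] x}))
    (k : ℕ) (hk : 1 ≤ k) :
    lambdaOne h x ≤ ((1 / (k : ℝ) : ℝ) : EReal) * lambdaOne (h^[k]) x := by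
  obtain ⟨C, hC⟩ := horb.exists_bound_of_continuousOn
    (hC1.continuous_fderiv one_ne_zero).continuousOn
  have hb : ∀ n : ℕ, ‖fderiv ℝ h (h^[n] x)‖ ≤ max 1 C := fun n =>
    (hC _ (subset_closure ⟨n, rfl⟩)).trans (le_max_right _ _)
  have hev := eventually_log_norm_fderiv_iterate_le (hC1.differentiable one_ne_zero)
    (le_max_left 1 C) hb hk
  simpa only [lambdaOne, ← Function.iterate_mul] using
    limsup_div_le_inv_mul_limsup_mul_div hk hev

end
end

section
/- Let X be a Banach space and Φ : [0,∞) × X → X a C¹-smooth semiflow. Let x ∈ X have relatively compact orbit {Φ_t x : t ≥ 0}, and let e be an equilibrium with λ₁(e,Φ) := limsup_{t→∞} (log‖DΦ_t(e)‖)/t ≤ 0 such that ω(x,Φ) = {e}. Then λ₁(x,Φ) := limsup_{t→∞} (log‖DΦ_t(x)‖)/t ≤ 0; in particular λ_max(x,Φ) := liminf_{t→∞} (log‖DΦ_t(x)‖)/t ≤ 0. -/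
open Filter Topology MeasureTheory Set Bornology Metric
open scoped ENNReal NNReal

noncomputable section

/-- If the orbit of `x` is relatively compact and `ω(x, Φ) = {e}`, then the orbit
converges to `e`. -/
theorem tendsto_of_omegaFlow_eq_singleton
    {X : Type*} [NormedAddCommGroup X] {Φ : ℝ → X → X} {x e : X}
    (horb : IsCompact (closure {y : X | ∃ t : ℝ, 0 ≤ t ∧ y = Φ t x}))
    (hω : omegaFlow Φ x = {e}) :
    Tendsto (fun t => Φ t x) atTop (𝓝 e) := by
  intro U hU
  set K : ℕ → Set X := fun n => closure {y : X | ∃ t : ℝ, (n : ℝ) ≤ t ∧ y = Φ t x} with hK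
  have hanti : ∀ a b : ℝ, a ≤ b → closure {y : X | ∃ t : ℝ, b ≤ t ∧ y = Φ t x} ⊆
      closure {y : X | ∃ t : ℝ, a ≤ t ∧ y = Φ t x} := fun a b hab =>
    closure_mono fun y ⟨t, ht, hy⟩ => ⟨t, hab.trans ht, hy⟩
  have hcpt : ∀ n, IsCompact (K n) := fun n =>
    horb.of_isClosed_subset isClosed_closure (hanti 0 n n.cast_nonneg)
  have hdir : Directed (· ⊇ ·) K := by
    intro a b
    refine ⟨max a b, hanti _ _ ?_, hanti _ _ ?_⟩ <;> exact_mod_cast by simp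
  have hsub : ∀ y ∈ ⋂ n, K n, U ∈ 𝓝 y := by
    intro y hy
    have hyω : y ∈ omegaFlow Φ x := by
      refine mem_iInter.2 fun s => ?_
      obtain ⟨n, hn⟩ := exists_nat_ge s
      exact hanti _ _ hn (mem_iInter.1 hy n)
    rw [hω, mem_singleton_iff] at hyω
    exact hyω ▸ hU
  obtain ⟨n, hn⟩ := exists_subset_nhds_of_isCompact hdir hcpt hsub
  refine mem_map.2 ?_
  filter_upwards [eventually_ge_atTop (n : ℝ)] with t ht
  exact hn (subset_closure ⟨t, ht, rfl⟩)

theorem IsSemiflow.continuousAt_time {X : Type*} [NormedAddCommGroup X] {Φ : ℝ → X → X}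
    (hΦ : IsSemiflow Φ) (y : X) {t : ℝ} (ht : 0 < t) :
    ContinuousAt (fun s => Φ s y) t := by
  have h : ContinuousOn (fun s => Φ s y) (Ici (0 : ℝ)) :=
    hΦ.2.2.comp (f := fun s : ℝ => (s, y)) (by fun_prop) fun s hs => ⟨hs, mem_univ _⟩
  exact h.continuousAt (Ici_mem_nhds ht)

section Semiflow

variable {X : Type*} [NormedAddCommGroup X] [NormedSpace ℝ X] {Φ : ℝ → X → X}

/-- The cocycle inequality for the derivative of a semiflow. -/
theorem IsSemiflow.norm_fderiv_add_le (hΦ : IsSemiflow Φ)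
    (hC1 : ∀ t : ℝ, 0 < t → ContDiff ℝ 1 (Φ t)) (x : X) {s t : ℝ} (hs : 0 < s) (ht : 0 < t) :
    ‖fderiv ℝ (Φ (t + s)) x‖ ≤ ‖fderiv ℝ (Φ t) (Φ s x)‖ * ‖fderiv ℝ (Φ s) x‖ := by
  have hcomp : Φ (t + s) = Φ t ∘ Φ s := funext fun y => hΦ.2.1 s t hs.le ht.le y
  rw [hcomp, fderiv_comp x ((hC1 t ht).differentiable (by simp) _)
    ((hC1 s hs).differentiable (by simp) _)]
  exact ContinuousLinearMap.opNorm_comp_le _ _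

/-- By the Baire category theorem, `t ↦ ‖DΦ_t(x)‖` is bounded near some positive time. -/
theorem IsSemiflow.exists_eventually_norm_fderiv_le (hΦ : IsSemiflow Φ)
    (hC1 : ∀ t : ℝ, 0 < t → ContDiff ℝ 1 (Φ t)) (x : X) :
    ∃ m : ℝ, 0 < m ∧ ∃ M : ℝ, ∀ᶠ s in 𝓝 m, ‖fderiv ℝ (Φ s) x‖ ≤ M := by
  set F : ℕ → Set ℝ := fun n =>
    {s | LipschitzOnWith n (Φ (Real.exp s)) (ball x (1 / ((n : ℝ) + 1)))} with hF
  have hcont : ∀ y, Continuous fun s => Φ (Real.exp s) y := fun y =>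
    continuous_iff_continuousAt.2 fun s =>
      ContinuousAt.comp (f := Real.exp) (g := fun s => Φ s y)
        (hΦ.continuousAt_time y (Real.exp_pos s)) Real.continuous_exp.continuousAt
  have hclosed : ∀ n, IsClosed (F n) := by
    intro n
    simp only [hF, lipschitzOnWith_iff_dist_le_mul, ofPred_forall]
    refine isClosed_iInter fun y => isClosed_iInter fun _ => isClosed_iInter fun z =>
      isClosed_iInter fun _ => isClosed_le ((hcont y).dist (hcont z)) continuous_const
  have hunion : ⋃ n, F n = univ := by
    refine eq_univ_of_forall fun s => mem_iUnion.2 ?_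
    obtain ⟨K, t, ht, hK⟩ :=
      (hC1 (Real.exp s) (Real.exp_pos s)).contDiffAt.exists_lipschitzOnWith (x := x)
    obtain ⟨δ, hδ, hball⟩ := Metric.mem_nhds_iff.1 ht
    obtain ⟨a, ha⟩ := exists_nat_one_div_lt hδ
    obtain ⟨b, hb⟩ := exists_nat_ge K
    refine ⟨max a b, (hK.mono ?_).weaken (hb.trans (by exact_mod_cast le_max_right a b))⟩
    refine (ball_subset_ball (le_trans ?_ ha.le)).trans hball
    have : (a : ℝ) ≤ ((max a b : ℕ) : ℝ) := by exact_mod_cast le_max_left a b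
    gcongr
  obtain ⟨n, s, hs⟩ := nonempty_interior_of_iUnion_of_closed hclosed hunion
  refine ⟨Real.exp s, Real.exp_pos s, n, ?_⟩
  have hlog : ∀ᶠ r in 𝓝 (Real.exp s), Real.log r ∈ F n := by
    have : Tendsto Real.log (𝓝 (Real.exp s)) (𝓝 s) := by
      simpa using (Real.continuousAt_log (Real.exp_pos s).ne').tendsto
    exact this (mem_interior_iff_mem_nhds.1 hs)
  filter_upwards [hlog, eventually_gt_nhds (Real.exp_pos s)] with r hr hr0
  simp only [hF, mem_ofPred_eq, Real.exp_log hr0] at hr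
  exact norm_fderiv_le_of_lipschitzOn ℝ (ball_mem_nhds x (by positivity)) hr

/-- `t ↦ ‖DΦ_t(x)‖` is bounded on compact sets of sufficiently large times. -/
theorem IsSemiflow.exists_norm_fderiv_le_on_compact (hΦ : IsSemiflow Φ)
    (hC1 : ∀ t : ℝ, 0 < t → ContDiff ℝ 1 (Φ t)) (x : X) :
    ∃ m : ℝ, 0 < m ∧ ∀ a b : ℝ, m < a →
      ∃ C : ℝ, ∀ s ∈ Icc a b, ‖fderiv ℝ (Φ s) x‖ ≤ C := by
  obtain ⟨m, hm, M, hM⟩ := hΦ.exists_eventually_norm_fderiv_le hC1 x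
  refine ⟨m, hm, fun a b ha => ?_⟩
  refine isCompact_Icc.induction_on (p := fun S => ∃ C : ℝ, ∀ s ∈ S, ‖fderiv ℝ (Φ s) x‖ ≤ C)
    ⟨0, by simp⟩ (fun S T hST ⟨C, hC⟩ => ⟨C, fun s hs => hC s (hST hs)⟩) ?_ ?_
  · rintro S T ⟨C, hC⟩ ⟨D, hD⟩
    refine ⟨max C D, fun s hs => ?_⟩
    rcases hs with hs | hs
    · exact (hC s hs).trans (le_max_left _ _)
    · exact (hD s hs).trans (le_max_right _ _)
  · intro t ht
    have hr : 0 < t - m := by linarith [ht.1]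
    set r := t - m with hr_def
    have hshift : Tendsto (fun s => s - r) (𝓝 t) (𝓝 m) := by
      have : Tendsto (fun s => s - r) (𝓝 t) (𝓝 (t - r)) :=
        (continuous_id.sub continuous_const).tendsto t
      simpa [hr_def] using this
    have hD : Tendsto (fun s => ‖fderiv ℝ (Φ r) (Φ (s - r) x)‖) (𝓝 t)
        (𝓝 ‖fderiv ℝ (Φ r) (Φ m x)‖) :=
      ((((hC1 r hr).continuous_fderiv (by simp)).tendsto _).comp
        ((hΦ.continuousAt_time x hm).tendsto.comp hshift)).norm
    have hev : ∀ᶠ s in 𝓝 t,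
        ‖fderiv ℝ (Φ s) x‖ ≤ (‖fderiv ℝ (Φ r) (Φ m x)‖ + 1) * M := by
      filter_upwards [hD.eventually_le_const (lt_add_one _), hshift.eventually hM,
        hshift.eventually (eventually_gt_nhds hm)] with s h₁ h₂ h₃
      have h := hΦ.norm_fderiv_add_le hC1 x h₃ hr
      rw [add_sub_cancel] at h
      exact h.trans (mul_le_mul h₁ h₂ (norm_nonneg _) (by positivity))
    exact ⟨_, mem_nhdsWithin_of_mem_nhds hev, _, fun s hs => hs⟩

/-- If `‖DΦ_T‖ ≤ q` along the orbit of `x` from time `a > 0` on, then `‖DΦ_t(x)‖` grows at most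
geometrically along the times `s + nT`. -/
theorem IsSemiflow.norm_fderiv_add_nat_mul_le (hΦ : IsSemiflow Φ)
    (hC1 : ∀ t : ℝ, 0 < t → ContDiff ℝ 1 (Φ t)) (x : X) {T a q : ℝ} (hT : 0 < T) (ha : 0 < a)
    (hq : ∀ s, a ≤ s → ‖fderiv ℝ (Φ T) (Φ s x)‖ ≤ q) {s : ℝ} (hs : a ≤ s) (n : ℕ) :
    ‖fderiv ℝ (Φ (s + n * T)) x‖ ≤ q ^ n * ‖fderiv ℝ (Φ s) x‖ := by
  have hq0 : 0 ≤ q := (norm_nonneg _).trans (hq a le_rfl)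
  induction n with
  | zero => simp
  | succ n ih =>
    have hs' : a ≤ s + n * T := hs.trans (le_add_of_nonneg_right (by positivity))
    have h := hΦ.norm_fderiv_add_le hC1 x (ha.trans_le hs') hT
    have htime : T + (s + n * T) = s + ((n + 1 : ℕ) : ℝ) * T := by push_cast; ring
    rw [htime] at h
    calc _ ≤ _ := h
      _ ≤ q * (q ^ n * ‖fderiv ℝ (Φ s) x‖) :=
        mul_le_mul (hq _ hs') ih (norm_nonneg _) hq0
      _ = _ := by ring

/-- An orbit converging to `e` has exponential growth rate at most that of `e`: a bound on
`‖DΦ_T(e)‖` at one time `T > 0` propagates to all large times. -/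
theorem IsSemiflow.exists_norm_fderiv_le_exp (hΦ : IsSemiflow Φ)
    (hC1 : ∀ t : ℝ, 0 < t → ContDiff ℝ 1 (Φ t)) {x e : X}
    (hlim : Tendsto (fun t => Φ t x) atTop (𝓝 e)) {T ε : ℝ} (hT : 0 < T) (hε : 0 ≤ ε)
    (he : ‖fderiv ℝ (Φ T) e‖ < Real.exp (ε * T)) :
    ∃ C : ℝ, 1 ≤ C ∧ ∀ᶠ t in atTop, ‖fderiv ℝ (Φ t) x‖ ≤ C * Real.exp (ε * t) := by
  obtain ⟨m, hm, hbdd⟩ := hΦ.exists_norm_fderiv_le_on_compact hC1 x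
  have hnear : ∀ᶠ t in atTop, ‖fderiv ℝ (Φ T) (Φ t x)‖ < Real.exp (ε * T) :=
    ((((hC1 T hT).continuous_fderiv (by simp)).tendsto e).comp hlim).norm.eventually_lt_const he
  obtain ⟨a₀, ha₀⟩ := eventually_atTop.1 hnear
  set a := max a₀ (m + 1) with ha_def
  have ham : m < a := (lt_add_one m).trans_le (le_max_right _ _)
  have ha : 0 < a := hm.trans ham
  obtain ⟨C, hC⟩ := hbdd a (a + T) ham
  refine ⟨max C 1, le_max_right _ _, ?_⟩
  filter_upwards [eventually_ge_atTop a] with t ht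
  set n := ⌊(t - a) / T⌋₊ with hn_def
  have h₁ : (n : ℝ) * T ≤ t - a := by
    rw [← le_div_iff₀ hT]
    exact Nat.floor_le (div_nonneg (sub_nonneg.2 ht) hT.le)
  have h₂ : t - a < ((n : ℝ) + 1) * T := by
    rw [← div_lt_iff₀ hT]
    exact Nat.lt_floor_add_one _
  have hs : t - n * T ∈ Icc a (a + T) := ⟨by linarith, by linarith⟩
  have h := hΦ.norm_fderiv_add_nat_mul_le hC1 x hT ha
    (fun s hs => (ha₀ s ((le_max_left _ _).trans hs)).le) hs.1 n
  rw [sub_add_cancel, ← Real.exp_nat_mul] at h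
  calc _ ≤ _ := h
    _ ≤ Real.exp (ε * t) * max C 1 := by
      refine mul_le_mul (Real.exp_le_exp.2 ?_) ((hC _ hs).trans (le_max_left _ _))
        (norm_nonneg _) (Real.exp_pos _).le
      calc (n : ℝ) * (ε * T) = ε * (n * T) := by ring
        _ ≤ ε * t := mul_le_mul_of_nonneg_left (by linarith) hε
    _ = _ := mul_comm _ _

theorem lambdaOneFlow_nonpos_of_tendsto (hΦ : IsSemiflow Φ)
    (hC1 : ∀ t : ℝ, 0 < t → ContDiff ℝ 1 (Φ t)) {x e : X}
    (hlim : Tendsto (fun t => Φ t x) atTop (𝓝 e)) (hstab : lambdaOneFlow Φ e ≤ 0) :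
    lambdaOneFlow Φ x ≤ 0 := by
  refine le_of_forall_gt fun c hc => ?_
  obtain ⟨δ, hδ, hδc⟩ := EReal.lt_iff_exists_real_btwn.1 hc
  have hδ0 : 0 < δ := by exact_mod_cast hδ
  refine lt_of_le_of_lt ?_ hδc
  have hε : 0 < δ / 2 := half_pos hδ0
  have hev : ∀ᶠ t in atTop,
      ((Real.log ‖fderiv ℝ (Φ t) e‖ / t : ℝ) : EReal) < ((δ / 2 : ℝ) : EReal) :=
    eventually_lt_of_limsup_lt (hstab.trans_lt (by exact_mod_cast hε))
  obtain ⟨T, hlt, hT⟩ := (hev.and (eventually_gt_atTop (0 : ℝ))).exists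
  have he : ‖fderiv ℝ (Φ T) e‖ < Real.exp (δ / 2 * T) := by
    rcases (norm_nonneg (fderiv ℝ (Φ T) e)).eq_or_lt with h | h
    · rw [← h]; exact Real.exp_pos _
    · rw [← Real.log_lt_iff_lt_exp h, ← div_lt_iff₀ hT]
      exact_mod_cast hlt
  obtain ⟨C, hC, hle⟩ := hΦ.exists_norm_fderiv_le_exp hC1 hlim hT hε.le he
  refine limsup_le_of_le (by isBoundedDefault) ?_
  filter_upwards [hle, eventually_gt_atTop (0 : ℝ),
    eventually_ge_atTop (Real.log C / (δ / 2))] with t ht ht0 htC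
  rw [EReal.coe_le_coe_iff, div_le_iff₀ ht0]
  rw [div_le_iff₀ hε] at htC
  rcases (norm_nonneg (fderiv ℝ (Φ t) x)).eq_or_lt with h | h
  · rw [← h, Real.log_zero]; positivity
  · have := Real.log_le_log h ht
    rw [Real.log_mul (by positivity) (Real.exp_pos _).ne', Real.log_exp] at this
    linarith

end Semiflow

/-- If `x` has relatively compact orbit under a `C¹`-smooth semiflow and
`ω(x,Φ) = {e}` for a linearly stable equilibrium `e`, then `λ₁(x,Φ) ≤ 0`; in
particular `λ_max(x,Φ) ≤ 0`. -/
theorem flow_lambdaOne_nonpos_of_omega_stable_equilibrium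
    {X : Type*} [NormedAddCommGroup X] [NormedSpace ℝ X]
    (Φ : ℝ → X → X) (hΦ : IsSemiflow Φ)
    (hC1 : ∀ t : ℝ, 0 < t → ContDiff ℝ 1 (Φ t))
    (x : X) (horb : IsCompact (closure {y : X | ∃ t : ℝ, 0 ≤ t ∧ y = Φ t x}))
    (e : X) (he : ∀ t : ℝ, 0 ≤ t → Φ t e = e)
    (hstab : lambdaOneFlow Φ e ≤ 0)
    (hω : omegaFlow Φ x = {e}) :
    lambdaOneFlow Φ x ≤ 0 ∧ lambdaMaxFlow Φ x ≤ 0 := by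
  have h := lambdaOneFlow_nonpos_of_tendsto hΦ hC1
    (tendsto_of_omegaFlow_eq_singleton horb hω) hstab
  exact ⟨h, (liminf_le_limsup).trans h⟩

end
end
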